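/- arXiv:2204.03587 — 4 statements merged into one kernel-verified Lean document; each statement's English description precedes it below -/
import Mathlib

section
/- Let M ⊂ ℝ² be a bounded open connected set with smooth boundary, equipped with Lebesgue measure λ. For every bistochastic kernel K on M there exists a sequence (φ_n) of C^∞ diffeomorphisms of M preserving λ such that for every continuous function f : closure(M) × closure(M) → ℝ one has ∫_M f(x, φ_n(x)) dλ(x) → ∫_M ∫_M f(x,y) dκ_x(y) dλ(x) as n → ∞. -/
open MeasureTheory ProbabilityTheory

/-- A bistochastic kernel on a measure space `(X, μ)`. -/
def IsBistochastic {X : Type*} [MeasurableSpace X] (μ : Measure X)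
    (κ : Kernel X X) : Prop :=
  IsMarkovKernel κ ∧ ∀ A : Set X, MeasurableSet A → ∫⁻ x, κ x A ∂μ = μ A

/-- `M` has smooth boundary: it is the sublevel set of a smooth defining function
whose differential does not vanish on the boundary. -/
def HasSmoothBoundary (M : Set (ℝ × ℝ)) : Prop :=
  ∃ f : ℝ × ℝ → ℝ, ContDiff ℝ (⊤ : ℕ∞) f ∧ M = {x | f x < 0} ∧
    ∀ x ∈ frontier M, fderiv ℝ f x ≠ 0

/-- A `C^∞` diffeomorphism of `M` preserving Lebesgue measure. -/
def IsSmoothAPDiffeo (M : Set (ℝ × ℝ)) (φ : ℝ × ℝ → ℝ × ℝ) : Prop :=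
  Set.BijOn φ M M ∧ ContDiffOn ℝ (⊤ : ℕ∞) φ M ∧
    (∃ ψ : ℝ × ℝ → ℝ × ℝ, ContDiffOn ℝ (⊤ : ℕ∞) ψ M ∧ (∀ x ∈ M, ψ (φ x) = x) ∧
      ∀ x ∈ M, φ (ψ x) = x) ∧
    MeasurePreserving φ (volume.restrict M) (volume.restrict M)


open Set Filter Topology

namespace BA

def IsAD (M : Set (ℝ × ℝ)) (φ : ℝ × ℝ → ℝ × ℝ) : Prop :=
  ContDiff ℝ (⊤ : ℕ∞) φ ∧
    (∃ ψ : ℝ × ℝ → ℝ × ℝ, ContDiff ℝ (⊤ : ℕ∞) ψ ∧ (∀ x, ψ (φ x) = x) ∧ (∀ x, φ (ψ x) = x)) ∧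
    MeasurePreserving φ volume volume ∧ ∀ x, x ∉ M → φ x = x

lemma IsAD.mono {M N : Set (ℝ × ℝ)} (h : M ⊆ N) {φ} (hφ : IsAD M φ) : IsAD N φ :=
  ⟨hφ.1, hφ.2.1, hφ.2.2.1, fun x hx => hφ.2.2.2 x (fun h' => hx (h h'))⟩

lemma IsAD.id (M : Set (ℝ × ℝ)) : IsAD M (fun x => x) :=
  ⟨contDiff_id, ⟨fun x => x, contDiff_id, fun _ => rfl, fun _ => rfl⟩,
    MeasurePreserving.id _, fun _ _ => rfl⟩

lemma IsAD.comp {M : Set (ℝ × ℝ)} {φ φ'} (h : IsAD M φ) (h' : IsAD M φ') :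
    IsAD M (fun x => φ (φ' x)) := by
  obtain ⟨a, ⟨ψ, b1, b2, b3⟩, c, d⟩ := h
  obtain ⟨a', ⟨ψ', b1', b2', b3'⟩, c', d'⟩ := h'
  refine ⟨a.comp a', ⟨fun x => ψ' (ψ x), b1'.comp b1, ?_, ?_⟩, c.comp c', ?_⟩
  · intro x; simp only [b2, b2']
  · intro x; simp only [b3, b3']
  · intro x hx; simp only [d' x hx, d x hx]

lemma IsAD.mem_iff {M : Set (ℝ × ℝ)} {φ} (h : IsAD M φ) (x : ℝ × ℝ) : φ x ∈ M ↔ x ∈ M := by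
  obtain ⟨a, ⟨ψ, b1, b2, b3⟩, c, d⟩ := h
  constructor
  · intro hx
    by_contra h'
    rw [d x h'] at hx
    exact h' hx
  · intro hx
    by_contra h'
    have h1 := d _ h'
    have h2 : φ x = x := by
      have := congrArg ψ h1
      rwa [b2, b2] at this
    rw [h2] at h'
    exact h' hx

lemma IsAD.isSmooth {M : Set (ℝ × ℝ)} (hM : IsOpen M) {φ} (h : IsAD M φ) :
    IsSmoothAPDiffeo M φ := by
  have hm := h.mem_iff
  obtain ⟨a, ⟨ψ, b1, b2, b3⟩, c, d⟩ := h
  refine ⟨⟨fun x hx => (hm x).2 hx, fun x _ y _ hxy => ?_, fun x hx => ⟨ψ x, ?_, b3 x⟩⟩,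
    a.contDiffOn, ⟨ψ, b1.contDiffOn, fun x _ => b2 x, fun x _ => b3 x⟩, ?_⟩
  · rw [← b2 x, ← b2 y, hxy]
  · rw [← hm, b3]; exact hx
  · have := c.restrict_preimage hM.measurableSet
    have h2 : φ ⁻¹' M = M := by ext x; exact hm x
    rwa [h2] at this

lemma det2 (a b c d : ℝ) :
    ((a • ContinuousLinearMap.fst ℝ ℝ ℝ + b • ContinuousLinearMap.snd ℝ ℝ ℝ).prod
        (c • ContinuousLinearMap.fst ℝ ℝ ℝ + d • ContinuousLinearMap.snd ℝ ℝ ℝ)).det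
      = a * d - b * c := by
  rw [← Matrix.toLin_finTwoProd_toContinuousLinearMap]
  simp only [LinearMap.det_toContinuousLinearMap, LinearMap.det_toLin, Matrix.det_fin_two_of]

lemma mp_of_det {φ : ℝ × ℝ → ℝ × ℝ} (hb : Function.Bijective φ) (hd : Differentiable ℝ φ)
    (hdet : ∀ x, (fderiv ℝ φ x).det = 1) : MeasurePreserving φ volume volume := by
  refine ⟨hd.continuous.measurable, ?_⟩
  ext s hs
  rw [Measure.map_apply hd.continuous.measurable hs]
  have := lintegral_abs_det_fderiv_eq_addHaar_image volume (f := φ) (f' := fderiv ℝ φ)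
    (hd.continuous.measurable hs) (fun x _ => (hd x).hasFDerivAt.hasFDerivWithinAt) hb.1.injOn
  rw [image_preimage_eq _ hb.2] at this
  simpa [hdet] using this

noncomputable def tw (α : ℝ → ℝ) (p : ℝ × ℝ) : ℝ × ℝ :=
  (p.1 * Real.cos (α (p.1 ^ 2 + p.2 ^ 2)) - p.2 * Real.sin (α (p.1 ^ 2 + p.2 ^ 2)),
   p.1 * Real.sin (α (p.1 ^ 2 + p.2 ^ 2)) + p.2 * Real.cos (α (p.1 ^ 2 + p.2 ^ 2)))

lemma tw_norm (α : ℝ → ℝ) (p : ℝ × ℝ) :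
    (tw α p).1 ^ 2 + (tw α p).2 ^ 2 = p.1 ^ 2 + p.2 ^ 2 := by
  simp only [tw]
  linear_combination (p.1 ^ 2 + p.2 ^ 2) * Real.sin_sq_add_cos_sq (α (p.1 ^ 2 + p.2 ^ 2))

lemma tw_neg (α : ℝ → ℝ) (p : ℝ × ℝ) : tw (fun s => - α s) (tw α p) = p := by
  have h := tw_norm α p
  rw [tw, h]
  have h2 := Real.sin_sq_add_cos_sq (α (p.1 ^ 2 + p.2 ^ 2))
  ext
  · simp only [tw, Real.cos_neg, Real.sin_neg]
    linear_combination p.1 * h2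
  · simp only [tw, Real.cos_neg, Real.sin_neg]
    linear_combination p.2 * h2

lemma tw_zero (α : ℝ → ℝ) (p : ℝ × ℝ) (h : α (p.1 ^ 2 + p.2 ^ 2) = 0) : tw α p = p := by
  simp [tw, h]

lemma tw_pi (α : ℝ → ℝ) (p : ℝ × ℝ) (h : α (p.1 ^ 2 + p.2 ^ 2) = Real.pi) : tw α p = -p := by
  ext <;> simp [tw, h]

lemma tw_smooth {α : ℝ → ℝ} (h : ContDiff ℝ (⊤ : ℕ∞) α) : ContDiff ℝ (⊤ : ℕ∞) (tw α) := by
  unfold tw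
  have h1 : ContDiff ℝ (⊤ : ℕ∞) (fun p : ℝ × ℝ => α (p.1 ^ 2 + p.2 ^ 2)) :=
    h.comp ((contDiff_fst.pow 2).add (contDiff_snd.pow 2))
  exact ((contDiff_fst.mul h1.cos).sub (contDiff_snd.mul h1.sin)).prodMk
    ((contDiff_fst.mul h1.sin).add (contDiff_snd.mul h1.cos))

lemma tw_det {α : ℝ → ℝ} (h : ContDiff ℝ (⊤ : ℕ∞) α) (p : ℝ × ℝ) :
    (fderiv ℝ (tw α) p).det = 1 := by
  set s := p.1 ^ 2 + p.2 ^ 2 with hs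
  have hα : HasDerivAt α (deriv α s) s :=
    ((h.differentiable (by simp)) s).hasDerivAt
  have h1 : HasFDerivAt (fun p : ℝ × ℝ => p.1 ^ 2 + p.2 ^ 2)
      ((2 * p.1) • ContinuousLinearMap.fst ℝ ℝ ℝ + (2 * p.2) • ContinuousLinearMap.snd ℝ ℝ ℝ) p := by
    convert! ((hasFDerivAt_fst (𝕜 := ℝ) (p := p)).pow 2).add
      ((hasFDerivAt_snd (𝕜 := ℝ) (p := p)).pow 2) using 1
    simp
  have hA := hα.comp_hasFDerivAt p h1
  have hc := (Real.hasDerivAt_cos (α s)).comp_hasFDerivAt p hA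
  have hsn := (Real.hasDerivAt_sin (α s)).comp_hasFDerivAt p hA
  have hx : HasFDerivAt (fun p : ℝ × ℝ => p.1) (ContinuousLinearMap.fst ℝ ℝ ℝ) p := hasFDerivAt_fst
  have hy : HasFDerivAt (fun p : ℝ × ℝ => p.2) (ContinuousLinearMap.snd ℝ ℝ ℝ) p := hasFDerivAt_snd
  have e1 := ((hx.mul hc).sub (hy.mul hsn)).prodMk ((hx.mul hsn).add (hy.mul hc))
  have e2 : HasFDerivAt (tw α) _ p := e1
  set C := Real.cos (α s) with hC
  set S := Real.sin (α s) with hS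
  set d := deriv α s
  have e3 : fderiv ℝ (tw α) p =
    (((C - 2 * p.1 * d * (p.1 * S + p.2 * C)) • ContinuousLinearMap.fst ℝ ℝ ℝ
      + (-S - 2 * p.2 * d * (p.1 * S + p.2 * C)) • ContinuousLinearMap.snd ℝ ℝ ℝ).prod
        ((S + 2 * p.1 * d * (p.1 * C - p.2 * S)) • ContinuousLinearMap.fst ℝ ℝ ℝ
          + (C + 2 * p.2 * d * (p.1 * C - p.2 * S)) • ContinuousLinearMap.snd ℝ ℝ ℝ)) := by
    rw [e2.fderiv]
    ext <;> simp [← hs, ← hC, ← hS] <;> ring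
  rw [e3, det2]
  linear_combination Real.sin_sq_add_cos_sq (α s)

def D : Set (ℝ × ℝ) := {p | p.1 ^ 2 + p.2 ^ 2 < 1}

lemma isOpen_D : IsOpen D := isOpen_lt (by fun_prop) (by fun_prop)

lemma isCompact_disc (r : ℝ) : IsCompact {p : ℝ × ℝ | p.1 ^ 2 + p.2 ^ 2 ≤ r} := by
  refine Metric.isCompact_of_isClosed_isBounded (isClosed_le (by fun_prop) (by fun_prop)) ?_
  refine (Metric.isBounded_closedBall (x := (0 : ℝ × ℝ)) (r := |r| + 1)).subset ?_
  intro p hp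
  have hp : p.1 ^ 2 + p.2 ^ 2 ≤ r := hp
  have := le_abs_self r
  rw [mem_closedBall_zero_iff, Prod.norm_def, max_le_iff, Real.norm_eq_abs, Real.norm_eq_abs]
  constructor
  · refine abs_le_of_sq_le_sq ?_ (by positivity)
    nlinarith [sq_nonneg p.2, abs_nonneg r]
  · refine abs_le_of_sq_le_sq ?_ (by positivity)
    nlinarith [sq_nonneg p.1, abs_nonneg r]

open Classical in
noncomputable def cj (R : Set (ℝ × ℝ)) (Φ Ψ : ℝ × ℝ → ℝ × ℝ) (α : ℝ → ℝ) (z : ℝ × ℝ) : ℝ × ℝ :=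
  if z ∈ R then Φ (tw α (Ψ z)) else z

structure Cd (R : Set (ℝ × ℝ)) (Φ Ψ : ℝ × ℝ → ℝ × ℝ) (c : ℝ) : Prop where
  op : IsOpen R
  fin : volume R < ⊤
  sΦ : ContDiffOn ℝ (⊤ : ℕ∞) Φ D
  sΨ : ContDiffOn ℝ (⊤ : ℕ∞) Ψ R
  mΦ : ∀ p ∈ D, Φ p ∈ R
  mΨ : ∀ p ∈ R, Ψ p ∈ D
  ΨΦ : ∀ p ∈ D, Ψ (Φ p) = p
  ΦΨ : ∀ p ∈ R, Φ (Ψ p) = p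
  hc : c ≠ 0
  det : ∀ p ∈ D, (fderiv ℝ Φ p).det = c

lemma tw_mem {α : ℝ → ℝ} {p} (h : p ∈ D) : tw α p ∈ D := by
  change (tw α p).1 ^ 2 + (tw α p).2 ^ 2 < 1
  rw [tw_norm]; exact h

section
variable {R : Set (ℝ × ℝ)} {Φ Ψ : ℝ × ℝ → ℝ × ℝ} {c : ℝ}

lemma cj_inv (H : Cd R Φ Ψ c) (α : ℝ → ℝ) (z) :
    cj R Φ Ψ (fun s => -α s) (cj R Φ Ψ α z) = z := by
  by_cases hz : z ∈ R
  · have h1 := H.mΦ _ (tw_mem (α := α) (H.mΨ z hz))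
    simp only [cj, hz, if_true, h1]
    rw [H.ΨΦ _ (tw_mem (H.mΨ z hz)), tw_neg, H.ΦΨ z hz]
  · simp [cj, hz]

lemma cj_id (H : Cd R Φ Ψ c) {α : ℝ → ℝ} {r : ℝ} (h0 : ∀ s, r ≤ s → α s = 0) {z}
    (hz : z ∉ Φ '' {p : ℝ × ℝ | p.1 ^ 2 + p.2 ^ 2 ≤ r}) : cj R Φ Ψ α z = z := by
  by_cases hz' : z ∈ R
  · simp only [cj, hz', if_true]
    rw [tw_zero, H.ΦΨ z hz']
    apply h0
    by_contra! h
    exact hz ⟨Ψ z, h.le, H.ΦΨ z hz'⟩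
  · simp [cj, hz']

lemma cj_closed (H : Cd R Φ Ψ c) {r : ℝ} (hr : r < 1) :
    IsClosed (Φ '' {p : ℝ × ℝ | p.1 ^ 2 + p.2 ^ 2 ≤ r}) :=
  ((isCompact_disc r).image_of_continuousOn
    (H.sΦ.continuousOn.mono (fun _ hp => lt_of_le_of_lt hp hr))).isClosed

lemma cj_smooth (H : Cd R Φ Ψ c) {α : ℝ → ℝ} (hα : ContDiff ℝ (⊤ : ℕ∞) α) {r : ℝ} (hr : r < 1)
    (h0 : ∀ s, r ≤ s → α s = 0) : ContDiff ℝ (⊤ : ℕ∞) (cj R Φ Ψ α) := by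
  rw [contDiff_iff_contDiffAt]
  intro z
  by_cases hz : z ∈ R
  · have h1 : ContDiffAt ℝ (⊤ : ℕ∞) (fun z => Φ (tw α (Ψ z))) z := by
      have a := H.sΨ.contDiffAt (H.op.mem_nhds hz)
      have b := (tw_smooth hα).contDiffAt (x := Ψ z)
      have c := H.sΦ.contDiffAt (isOpen_D.mem_nhds (tw_mem (α := α) (H.mΨ z hz)))
      exact c.comp z (b.comp z a)
    refine h1.congr_of_eventuallyEq ?_
    filter_upwards [H.op.mem_nhds hz] with w hw
    simp [cj, hw]
  · refine contDiffAt_id.congr_of_eventuallyEq ?_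
    have : z ∉ Φ '' {p : ℝ × ℝ | p.1 ^ 2 + p.2 ^ 2 ≤ r} := by
      rintro ⟨p, hp, rfl⟩
      exact hz (H.mΦ p (lt_of_le_of_lt hp hr))
    filter_upwards [(cj_closed H hr).isOpen_compl.mem_nhds this] with w hw
    exact cj_id H h0 hw

lemma cj_det (H : Cd R Φ Ψ c) {α : ℝ → ℝ} (hα : ContDiff ℝ (⊤ : ℕ∞) α) {r : ℝ} (hr : r < 1)
    (h0 : ∀ s, r ≤ s → α s = 0) (z) : (fderiv ℝ (cj R Φ Ψ α) z).det = 1 := by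
  have hsm := cj_smooth H hα hr h0
  by_cases hz : z ∈ R
  · set p := Ψ z with hp
    have hpD : p ∈ D := H.mΨ z hz
    have hzp : Φ p = z := H.ΦΨ z hz
    have dΦ : ∀ q ∈ D, HasFDerivAt Φ (fderiv ℝ Φ q) q := fun q hq =>
      ((H.sΦ.contDiffAt (isOpen_D.mem_nhds hq)).differentiableAt (by simp)).hasFDerivAt
    have dT : HasFDerivAt (tw α) (fderiv ℝ (tw α) p) p :=
      (((tw_smooth hα).differentiable (by simp)) p).hasFDerivAt
    have dc : HasFDerivAt (cj R Φ Ψ α) (fderiv ℝ (cj R Φ Ψ α) z) (Φ p) := by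
      rw [hzp]; exact ((hsm.differentiable (by simp)) z).hasFDerivAt
    have e1 := dc.comp p (dΦ p hpD)
    have e2 := (dΦ _ (tw_mem (α := α) hpD)).comp p dT
    have e3 : HasFDerivAt (cj R Φ Ψ α ∘ Φ) _ p := e2.congr_of_eventuallyEq (by
      filter_upwards [isOpen_D.mem_nhds hpD] with q hq
      simp [cj, H.mΦ q hq, H.ΨΦ q hq])
    have e4 := congrArg ContinuousLinearMap.det (e1.unique e3)
    simp only [ContinuousLinearMap.det, ContinuousLinearMap.toLinearMap_comp, LinearMap.det_comp] at e4
    have k1 := H.det p hpD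
    have k2 := H.det _ (tw_mem (α := α) hpD)
    have k3 := tw_det hα p
    simp only [ContinuousLinearMap.det] at k1 k2 k3 ⊢
    rw [k1, k2, k3] at e4
    have := H.hc
    field_simp at e4
    linarith
  · have : z ∉ Φ '' {p : ℝ × ℝ | p.1 ^ 2 + p.2 ^ 2 ≤ r} := by
      rintro ⟨p, hp, rfl⟩
      exact hz (H.mΦ p (lt_of_le_of_lt hp hr))
    have e : cj R Φ Ψ α =ᶠ[𝓝 z] id := by
      filter_upwards [(cj_closed H hr).isOpen_compl.mem_nhds this] with w hw
      exact cj_id H h0 hw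
    rw [e.fderiv_eq, fderiv_id]
    simp [ContinuousLinearMap.det]

lemma cj_AD (H : Cd R Φ Ψ c) {α : ℝ → ℝ} (hα : ContDiff ℝ (⊤ : ℕ∞) α) {r : ℝ} (hr : r < 1)
    (h0 : ∀ s, r ≤ s → α s = 0) : IsAD R (cj R Φ Ψ α) := by
  have i1 := cj_inv H α
  have i2 : ∀ z, cj R Φ Ψ α (cj R Φ Ψ (fun s => -α s) z) = z := by
    intro z
    have := cj_inv H (fun s => -α s) z
    simpa using this
  have sm := cj_smooth H hα hr h0
  refine ⟨sm, ⟨_, cj_smooth H hα.neg hr (fun s hs => by simp [h0 s hs]), i1, i2⟩, ?_, ?_⟩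
  · exact mp_of_det ⟨Function.LeftInverse.injective i1, Function.RightInverse.surjective i2⟩
      (sm.differentiable (by simp)) (cj_det H hα hr h0)
  · intro x hx; simp [cj, hx]

lemma exists_rot (H : Cd R Φ Ψ c) {ε : ENNReal} (hε : 0 < ε) :
    ∃ φ, IsAD R φ ∧ volume {z | z ∈ R ∧ φ z ≠ Φ (-Ψ z)} ≤ ε := by
  let A : ℕ → Set (ℝ × ℝ) := fun n => {z | z ∈ R ∧ 1 - 2 / ((n : ℝ) + 1) < (Ψ z).1 ^ 2 + (Ψ z).2 ^ 2}
  have hlim : Tendsto (fun n : ℕ => 1 - 2 / ((n : ℝ) + 1)) atTop (𝓝 1) := by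
    have := (tendsto_one_div_add_atTop_nhds_zero_nat (𝕜 := ℝ)).const_mul 2
    have := this.const_sub 1
    simpa [div_eq_mul_inv] using this
  have hAm : ∀ n, MeasurableSet (A n) := by
    intro n
    have : IsOpen (R ∩ (fun z => (Ψ z).1 ^ 2 + (Ψ z).2 ^ 2) ⁻¹' Ioi (1 - 2 / ((n : ℝ) + 1))) := by
      refine ContinuousOn.isOpen_inter_preimage ?_ H.op isOpen_Ioi
      have := H.sΨ.continuousOn
      fun_prop
    exact this.measurableSet
  have hA : Tendsto (fun n => volume (A n)) atTop (𝓝 0) := by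
    have : Antitone A := by
      intro m n hmn z hz
      refine ⟨hz.1, lt_of_le_of_lt ?_ hz.2⟩
      gcongr
    have h2 := tendsto_measure_iInter_atTop (μ := volume) (s := A)
      (fun n => (hAm n).nullMeasurableSet) this
      ⟨0, ((measure_mono (fun z hz => hz.1)).trans_lt H.fin).ne⟩
    have h3 : (⋂ n, A n) = ∅ := by
      ext z
      simp only [mem_iInter, mem_empty_iff_false, iff_false]
      intro hz
      have hzD : (Ψ z).1 ^ 2 + (Ψ z).2 ^ 2 < 1 := H.mΨ z (hz 0).1
      obtain ⟨n, hn⟩ := ((hlim.eventually (lt_mem_nhds hzD)).exists)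
      exact absurd (hz n).2 (not_lt.2 hn.le)
    rwa [h3, measure_empty] at h2
  obtain ⟨n, hn⟩ := (hA.eventually (ge_mem_nhds hε)).exists
  have hn0 : (0 : ℝ) < n + 1 := by positivity
  set α : ℝ → ℝ := fun s => Real.pi * Real.smoothTransition ((1 - 1 / ((n : ℝ) + 1) - s) * (n + 1))
    with hαd
  have hα : ContDiff ℝ (⊤ : ℕ∞) α := by
    refine contDiff_const.mul (Real.smoothTransition.contDiff.comp ?_)
    fun_prop
  refine ⟨cj R Φ Ψ α, cj_AD H hα (r := 1 - 1 / ((n : ℝ) + 1)) ?_ ?_, le_trans (measure_mono ?_) hn⟩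
  · have : 0 < 1 / ((n : ℝ) + 1) := by positivity
    linarith
  · intro s hs
    simp only [hαd]
    rw [Real.smoothTransition.zero_of_nonpos, mul_zero]
    exact mul_nonpos_of_nonpos_of_nonneg (by linarith) hn0.le
  · rintro z ⟨hz, hne⟩
    refine ⟨hz, ?_⟩
    by_contra! h
    apply hne
    simp only [cj, hz, if_true]
    rw [tw_pi]
    simp only [hαd]
    rw [Real.smoothTransition.one_of_one_le, mul_one]
    have e : (2 : ℝ) / (n + 1) = 1 / (n + 1) + 1 / (n + 1) := by ring
    have : 1 / ((n : ℝ) + 1) ≤ 1 - 1 / ((n : ℝ) + 1) - ((Ψ z).1 ^ 2 + (Ψ z).2 ^ 2) := by linarith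
    calc (1 : ℝ) = 1 / ((n : ℝ) + 1) * (n + 1) := by field_simp
      _ ≤ _ := by gcongr
end


noncomputable def gf (x : ℝ) : ℝ := x + Real.sin x * Real.cos x

lemma gf_mono : StrictMono gf := by
  intro x y hxy
  have h1 : gf y - gf x = (y - x) + Real.sin (y - x) * Real.cos (x + y) := by
    simp only [gf, Real.sin_sub, Real.cos_add]
    have a := Real.sin_sq_add_cos_sq x
    have b := Real.sin_sq_add_cos_sq y
    linear_combination (-Real.sin y * Real.cos y) * a + (Real.sin x * Real.cos x) * b
  have h2 : |Real.sin (y - x)| < |y - x| := Real.abs_sin_lt_abs (by linarith)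
  rw [abs_of_pos (by linarith : 0 < y - x)] at h2
  have h3 : |Real.sin (y - x) * Real.cos (x + y)| ≤ |Real.sin (y - x)| := by
    rw [abs_mul]
    exact mul_le_of_le_one_right (abs_nonneg _) (Real.abs_cos_le_one _)
  have h4 := neg_abs_le (Real.sin (y - x) * Real.cos (x + y))
  linarith

lemma gf_smooth : ContDiff ℝ (⊤ : ℕ∞) gf := by
  unfold gf
  exact contDiff_id.add (Real.contDiff_sin.mul Real.contDiff_cos)

lemma gf_bd (x : ℝ) : x - 1 ≤ gf x ∧ gf x ≤ x + 1 := by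
  have h : |Real.sin x * Real.cos x| ≤ 1 := by
    rw [abs_mul]
    exact mul_le_one₀ (Real.abs_sin_le_one _) (abs_nonneg _) (Real.abs_cos_le_one _)
  rw [abs_le] at h
  unfold gf
  constructor <;> linarith

lemma gf_surj : Function.Surjective gf := by
  apply gf_smooth.continuous.surjective
  · exact tendsto_atTop_mono (fun x => (gf_bd x).1) (tendsto_atTop_add_const_right _ _ tendsto_id)
  · exact tendsto_atBot_mono (fun x => (gf_bd x).2) (tendsto_atBot_add_const_right _ _ tendsto_id)

noncomputable def gi : ℝ ≃o ℝ := StrictMono.orderIsoOfSurjective gf gf_mono gf_surj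

lemma gi_apply (x) : gi x = gf x := rfl
lemma gi_symm (x) : gf (gi.symm x) = x := gi.apply_symm_apply x
lemma symm_gi (x) : gi.symm (gf x) = x := gi.symm_apply_apply x

lemma gf_pi : gf (Real.pi / 2) = Real.pi / 2 := by simp [gf]
lemma gf_neg (x) : gf (-x) = - gf x := by simp [gf]; ring

lemma gf_deriv (x) : HasDerivAt gf (2 * Real.cos x ^ 2) x := by
  have := (hasDerivAt_id x).add ((Real.hasDerivAt_sin x).mul (Real.hasDerivAt_cos x))
  refine HasDerivAt.congr_deriv this ?_
  have a := Real.sin_sq_add_cos_sq x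
  simp
  linear_combination -a

lemma gi_mem {u : ℝ} (hu : u ∈ Ioo (-(Real.pi / 2)) (Real.pi / 2)) :
    gi.symm u ∈ Ioo (-(Real.pi / 2)) (Real.pi / 2) := by
  constructor
  · rw [← gf_mono.lt_iff_lt, gi_symm, gf_neg, gf_pi]; exact hu.1
  · rw [← gf_mono.lt_iff_lt, gi_symm, gf_pi]; exact hu.2

lemma gi_smooth {u : ℝ} (hu : u ∈ Ioo (-(Real.pi / 2)) (Real.pi / 2)) :
    ContDiffAt ℝ (⊤ : ℕ∞) (fun u => gi.symm u) u := by
  have h := gi_mem hu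
  refine OpenPartialHomeomorph.contDiffAt_symm_deriv (f := gi.toHomeomorph.toOpenPartialHomeomorph)
    (f₀' := 2 * Real.cos (gi.symm u) ^ 2) ?_ (by simp) ?_ ?_
  · have := Real.cos_pos_of_mem_Ioo h
    positivity
  · exact gf_deriv _
  · exact gf_smooth.contDiffAt

def rect (a b s t : ℝ) : Set (ℝ × ℝ) := Ioo (a - s) (a + s) ×ˢ Ioo (b - t) (b + t)

noncomputable def PhiR (a b s t : ℝ) (p : ℝ × ℝ) : ℝ × ℝ :=
  (a + s * (2 / Real.pi) * gf (Real.arcsin p.1), b + t * (p.2 / √(1 - p.1 ^ 2)))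

noncomputable def PsiR (a b s t : ℝ) (z : ℝ × ℝ) : ℝ × ℝ :=
  (Real.sin (gi.symm (Real.pi / 2 * ((z.1 - a) / s))),
    (z.2 - b) / t * Real.cos (gi.symm (Real.pi / 2 * ((z.1 - a) / s))))

lemma PhiR_neg (a b s t : ℝ) (p : ℝ × ℝ) :
    PhiR a b s t (-p) = (2 * a - (PhiR a b s t p).1, 2 * b - (PhiR a b s t p).2) := by
  ext
  · simp [PhiR, Real.arcsin_neg, gf_neg]; ring
  · simp [PhiR]; ring

lemma D_aux {p : ℝ × ℝ} (hp : p ∈ D) : -1 < p.1 ∧ p.1 < 1 ∧ 0 < 1 - p.1 ^ 2 ∧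
    |p.2| < √(1 - p.1 ^ 2) := by
  have h : p.1 ^ 2 + p.2 ^ 2 < 1 := hp
  have h1 : p.1 ^ 2 < 1 := by nlinarith [sq_nonneg p.2]
  have h2 := abs_lt.1 ((sq_lt_one_iff_abs_lt_one _).1 h1)
  refine ⟨h2.1, h2.2, by linarith, ?_⟩
  apply Real.lt_sqrt_of_sq_lt
  rw [sq_abs]; linarith

lemma u_mem {a s x : ℝ} (hs : 0 < s) (hx : x ∈ Ioo (a - s) (a + s)) :
    Real.pi / 2 * ((x - a) / s) ∈ Ioo (-(Real.pi / 2)) (Real.pi / 2) := by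
  have h1 : -1 < (x - a) / s := by rw [lt_div_iff₀ hs]; linarith [hx.1]
  have h2 : (x - a) / s < 1 := by rw [div_lt_iff₀ hs]; linarith [hx.2]
  have := Real.pi_pos
  constructor <;> nlinarith

lemma sqrt_sin {x : ℝ} (h : x ∈ Ioo (-(Real.pi / 2)) (Real.pi / 2)) :
    √(1 - Real.sin x ^ 2) = Real.cos x := by
  rw [← Real.cos_eq_sqrt_one_sub_sin_sq h.1.le h.2.le]

lemma Cd_rect (a b : ℝ) {s t : ℝ} (hs : 0 < s) (ht : 0 < t) :
    Cd (rect a b s t) (PhiR a b s t) (PsiR a b s t) (s * (2 / Real.pi) * 2 * t) where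
  op := isOpen_Ioo.prod isOpen_Ioo
  fin := by
    refine ((Metric.isBounded_Ioo _ _).prod (Metric.isBounded_Ioo _ _)).measure_lt_top
  sΦ := by
    intro p hp
    obtain ⟨h1, h2, h3, h4⟩ := D_aux hp
    refine ContDiffAt.contDiffWithinAt ?_
    unfold PhiR
    have e1 : ContDiffAt ℝ (⊤ : ℕ∞) (fun p : ℝ × ℝ => Real.arcsin p.1) p :=
      (Real.contDiffAt_arcsin h1.ne' h2.ne).comp p contDiffAt_fst
    have e2 : ContDiffAt ℝ (⊤ : ℕ∞) (fun p : ℝ × ℝ => gf (Real.arcsin p.1)) p :=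
      gf_smooth.contDiffAt.comp p e1
    have e3 : ContDiffAt ℝ (⊤ : ℕ∞) (fun p : ℝ × ℝ => √(1 - p.1 ^ 2)) p :=
      (contDiffAt_const.sub (contDiffAt_fst.pow 2)).sqrt h3.ne'
    exact (contDiffAt_const.add (contDiffAt_const.mul e2)).prodMk
      (contDiffAt_const.add (contDiffAt_const.mul (contDiffAt_snd.div e3 (Real.sqrt_pos.2 h3).ne')))
  sΨ := by
    intro z hz
    have hu := u_mem hs hz.1
    refine ContDiffAt.contDiffWithinAt ?_
    unfold PsiR
    have e0 : ContDiffAt ℝ (⊤ : ℕ∞) (fun z : ℝ × ℝ => Real.pi / 2 * ((z.1 - a) / s)) z := by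
      fun_prop
    have e1 : ContDiffAt ℝ (⊤ : ℕ∞)
        (fun z : ℝ × ℝ => gi.symm (Real.pi / 2 * ((z.1 - a) / s))) z :=
      ContDiffAt.comp (g := fun u => gi.symm u) z (gi_smooth hu) e0
    exact e1.sin.prodMk (((contDiffAt_snd.sub contDiffAt_const).div_const t).mul e1.cos)
  mΦ := by
    intro p hp
    obtain ⟨h1, h2, h3, h4⟩ := D_aux hp
    have hq := Real.sqrt_pos.2 h3
    have k1 := Real.neg_pi_div_two_lt_arcsin.2 h1
    have k2 := Real.arcsin_lt_pi_div_two.2 h2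
    have k3 := gf_mono k1
    have k4 := gf_mono k2
    rw [gf_neg, gf_pi] at k3
    rw [gf_pi] at k4
    have hpi := Real.pi_pos
    have k5 : s * (2 / Real.pi) * (Real.pi / 2) = s := by field_simp
    have k6 : 0 < s * (2 / Real.pi) := by positivity
    have k7 := mul_lt_mul_of_pos_left k3 k6
    have k8 := mul_lt_mul_of_pos_left k4 k6
    have k9 : |p.2 / √(1 - p.1 ^ 2)| < 1 := by
      rw [abs_div, abs_of_pos hq, div_lt_one hq]; exact h4
    rw [abs_lt] at k9
    refine ⟨⟨?_, ?_⟩, ⟨?_, ?_⟩⟩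
    · simp only [PhiR]; linarith
    · simp only [PhiR]; linarith
    · simp only [PhiR]; nlinarith
    · simp only [PhiR]; nlinarith
  mΨ := by
    intro z hz
    have hu := gi_mem (u_mem hs hz.1)
    have hc := Real.cos_pos_of_mem_Ioo hu
    have hy : ((z.2 - b) / t) ^ 2 < 1 := by
      rw [sq_lt_one_iff_abs_lt_one, abs_lt, lt_div_iff₀ ht, div_lt_iff₀ ht]
      constructor <;> linarith [hz.2.1, hz.2.2]
    change (PsiR a b s t z).1 ^ 2 + (PsiR a b s t z).2 ^ 2 < 1
    simp only [PsiR]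
    rw [mul_pow]
    have := Real.sin_sq_add_cos_sq (gi.symm (Real.pi / 2 * ((z.1 - a) / s)))
    nlinarith [sq_pos_of_pos hc]
  ΨΦ := by
    intro p hp
    obtain ⟨h1, h2, h3, h4⟩ := D_aux hp
    have hq := Real.sqrt_pos.2 h3
    have hpi := Real.pi_pos
    have e : Real.pi / 2 * (((PhiR a b s t p).1 - a) / s) = gf (Real.arcsin p.1) := by
      simp only [PhiR]; field_simp; ring
    have e' : ((PhiR a b s t p).2 - b) / t = p.2 / √(1 - p.1 ^ 2) := by
      simp only [PhiR]; field_simp; ring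
    unfold PsiR
    rw [e, e', symm_gi, Real.sin_arcsin h1.le h2.le, Real.cos_arcsin, div_mul_cancel₀ _ hq.ne']
  ΦΨ := by
    intro z hz
    have hu := gi_mem (u_mem hs hz.1)
    have hc := Real.cos_pos_of_mem_Ioo hu
    have hpi := Real.pi_pos
    unfold PhiR
    simp only [PsiR]
    rw [Real.arcsin_sin hu.1.le hu.2.le, gi_symm, sqrt_sin hu]
    ext
    · simp only; field_simp; ring
    · simp only
      rw [mul_div_assoc, div_self hc.ne', mul_one]
      field_simp; ring
  hc := by have := Real.pi_pos; positivity
  det := by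
    intro p hp
    obtain ⟨h1, h2, h3, h4⟩ := D_aux hp
    have hq := Real.sqrt_pos.2 h3
    have hpi := Real.pi_pos
    have ha := (gf_deriv (Real.arcsin p.1)).comp p.1 (Real.hasDerivAt_arcsin h1.ne' h2.ne)
    have hx : HasFDerivAt (fun p : ℝ × ℝ => p.1) (ContinuousLinearMap.fst ℝ ℝ ℝ) p := hasFDerivAt_fst
    have hy : HasFDerivAt (fun p : ℝ × ℝ => p.2) (ContinuousLinearMap.snd ℝ ℝ ℝ) p := hasFDerivAt_snd
    have hb : DifferentiableAt ℝ (fun x : ℝ => (√(1 - x ^ 2))⁻¹) p.1 := by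
      refine DifferentiableAt.inv (DifferentiableAt.sqrt (by fun_prop) h3.ne') hq.ne'
    have hb' := hb.hasDerivAt.comp_hasFDerivAt p hx
    have e1 : HasFDerivAt (PhiR a b s t) _ p :=
      (((ha.comp_hasFDerivAt p hx).const_mul (s * (2 / Real.pi))).const_add a).prodMk
        (((hy.mul hb').const_mul t).const_add b)
    have e3 : fderiv ℝ (PhiR a b s t) p =
      (((s * (2 / Real.pi) * (2 * √(1 - p.1 ^ 2))) • ContinuousLinearMap.fst ℝ ℝ ℝ
        + (0 : ℝ) • ContinuousLinearMap.snd ℝ ℝ ℝ).prod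
        ((t * p.2 * deriv (fun x : ℝ => (√(1 - x ^ 2))⁻¹) p.1) • ContinuousLinearMap.fst ℝ ℝ ℝ
          + (t * (√(1 - p.1 ^ 2))⁻¹) • ContinuousLinearMap.snd ℝ ℝ ℝ)) := by
      rw [e1.fderiv]
      have : √(1 - p.1 ^ 2) ^ 2 * (√(1 - p.1 ^ 2))⁻¹ = √(1 - p.1 ^ 2) := by field_simp
      ext
      · simp [Real.cos_arcsin]
        left
        rw [mul_assoc 2, this]
      · simp [mul_assoc]
      · simp
      · simp
    rw [e3, det2]
    field_simp
    ring

lemma exists_rot_rect (a b : ℝ) {s t : ℝ} (hs : 0 < s) (ht : 0 < t) {ε : ENNReal} (hε : 0 < ε) :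
    ∃ φ, IsAD (rect a b s t) φ ∧
      volume {z | z ∈ rect a b s t ∧ φ z ≠ (2 * a - z.1, 2 * b - z.2)} ≤ ε := by
  have H := Cd_rect a b hs ht
  obtain ⟨φ, h1, h2⟩ := exists_rot H hε
  refine ⟨φ, h1, le_trans (measure_mono ?_) h2⟩
  rintro z ⟨hz, hne⟩
  refine ⟨hz, ?_⟩
  rwa [PhiR_neg, H.ΦΨ z hz]


noncomputable def ci (L : ℕ) (x : ℝ × ℝ) : ℤ × ℤ := (⌊x.1 * L⌋, ⌊x.2 * L⌋)

lemma ci_meas (L : ℕ) : Measurable (ci L) := by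
  unfold ci
  exact (Int.measurable_floor.comp (measurable_fst.mul_const _)).prodMk
    (Int.measurable_floor.comp (measurable_snd.mul_const _))

def Appr (M : Set (ℝ × ℝ)) (L : ℕ) (σ : Equiv.Perm (ℤ × ℤ)) : Prop :=
  ∀ ε : ENNReal, 0 < ε → ∃ φ, IsAD M φ ∧ volume {x | x ∈ M ∧ ci L (φ x) ≠ σ (ci L x)} ≤ ε

lemma bad_meas {M : Set (ℝ × ℝ)} (hM : IsOpen M) (L : ℕ) (σ : Equiv.Perm (ℤ × ℤ)) {φ}
    (hφ : IsAD M φ) : MeasurableSet {x | x ∈ M ∧ ci L (φ x) ≠ σ (ci L x)} := by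
  refine hM.measurableSet.inter (MeasurableSet.compl ?_)
  refine measurableSet_eq_fun ((ci_meas L).comp hφ.1.continuous.measurable) ?_
  exact (Measurable.of_discrete (f := σ)).comp (ci_meas L)

lemma Appr.one (M : Set (ℝ × ℝ)) (L : ℕ) : Appr M L 1 := by
  intro ε hε
  exact ⟨_, IsAD.id M, by simp⟩

lemma Appr.mul {M : Set (ℝ × ℝ)} (hM : IsOpen M) {L : ℕ} {σ τ} (h : Appr M L σ)
    (h' : Appr M L τ) : Appr M L (σ * τ) := by
  intro ε hε
  obtain ⟨φ, a, b⟩ := h (ε / 2) (ENNReal.half_pos hε.ne')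
  obtain ⟨φ', a', b'⟩ := h' (ε / 2) (ENNReal.half_pos hε.ne')
  refine ⟨_, a.comp a', ?_⟩
  have hm := a'.2.2.1.measure_preimage (bad_meas hM L σ a).nullMeasurableSet
  calc _ ≤ volume ({x | x ∈ M ∧ ci L (φ' x) ≠ τ (ci L x)} ∪
        φ' ⁻¹' {x | x ∈ M ∧ ci L (φ x) ≠ σ (ci L x)}) := by
        apply measure_mono
        rintro x ⟨hx, hne⟩
        by_cases h1 : ci L (φ' x) = τ (ci L x)
        · right
          refine ⟨(a'.mem_iff x).2 hx, ?_⟩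
          rw [h1]; exact hne
        · left; exact ⟨hx, h1⟩
    _ ≤ _ := measure_union_le _ _
    _ ≤ ε / 2 + ε / 2 := by rw [hm]; gcongr
    _ = ε := ENNReal.add_halves ε

def Rel (M : Set (ℝ × ℝ)) (L : ℕ) (i j : ℤ × ℤ) : Prop := Appr M L (Equiv.swap i j)

lemma Rel.refl (M : Set (ℝ × ℝ)) (L : ℕ) (i) : Rel M L i i := by
  unfold Rel
  rw [Equiv.swap_self]; exact Appr.one M L

lemma Rel.symm {M : Set (ℝ × ℝ)} {L : ℕ} {i j} (h : Rel M L i j) : Rel M L j i := by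
  unfold Rel
  rw [Equiv.swap_comm]; exact h

lemma Rel.trans {M : Set (ℝ × ℝ)} (hM : IsOpen M) {L : ℕ} {i j k} (h : Rel M L i j)
    (h' : Rel M L j k) : Rel M L i k := by
  by_cases h1 : i = j
  · rwa [h1]
  by_cases h2 : i = k
  · rw [h2]; exact Rel.refl M L k
  by_cases h3 : j = k
  · rwa [← h3]
  have := Equiv.swap_mul_swap_mul_swap (x := i) (y := j) (z := k) h1 h2
  apply Rel.symm
  unfold Rel
  rw [← this]
  exact (h'.mul hM h).mul hM h'

lemma null_lines (L : ℕ) (hL : 0 < L) :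
    volume {x : ℝ × ℝ | (∃ m : ℤ, x.1 * L = m) ∨ (∃ m : ℤ, x.2 * L = m)} = 0 := by
  have hL' : (L : ℝ) ≠ 0 := by positivity
  have h0 : volume {x : ℝ | ∃ m : ℤ, x * L = m} = 0 := by
    refine Set.Countable.measure_zero ((countable_range (fun m : ℤ => (m : ℝ) / L)).mono ?_) _
    rintro x ⟨m, hm⟩
    exact ⟨m, by simp only [← hm]; field_simp⟩
  have e : {x : ℝ × ℝ | (∃ m : ℤ, x.1 * L = m) ∨ (∃ m : ℤ, x.2 * L = m)} =
    ({x : ℝ | ∃ m : ℤ, x * L = m} ×ˢ univ) ∪ (univ ×ˢ {x : ℝ | ∃ m : ℤ, x * L = m}) := by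
    ext x; simp
  rw [e, measure_union_null_iff, Measure.volume_eq_prod, Measure.prod_prod, Measure.prod_prod, h0]
  simp

lemma floor_refl (X : ℝ) (n : ℤ) (h : ¬ ∃ m : ℤ, X = m) : ⌊(n : ℝ) - X⌋ = n - 1 - ⌊X⌋ := by
  rw [Int.floor_eq_iff]
  have h1 := Int.floor_le X
  have h2 := Int.lt_floor_add_one X
  have h3 : (⌊X⌋ : ℝ) ≠ X := fun h' => h ⟨_, h'.symm⟩
  have h4 := lt_of_le_of_ne h1 h3
  push_cast
  constructor <;> linarith

lemma Rel.adj {M : Set (ℝ × ℝ)} {L : ℕ} (hL : 0 < L) (k w : ℤ × ℤ)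
    (hw : w = (2, 1) ∨ w = (1, 2)) (h1 : ci L ⁻¹' {k} ⊆ M)
    (h2 : ci L ⁻¹' {(k.1 + w.1 - 1, k.2 + w.2 - 1)} ⊆ M) :
    Rel M L k (k.1 + w.1 - 1, k.2 + w.2 - 1) := by
  intro ε hε
  have hL' : (0 : ℝ) < L := by positivity
  have w1 : (0 : ℝ) < w.1 := by rcases hw with rfl | rfl <;> norm_num
  have w2 : (0 : ℝ) < w.2 := by rcases hw with rfl | rfl <;> norm_num
  obtain ⟨φ, hφ, hv⟩ := exists_rot_rect ((k.1 + w.1 / 2) / L) ((k.2 + w.2 / 2) / L)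
    (s := w.1 / 2 / L) (t := w.2 / 2 / L) (by positivity) (by positivity) hε
  set R := rect ((k.1 + w.1 / 2 : ℝ) / L) ((k.2 + w.2 / 2 : ℝ) / L) (w.1 / 2 / L) (w.2 / 2 / L)
    with hR
  have memR : ∀ z : ℝ × ℝ, z ∈ R ↔ ((k.1 : ℝ) < z.1 * L ∧ z.1 * L < k.1 + w.1) ∧
      ((k.2 : ℝ) < z.2 * L ∧ z.2 * L < k.2 + w.2) := by
    intro z
    have e1 : (k.1 + w.1 / 2 : ℝ) / L - w.1 / 2 / L = k.1 / L := by ring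
    have e2 : (k.1 + w.1 / 2 : ℝ) / L + w.1 / 2 / L = (k.1 + w.1) / L := by ring
    have e3 : (k.2 + w.2 / 2 : ℝ) / L - w.2 / 2 / L = k.2 / L := by ring
    have e4 : (k.2 + w.2 / 2 : ℝ) / L + w.2 / 2 / L = (k.2 + w.2) / L := by ring
    rw [hR, rect, e1, e2, e3, e4, mem_prod, mem_Ioo, mem_Ioo, div_lt_iff₀ hL', lt_div_iff₀ hL',
      div_lt_iff₀ hL', lt_div_iff₀ hL']
  have fl : ∀ z ∈ R, (k.1 ≤ ⌊z.1 * L⌋ ∧ ⌊z.1 * L⌋ < k.1 + w.1) ∧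
      (k.2 ≤ ⌊z.2 * L⌋ ∧ ⌊z.2 * L⌋ < k.2 + w.2) := by
    intro z hz
    obtain ⟨⟨a, b⟩, c, d⟩ := (memR z).1 hz
    refine ⟨⟨Int.le_floor.2 a.le, Int.floor_lt.2 ?_⟩, Int.le_floor.2 c.le, Int.floor_lt.2 ?_⟩
    · push_cast; exact b
    · push_cast; exact d
  have hRM : R ⊆ M := by
    intro z hz
    obtain ⟨⟨a, b⟩, c, d⟩ := fl z hz
    have : ci L z = k ∨ ci L z = (k.1 + w.1 - 1, k.2 + w.2 - 1) := by
      unfold ci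
      rcases hw with rfl | rfl <;> simp only [Prod.ext_iff] at * <;> omega
    rcases this with h | h
    · exact h1 h
    · exact h2 h
  refine ⟨φ, hφ.mono hRM, ?_⟩
  calc _ ≤ volume ({x : ℝ × ℝ | (∃ m : ℤ, x.1 * L = m) ∨ (∃ m : ℤ, x.2 * L = m)} ∪ _) :=
        measure_mono (t := _ ∪ {z | z ∈ R ∧ φ z ≠ (2 * ((k.1 + w.1 / 2 : ℝ) / L) - z.1,
          2 * ((k.2 + w.2 / 2 : ℝ) / L) - z.2)}) ?_
    _ ≤ _ := measure_union_le _ _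
    _ ≤ ε := by rw [null_lines L hL, zero_add]; exact hv
  rintro z ⟨hzM, hne⟩
  by_contra hcon
  simp only [mem_union, mem_ofPred_eq, not_or, not_and, not_not] at hcon
  obtain ⟨⟨n1, n2⟩, hrot⟩ := hcon
  apply hne
  by_cases hz : z ∈ R
  · obtain ⟨⟨a, b⟩, c, d⟩ := fl z hz
    have f1 := floor_refl _ (2 * k.1 + w.1) n1
    have f2 := floor_refl _ (2 * k.2 + w.2) n2
    have e : ci L (φ z) = (2 * k.1 + w.1 - 1 - ⌊z.1 * L⌋, 2 * k.2 + w.2 - 1 - ⌊z.2 * L⌋) := by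
      rw [hrot hz, ← f1, ← f2, ci]
      congr 2
      · push_cast; field_simp
      · push_cast; field_simp
    rw [e]
    have : ci L z = k ∨ ci L z = (k.1 + w.1 - 1, k.2 + w.2 - 1) := by
      unfold ci
      rcases hw with rfl | rfl <;> simp only [Prod.ext_iff] at * <;> omega
    rcases this with h | h
    · rw [h, Equiv.swap_apply_left]
      have g1 : ⌊z.1 * L⌋ = k.1 := congrArg Prod.fst h
      have g2 : ⌊z.2 * L⌋ = k.2 := congrArg Prod.snd h
      rw [g1, g2]; ext <;> simp only <;> ring
    · rw [h, Equiv.swap_apply_right]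
      have g1 : ⌊z.1 * L⌋ = k.1 + w.1 - 1 := congrArg Prod.fst h
      have g2 : ⌊z.2 * L⌋ = k.2 + w.2 - 1 := congrArg Prod.snd h
      rw [g1, g2]; ext <;> simp only <;> ring
  · rw [hφ.2.2.2 z hz]
    symm
    have key : ¬ ((k.1 ≤ ⌊z.1 * L⌋ ∧ ⌊z.1 * L⌋ < k.1 + w.1) ∧
      (k.2 ≤ ⌊z.2 * L⌋ ∧ ⌊z.2 * L⌋ < k.2 + w.2)) := by
      rintro ⟨⟨a, b⟩, c, d⟩
      apply hz
      rw [memR]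
      rw [Int.le_floor] at a c
      rw [Int.floor_lt] at b d
      push_cast at b d
      refine ⟨⟨lt_of_le_of_ne a ?_, b⟩, lt_of_le_of_ne c ?_, d⟩
      · exact fun h => n1 ⟨_, h.symm⟩
      · exact fun h => n2 ⟨_, h.symm⟩
    apply Equiv.swap_apply_of_ne_of_ne
    · intro h
      have g1 : ⌊z.1 * L⌋ = k.1 := congrArg Prod.fst h
      have g2 : ⌊z.2 * L⌋ = k.2 := congrArg Prod.snd h
      apply key
      rcases hw with rfl | rfl <;> simp only <;> omega
    · intro h
      have g1 : ⌊z.1 * L⌋ = k.1 + w.1 - 1 := congrArg Prod.fst h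
      have g2 : ⌊z.2 * L⌋ = k.2 + w.2 - 1 := congrArg Prod.snd h
      apply key
      rcases hw with rfl | rfl <;> simp only at * <;> omega

lemma Rel.box {M : Set (ℝ × ℝ)} (hM : IsOpen M) {L : ℕ} (hL : 0 < L) (a b : ℤ × ℤ)
    (h : ∀ k : ℤ × ℤ, a.1 ≤ k.1 → k.1 ≤ b.1 → a.2 ≤ k.2 → k.2 ≤ b.2 → ci L ⁻¹' {k} ⊆ M)
    (i j : ℤ × ℤ) (hi : (a.1 ≤ i.1 ∧ i.1 ≤ b.1) ∧ (a.2 ≤ i.2 ∧ i.2 ≤ b.2))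
    (hj : (a.1 ≤ j.1 ∧ j.1 ≤ b.1) ∧ (a.2 ≤ j.2 ∧ j.2 ≤ b.2)) : Rel M L i j := by
  have H : ∀ y, a.2 ≤ y → y ≤ b.2 → ∀ n : ℕ, a.1 + n ≤ b.1 → Rel M L (a.1, y) (a.1 + n, y) := by
    intro y h1 h2 n
    induction n with
    | zero => intro _; simpa using Rel.refl M L _
    | succ n ih =>
      intro hn
      push_cast at hn
      refine (ih (by omega)).trans hM ?_
      have := Rel.adj hL (a.1 + n, y) (2, 1) (Or.inl rfl)
        (h _ (by simp) (by simp only; omega) h1 h2)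
        (h _ (by simp only; omega) (by simp only; omega) (by simp only; omega)
          (by simp only; omega)) (M := M)
      convert this using 2
      · simp only; push_cast; ring
      · simp
  have V : ∀ n : ℕ, a.2 + n ≤ b.2 → a.1 ≤ b.1 → Rel M L (a.1, a.2) (a.1, a.2 + n) := by
    intro n
    induction n with
    | zero => intro _ _; simpa using Rel.refl M L _
    | succ n ih =>
      intro hn h0
      push_cast at hn
      refine (ih (by omega) h0).trans hM ?_
      have := Rel.adj hL (a.1, a.2 + n) (1, 2) (Or.inr rfl)
        (h _ (by simp) (by simp only; omega) (by simp only; omega) (by simp only; omega))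
        (h _ (by simp only; omega) (by simp only; omega) (by simp only; omega)
          (by simp only; omega)) (M := M)
      convert this using 2
      · simp
      · simp only; push_cast; ring
  have C : ∀ i : ℤ × ℤ, (a.1 ≤ i.1 ∧ i.1 ≤ b.1) ∧ (a.2 ≤ i.2 ∧ i.2 ≤ b.2) →
      Rel M L (a.1, a.2) i := by
    intro i hi
    have h1 := V (i.2 - a.2).toNat (by omega) (by omega)
    have h2 := H i.2 (by omega) (by omega) (i.1 - a.1).toNat (by omega)
    rw [Int.toNat_of_nonneg (by omega)] at h1 h2
    simp only [add_sub_cancel] at h1 h2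
    exact h1.trans hM h2
  exact (C i hi).symm.trans hM (C j hj)


lemma one_dim_aux {x y z L r : ℝ} (hL : 0 < L) (hxy : |y - x| < r / 2) (hr : 2 / r < L) (hr0 : 0 < r)
    (h1 : min ⌊x * L⌋ ⌊y * L⌋ ≤ ⌊z * L⌋) (h2 : ⌊z * L⌋ ≤ max ⌊x * L⌋ ⌊y * L⌋) :
    |z - x| < r := by
  rw [div_lt_iff₀ hr0] at hr
  have a1 := Int.floor_le (x * L)
  have a2 := Int.lt_floor_add_one (x * L)
  have b1 := Int.floor_le (y * L)
  have b2 := Int.lt_floor_add_one (y * L)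
  have c1 := Int.floor_le (z * L)
  have c2 := Int.lt_floor_add_one (z * L)
  rw [abs_lt] at hxy ⊢
  have d1 := mul_lt_mul_of_pos_right hxy.1 hL
  have d2 := mul_lt_mul_of_pos_right hxy.2 hL
  have e1 : z * L < x * L + r * L := by
    rcases le_max_iff.1 h2 with h | h
    · have : (⌊z * L⌋ : ℝ) ≤ ⌊x * L⌋ := by exact_mod_cast h
      nlinarith
    · have : (⌊z * L⌋ : ℝ) ≤ ⌊y * L⌋ := by exact_mod_cast h
      nlinarith
  have e2 : x * L - r * L < z * L := by
    rcases min_le_iff.1 h1 with h | h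
    · have : (⌊x * L⌋ : ℝ) ≤ ⌊z * L⌋ := by exact_mod_cast h
      nlinarith
    · have : (⌊y * L⌋ : ℝ) ≤ ⌊z * L⌋ := by exact_mod_cast h
      nlinarith
  constructor
  · by_contra! hh
    nlinarith
  · by_contra! hh
    nlinarith

lemma conn {M : Set (ℝ × ℝ)} (hM : IsOpen M) (hc : IsPreconnected M) {x y : ℝ × ℝ}
    (hx : x ∈ M) (hy : y ∈ M) : ∃ L0 : ℕ, ∀ L : ℕ, L0 ≤ L → 0 < L → Rel M L (ci L x) (ci L y) := by
  refine hc.induction₂ (fun x y => ∃ L0 : ℕ, ∀ L : ℕ, L0 ≤ L → 0 < L → Rel M L (ci L x) (ci L y))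
    ?_ ?_ ?_ hx hy
  · intro x hx
    obtain ⟨r, hr, hb⟩ := Metric.isOpen_iff.1 hM x hx
    apply mem_nhdsWithin_of_mem_nhds
    filter_upwards [Metric.ball_mem_nhds x (half_pos hr)] with y hy
    obtain ⟨L0, hL0⟩ := exists_nat_gt (2 / r)
    refine ⟨L0, fun L hL hpos => ?_⟩
    have hL' : (0 : ℝ) < L := by positivity
    have hLr : 2 / r < L := lt_of_lt_of_le hL0 (by exact_mod_cast hL)
    rw [Metric.mem_ball, Prod.dist_eq, max_lt_iff, Real.dist_eq, Real.dist_eq] at hy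
    refine Rel.box hM hpos (min (ci L x).1 (ci L y).1, min (ci L x).2 (ci L y).2)
      (max (ci L x).1 (ci L y).1, max (ci L x).2 (ci L y).2) ?_ _ _ (by simp) (by simp)
    intro k k1 k2 k3 k4 z hz
    have hz : ci L z = k := hz
    subst hz
    apply hb
    rw [Metric.mem_ball, Prod.dist_eq, max_lt_iff, Real.dist_eq, Real.dist_eq]
    exact ⟨one_dim_aux hL' hy.1 hLr hr k1 k2, one_dim_aux hL' hy.2 hLr hr k3 k4⟩
  · rintro x y z - - - ⟨L0, h0⟩ ⟨L1, h1⟩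
    exact ⟨max L0 L1, fun L hL hp => (h0 L ((le_max_left _ _).trans hL) hp).trans hM
      (h1 L ((le_max_right _ _).trans hL) hp)⟩
  · rintro x y - - ⟨L0, h0⟩
    exact ⟨L0, fun L hL hp => (h0 L hL hp).symm⟩

lemma ci_div (N p : ℕ) (hp : 0 < p) (z : ℝ × ℝ) :
    ((ci (N * p) z).1 / (p : ℤ), (ci (N * p) z).2 / (p : ℤ)) = ci N z := by
  have h : ∀ x : ℝ, ⌊x * ((N * p : ℕ) : ℝ)⌋ / (p : ℤ) = ⌊x * N⌋ := by
    intro x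
    have := Int.mul_cast_floor_div_cancel_of_pos (n := (p : ℤ)) (by exact_mod_cast hp) (x * N)
    rw [← this]
    push_cast
    rw [mul_assoc]
  simp only [ci, h]

lemma appr_perm {M : Set (ℝ × ℝ)} (hM : IsOpen M) {L : ℕ} (X : Finset (ℤ × ℤ))
    (h : ∀ i ∈ X, ∀ j ∈ X, Rel M L i j) (σ : Equiv.Perm {x // x ∈ X}) :
    Appr M L (Equiv.Perm.ofSubtype σ) := by
  induction σ using Equiv.Perm.swap_induction_on with
  | one => rw [map_one]; exact Appr.one M L
  | swap_mul f x y hxy ih =>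
    rw [map_mul, Equiv.Perm.ofSubtype_swap_eq]
    exact Appr.mul hM (h _ x.2 _ y.2) ih

lemma ci_rep {N : ℕ} (hN : 0 < N) (i : ℤ × ℤ) : ci N ((i.1 : ℝ) / N, (i.2 : ℝ) / N) = i := by
  have : (N : ℝ) ≠ 0 := by positivity
  simp [ci, div_mul_cancel₀ _ this]

lemma rel_fine {M : Set (ℝ × ℝ)} (hM : IsOpen M) (hc : IsPreconnected M) {N : ℕ} (hN : 0 < N)
    (F : Finset (ℤ × ℤ)) (hF : ∀ i ∈ F, ci N ⁻¹' {i} ⊆ M) :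
    ∃ p0 : ℕ, ∀ p : ℕ, p0 ≤ p → 0 < p → ∀ k k' : ℤ × ℤ, (k.1 / (p : ℤ), k.2 / (p : ℤ)) ∈ F →
      (k'.1 / (p : ℤ), k'.2 / (p : ℤ)) ∈ F → Rel M (N * p) k k' := by
  let x : ℤ × ℤ → ℝ × ℝ := fun i => ((i.1 : ℝ) / N, (i.2 : ℝ) / N)
  have hxM : ∀ i ∈ F, x i ∈ M := fun i hi => hF i hi (ci_rep hN i)
  have H : ∀ q : (ℤ × ℤ) × (ℤ × ℤ), ∃ L0 : ℕ, q.1 ∈ F → q.2 ∈ F → ∀ L : ℕ, L0 ≤ L → 0 < L →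
      Rel M L (ci L (x q.1)) (ci L (x q.2)) := by
    intro q
    by_cases h1 : q.1 ∈ F
    · by_cases h2 : q.2 ∈ F
      · obtain ⟨L0, h⟩ := conn hM hc (hxM _ h1) (hxM _ h2)
        exact ⟨L0, fun _ _ => h⟩
      · exact ⟨0, fun _ h => absurd h h2⟩
    · exact ⟨0, fun h => absurd h h1⟩
  choose L0 hL0 using H
  refine ⟨(F ×ˢ F).sup L0, fun p hp hp0 => ?_⟩
  have hL : 0 < N * p := by positivity
  have hpi : (0 : ℤ) < p := by exact_mod_cast hp0
  have B : ∀ k : ℤ × ℤ, (k.1 / (p : ℤ), k.2 / (p : ℤ)) ∈ F →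
      Rel M (N * p) k (ci (N * p) (x (k.1 / (p : ℤ), k.2 / (p : ℤ)))) := by
    intro k hk
    have bd : ∀ m : ℤ, m / p * p ≤ m ∧ m ≤ m / p * p + (p - 1) := by
      intro m
      have := Int.ediv_mul_add_emod m p
      have h1 := Int.emod_nonneg m hpi.ne'
      have h2 := Int.emod_lt_of_pos m hpi
      omega
    set i : ℤ × ℤ := (k.1 / (p : ℤ), k.2 / (p : ℤ)) with hi
    refine Rel.box hM hL (i.1 * p, i.2 * p) (i.1 * p + (p - 1), i.2 * p + (p - 1)) ?_ _ _ ?_ ?_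
    · intro m h1 h2 h3 h4 z hz
      have hz : ci (N * p) z = m := hz
      refine hF i hk ?_
      have e := ci_div N p hp0 z
      rw [hz] at e
      change ci N z = i
      rw [← e]
      have q1 : m.1 / p = i.1 := by
        rw [Int.ediv_eq_iff_of_pos hpi]; simp only at h1 h2; constructor <;> nlinarith
      have q2 : m.2 / p = i.2 := by
        rw [Int.ediv_eq_iff_of_pos hpi]; simp only at h3 h4; constructor <;> nlinarith
      ext
      · exact q1
      · exact q2
    · exact ⟨bd _, bd _⟩
    · have e := ci_div N p hp0 (x i)
      rw [ci_rep hN] at e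
      have e1 : (ci (N * p) (x i)).1 / (p : ℤ) = i.1 := congrArg Prod.fst e
      have e2 : (ci (N * p) (x i)).2 / (p : ℤ) = i.2 := congrArg Prod.snd e
      rw [← e1, ← e2]
      exact ⟨bd _, bd _⟩
  intro k k' hk hk'
  refine (B k hk).trans hM (Rel.trans hM ?_ (B k' hk').symm)
  refine hL0 (_, _) hk hk' _ ?_ hL
  refine (Finset.le_sup (f := L0) (Finset.mk_mem_product hk hk')).trans (hp.trans ?_)
  exact Nat.le_mul_of_pos_left p hN


lemma comb {ι β : Type*} [DecidableEq ι] [DecidableEq β] (F : Finset ι) (n : ι → ι → ℕ) (K : ℕ)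
    (row : ∀ i ∈ F, ∑ j ∈ F, n i j ≤ K) (col : ∀ j ∈ F, ∑ i ∈ F, n i j ≤ K)
    (c : β → ι) (X : Finset β) (hX : ∀ i ∈ F, K ≤ (X.filter (fun k => c k = i)).card) :
    ∃ (σ : Equiv.Perm {x // x ∈ X}) (U : (Σ i : F, Σ j : F, Fin (n i j)) → {x // x ∈ X}),
      Function.Injective U ∧ (∀ t, c (U t) = t.1) ∧ (∀ t, c (σ (U t)) = t.2.1) := by
  have hu : ∀ i : F, Nonempty ((Σ j : F, Fin (n i j)) ↪ (X.filter (fun k => c k = i))) := by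
    intro i
    apply Function.Embedding.nonempty_of_card_le
    rw [Fintype.card_sigma, Fintype.card_coe]
    simp only [Fintype.card_fin]
    refine le_trans ?_ (hX i i.2)
    rw [Finset.sum_coe_sort F (fun j => n i j)]
    exact row i i.2
  have hv : ∀ j : F, Nonempty ((Σ i : F, Fin (n i j)) ↪ (X.filter (fun k => c k = j))) := by
    intro j
    apply Function.Embedding.nonempty_of_card_le
    rw [Fintype.card_sigma, Fintype.card_coe]
    simp only [Fintype.card_fin]
    refine le_trans ?_ (hX j j.2)
    rw [Finset.sum_coe_sort F (fun i => n i j)]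
    exact col j j.2
  let u := fun i => (hu i).some
  let v := fun j => (hv j).some
  let U : (Σ i : F, Σ j : F, Fin (n i j)) → {x // x ∈ X} := fun t =>
    ⟨(u t.1 t.2).1, (Finset.mem_filter.1 (u t.1 t.2).2).1⟩
  let V : (Σ i : F, Σ j : F, Fin (n i j)) → β := fun t => (v t.2.1 ⟨t.1, t.2.2⟩).1
  have cU : ∀ t, c (U t) = t.1 := fun t => (Finset.mem_filter.1 (u t.1 t.2).2).2
  have cV : ∀ t, c (V t) = t.2.1 := fun t => (Finset.mem_filter.1 (v t.2.1 ⟨t.1, t.2.2⟩).2).2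
  have iU : Function.Injective U := by
    rintro ⟨i, t⟩ ⟨i', t'⟩ h
    have h1 : i = i' := by
      have a := cU ⟨i, t⟩
      rw [h, cU] at a
      exact (Subtype.ext a).symm
    subst h1
    have h2 : u i t = u i t' := Subtype.ext (congrArg (fun z : {x // x ∈ X} => (z : β)) h)
    rw [(u i).injective h2]
  have iV : Function.Injective V := by
    rintro ⟨i, j, t⟩ ⟨i', j', t'⟩ h
    have h1 : j = j' := by
      have a := cV ⟨i, j, t⟩
      rw [h, cV] at a
      exact (Subtype.ext a).symm
    subst h1
    have h2 : v j ⟨i, t⟩ = v j ⟨i', t'⟩ := Subtype.ext h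
    have h3 := (v j).injective h2
    cases h3
    rfl
  have mV : ∀ t, V t ∈ X := fun t => (Finset.mem_filter.1 (v t.2.1 ⟨t.1, t.2.2⟩).2).1
  by_cases hT : Nonempty (Σ i : F, Σ j : F, Fin (n i j))
  · obtain ⟨g, hg⟩ := Finset.exists_equiv_extend_of_card_eq (α := {x // x ∈ X}) (t := X) (by simp)
      (s := Finset.univ.image U) (f := fun k => V (Function.invFun U k)) (by
        intro b hb
        simp only [Finset.mem_image] at hb
        obtain ⟨k, -, rfl⟩ := hb
        exact mV _) (by
        intro k hk k' hk' h
        simp only [Finset.coe_image, Finset.coe_univ, Set.image_univ, Set.mem_range] at hk hk'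
        obtain ⟨t, rfl⟩ := hk
        obtain ⟨t', rfl⟩ := hk'
        simp only [Function.leftInverse_invFun iU _] at h
        rw [iV h])
    refine ⟨g, U, iU, cU, fun t => ?_⟩
    have := hg (U t) (Finset.mem_image_of_mem _ (Finset.mem_univ t))
    rw [Function.leftInverse_invFun iU t] at this
    rw [this, cV]
  · rw [not_nonempty_iff] at hT
    exact ⟨1, U, iU, cU, fun t => hT.elim t⟩

lemma cell_vol {L : ℕ} (hL : 0 < L) (k : ℤ × ℤ) :
    volume (ci L ⁻¹' {k}) = ENNReal.ofReal (1 / (L : ℝ) ^ 2) := by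
  have hL' : (0 : ℝ) < L := by positivity
  have e : ci L ⁻¹' {k} = Ico (k.1 / L : ℝ) ((k.1 + 1) / L) ×ˢ Ico (k.2 / L : ℝ) ((k.2 + 1) / L) := by
    ext z
    rw [mem_preimage, mem_singleton_iff, mem_prod, mem_Ico, mem_Ico, div_le_iff₀ hL',
      lt_div_iff₀ hL', div_le_iff₀ hL', lt_div_iff₀ hL', Prod.ext_iff]
    simp only [ci, Int.floor_eq_iff]
  rw [e, Measure.volume_eq_prod, Measure.prod_prod, Real.volume_Ico, Real.volume_Ico,
    ← ENNReal.ofReal_mul]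
  · congr 1; field_simp; ring
  · rw [← sub_div, add_sub_cancel_left]; positivity

lemma finite_cells {M : Set (ℝ × ℝ)} (hb : Bornology.IsBounded M) {N : ℕ} (hN : 0 < N) :
    {i : ℤ × ℤ | ci N ⁻¹' {i} ⊆ M}.Finite := by
  obtain ⟨R, hR⟩ := hb.subset_closedBall 0
  have hN' : (0 : ℝ) < N := by positivity
  obtain ⟨K, hK⟩ := exists_nat_gt (R * N)
  refine ((finite_Icc (-(K : ℤ)) K).prod (finite_Icc (-(K : ℤ)) K)).subset ?_
  intro i hi
  have h1 := hR (hi (ci_rep hN i))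
  rw [mem_closedBall_zero_iff, Prod.norm_def, max_le_iff, Real.norm_eq_abs, Real.norm_eq_abs,
    abs_div, abs_div, abs_of_pos hN', div_le_iff₀ hN', div_le_iff₀ hN'] at h1
  have h2 := abs_le.1 (h1.1.trans hK.le)
  have h3 := abs_le.1 (h1.2.trans hK.le)
  refine ⟨⟨?_, ?_⟩, ?_, ?_⟩
  · exact_mod_cast h2.1
  · exact_mod_cast h2.2
  · exact_mod_cast h3.1
  · exact_mod_cast h3.2

def CC (N : ℕ) (i j : ℤ × ℤ) : Set ((ℝ × ℝ) × (ℝ × ℝ)) := (ci N ⁻¹' {i}) ×ˢ (ci N ⁻¹' {j})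

lemma CC_meas (N i j) : MeasurableSet (CC N i j) :=
  (ci_meas N (measurableSet_singleton _)).prod (ci_meas N (measurableSet_singleton _))

lemma card_box (p : ℕ) (hp : 0 < p) (F : Finset (ℤ × ℤ)) :
    ∃ X : Finset (ℤ × ℤ), (∀ k, k ∈ X ↔ (k.1 / (p : ℤ), k.2 / (p : ℤ)) ∈ F) ∧
      ∀ i ∈ F, p ^ 2 ≤ (X.filter (fun k => (k.1 / (p : ℤ), k.2 / (p : ℤ)) = i)).card := by
  have hpi : (0 : ℤ) < p := by exact_mod_cast hp
  let box : ℤ × ℤ → Finset (ℤ × ℤ) := fun i =>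
    Finset.Ico (i.1 * p) (i.1 * p + p) ×ˢ Finset.Ico (i.2 * p) (i.2 * p + p)
  have hbox : ∀ k i : ℤ × ℤ, k ∈ box i ↔ (k.1 / (p : ℤ), k.2 / (p : ℤ)) = i := by
    intro k i
    simp only [box, Finset.mem_product, Finset.mem_Ico, Prod.ext_iff,
      Int.ediv_eq_iff_of_pos hpi]
  refine ⟨F.biUnion box, ?_, ?_⟩
  · intro k
    simp only [Finset.mem_biUnion, hbox]
    simp
  · intro i hi
    have : (F.biUnion box).filter (fun k => (k.1 / (p : ℤ), k.2 / (p : ℤ)) = i) = box i := by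
      ext k
      simp only [Finset.mem_filter, Finset.mem_biUnion, hbox]
      constructor
      · exact fun h => h.2
      · exact fun h => ⟨⟨i, hi, h⟩, h⟩
    rw [this]
    simp [box, sq]

lemma sum_bound {ι : Type*} (F : Finset ι) (ρ : Measure ((ℝ × ℝ) × (ℝ × ℝ)))
    (A : ι → Set ((ℝ × ℝ) × (ℝ × ℝ))) (hA : ∀ i, MeasurableSet (A i))
    (hd : Pairwise (Function.onFun Disjoint A)) (N p : ℕ) (hN : 0 < N)
    (B : Set ((ℝ × ℝ) × (ℝ × ℝ))) (hB : ∀ i ∈ F, A i ⊆ B)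
    (hρ : ρ B ≤ ENNReal.ofReal (1 / (N : ℝ) ^ 2)) :
    ∑ i ∈ F, ⌊(ρ (A i)).toReal * ((N * p : ℕ) : ℝ) ^ 2⌋₊ ≤ p ^ 2 := by
  have hN' : (0 : ℝ) < N := by positivity
  have hBf : ρ B ≠ ⊤ := ne_top_of_le_ne_top ENNReal.ofReal_ne_top hρ
  have h1 : ∑ i ∈ F, (ρ (A i)).toReal ≤ 1 / (N : ℝ) ^ 2 := by
    rw [← ENNReal.toReal_sum (fun i hi => ne_top_of_le_ne_top hBf (measure_mono (hB i hi))),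
      ← measure_biUnion_finset (fun i _ j _ hij => hd hij) (fun i _ => hA i)]
    refine ENNReal.toReal_le_of_le_ofReal (by positivity) (le_trans (measure_mono ?_) hρ)
    exact iUnion₂_subset hB
  have h2 : ((∑ i ∈ F, ⌊(ρ (A i)).toReal * ((N * p : ℕ) : ℝ) ^ 2⌋₊ : ℕ) : ℝ) ≤ ((p ^ 2 : ℕ) : ℝ) := by
    push_cast
    calc _ ≤ ∑ i ∈ F, (ρ (A i)).toReal * ((N : ℝ) * p) ^ 2 := by
          apply Finset.sum_le_sum
          intro i _
          exact Nat.floor_le (by positivity)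
      _ = (∑ i ∈ F, (ρ (A i)).toReal) * ((N : ℝ) * p) ^ 2 := by rw [Finset.sum_mul]
      _ ≤ 1 / (N : ℝ) ^ 2 * ((N : ℝ) * p) ^ 2 := by gcongr
      _ = (p : ℝ) ^ 2 := by field_simp
  exact_mod_cast h2


lemma main_approx {M : Set (ℝ × ℝ)} (hM : IsOpen M) (hc : IsPreconnected M)
    (hb : Bornology.IsBounded M) (ρ : Measure ((ℝ × ℝ) × (ℝ × ℝ)))
    (h1 : ∀ A : Set (ℝ × ℝ), MeasurableSet A → ρ (A ×ˢ univ) ≤ volume A)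
    (h2 : ∀ A : Set (ℝ × ℝ), MeasurableSet A → ρ (univ ×ˢ A) ≤ volume A)
    {N : ℕ} (hN : 0 < N) (ε : ENNReal) (hε : 0 < ε) :
    ∃ φ, IsAD M φ ∧ ∀ S : Set ((ℤ × ℤ) × (ℤ × ℤ)),
      (∀ q ∈ S, ci N ⁻¹' {q.1} ⊆ M ∧ ci N ⁻¹' {q.2} ⊆ M) →
      ρ {z | (ci N z.1, ci N z.2) ∈ S} ≤ volume {x | x ∈ M ∧ (ci N x, ci N (φ x)) ∈ S} + ε := by
  classical
  have hfin := finite_cells hb hN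
  obtain ⟨F, hF⟩ : ∃ F : Finset (ℤ × ℤ), ∀ i, i ∈ F ↔ ci N ⁻¹' {i} ⊆ M :=
    ⟨hfin.toFinset, fun i => by simp⟩
  obtain ⟨p0, hp0⟩ := rel_fine hM hc hN F (fun i hi => (hF i).1 hi)
  have hε2 : 0 < ε / 2 := ENNReal.half_pos hε.ne'
  -- choose p
  obtain ⟨p, hpp0, hp, hpε⟩ : ∃ p : ℕ, p0 ≤ p ∧ 0 < p ∧
      ((F ×ˢ F).card : ENNReal) * ENNReal.ofReal (1 / ((N * p : ℕ) : ℝ) ^ 2) ≤ ε / 2 := by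
    have t1 : Tendsto (fun p : ℕ => 1 / ((N * p : ℕ) : ℝ) ^ 2) atTop (𝓝 0) := by
      have : Tendsto (fun p : ℕ => ((N * p : ℕ) : ℝ) ^ 2) atTop atTop := by
        refine (tendsto_pow_atTop two_ne_zero).comp (tendsto_natCast_atTop_atTop.comp ?_)
        exact tendsto_id.const_mul_atTop' hN
      exact tendsto_const_nhds.div_atTop this
    have t2 := ENNReal.tendsto_ofReal t1
    rw [ENNReal.ofReal_zero] at t2
    have t3 := ENNReal.Tendsto.const_mul (a := ((F ×ˢ F).card : ENNReal)) t2
      (Or.inr (ENNReal.natCast_ne_top _))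
    rw [mul_zero] at t3
    obtain ⟨p, a, b, c⟩ := ((eventually_ge_atTop p0).and
      ((eventually_gt_atTop 0).and (t3.eventually (gt_mem_nhds hε2)))).exists
    exact ⟨p, a, b, c.le⟩
  have hL : 0 < N * p := Nat.mul_pos hN hp
  obtain ⟨X, hX, hXc⟩ := card_box p hp F
  have cm : ∀ i, MeasurableSet (ci N ⁻¹' {i}) := fun i => ci_meas N (measurableSet_singleton _)
  let n : ℤ × ℤ → ℤ × ℤ → ℕ := fun i j => ⌊(ρ (CC N i j)).toReal * ((N * p : ℕ) : ℝ) ^ 2⌋₊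
  have row : ∀ i ∈ F, ∑ j ∈ F, n i j ≤ p ^ 2 := by
    intro i _
    refine sum_bound F ρ (fun j => CC N i j) (fun j => CC_meas N i j) ?_ N p hN
      ((ci N ⁻¹' {i}) ×ˢ univ) ?_ ?_
    · intro j j' hjj
      rw [Function.onFun, Set.disjoint_left]
      rintro z ⟨-, hz⟩ ⟨-, hz'⟩
      exact hjj (hz.symm.trans hz')
    · exact fun j _ => prod_mono_right (subset_univ _)
    · rw [← cell_vol hN i]; exact h1 _ (cm i)
  have col : ∀ j ∈ F, ∑ i ∈ F, n i j ≤ p ^ 2 := by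
    intro j _
    refine sum_bound F ρ (fun i => CC N i j) (fun i => CC_meas N i j) ?_ N p hN
      (univ ×ˢ (ci N ⁻¹' {j})) ?_ ?_
    · intro i i' hjj
      rw [Function.onFun, Set.disjoint_left]
      rintro z ⟨hz, -⟩ ⟨hz', -⟩
      exact hjj (hz.symm.trans hz')
    · exact fun j _ => prod_mono_left (subset_univ _)
    · rw [← cell_vol hN j]; exact h2 _ (cm j)
  obtain ⟨σ, U, iU, cU, cV⟩ := comb F n (p ^ 2) row col
    (fun k : ℤ × ℤ => (k.1 / (p : ℤ), k.2 / (p : ℤ))) X hXc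
  obtain ⟨φ, hφ, hbad⟩ := appr_perm hM X (fun i hi j hj =>
    hp0 p hpp0 hp i j ((hX i).1 hi) ((hX j).1 hj)) σ (ε / 2) hε2
  refine ⟨φ, hφ, fun S hS => ?_⟩
  set a : ENNReal := ENNReal.ofReal (1 / ((N * p : ℕ) : ℝ) ^ 2) with ha
  let Q := (F ×ˢ F).filter (fun q => q ∈ S)
  let TS : Finset (Σ i : F, Σ j : F, Fin (n i j)) :=
    Finset.univ.filter (fun t => ((t.1 : ℤ × ℤ), (t.2.1 : ℤ × ℤ)) ∈ S)
  have card : TS.card = ∑ q ∈ Q, n q.1 q.2 := by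
    rw [Finset.card_filter, Fintype.sum_sigma, Finset.sum_filter, Finset.sum_product,
      ← Finset.sum_coe_sort F]
    refine Finset.sum_congr rfl fun i _ => ?_
    rw [Fintype.sum_sigma, ← Finset.sum_coe_sort F]
    refine Finset.sum_congr rfl fun j _ => ?_
    by_cases h : ((i : ℤ × ℤ), (j : ℤ × ℤ)) ∈ S <;> simp [h]
  have hn : ∀ i j, ρ (CC N i j) ≤ (n i j + 1 : ℕ) * a := by
    intro i j
    have hf : ρ (CC N i j) ≠ ⊤ := by
      refine ne_top_of_le_ne_top (b := ENNReal.ofReal (1 / (N : ℝ) ^ 2)) ENNReal.ofReal_ne_top ?_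
      rw [← cell_vol hN i]
      exact (measure_mono (prod_mono_right (subset_univ _))).trans (h1 _ (cm i))
    rw [← ENNReal.ofReal_toReal hf, ha, ← ENNReal.ofReal_natCast,
      ← ENNReal.ofReal_mul (by positivity)]
    apply ENNReal.ofReal_le_ofReal
    have hL' : (0 : ℝ) < ((N * p : ℕ) : ℝ) := by exact_mod_cast hL
    rw [mul_one_div, le_div_iff₀ (by positivity)]
    have := (Nat.lt_floor_add_one ((ρ (CC N i j)).toReal * ((N * p : ℕ) : ℝ) ^ 2)).le
    push_cast at this ⊢
    simpa [n] using this
  have up : ρ {z | (ci N z.1, ci N z.2) ∈ S} ≤ TS.card * a + ε / 2 := by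
    calc ρ {z | (ci N z.1, ci N z.2) ∈ S} ≤ ρ (⋃ q ∈ Q, CC N q.1 q.2) := by
          apply measure_mono
          intro z hz
          have hz' : (ci N z.1, ci N z.2) ∈ S := hz
          simp only [mem_iUnion]
          refine ⟨(ci N z.1, ci N z.2), ?_, rfl, rfl⟩
          simp only [Q, Finset.mem_filter, Finset.mem_product]
          exact ⟨⟨(hF _).2 (hS _ hz').1, (hF _).2 (hS _ hz').2⟩, hz'⟩
      _ ≤ ∑ q ∈ Q, ρ (CC N q.1 q.2) := measure_biUnion_finset_le _ _
      _ ≤ ∑ q ∈ Q, ((n q.1 q.2 : ENNReal) * a + a) := by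
          refine Finset.sum_le_sum fun q _ => (hn _ _).trans (le_of_eq ?_)
          push_cast
          rw [add_mul, one_mul]
      _ = TS.card * a + Q.card * a := by
          rw [Finset.sum_add_distrib, ← Finset.sum_mul, card, Finset.sum_const, nsmul_eq_mul]
          push_cast
          rfl
      _ ≤ TS.card * a + ε / 2 := by
          gcongr
          refine le_trans ?_ hpε
          gcongr
          exact Finset.filter_subset _ _
  have vW : volume (⋃ t ∈ TS, ci (N * p) ⁻¹' {(U t : ℤ × ℤ)}) = TS.card * a := by
    rw [measure_biUnion_finset]
    · simp only [cell_vol hL]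
      rw [Finset.sum_const, nsmul_eq_mul]
    · intro t _ t' _ htt
      rw [Function.onFun, Set.disjoint_left]
      intro z hz hz'
      exact htt (iU (Subtype.ext (hz.symm.trans hz')))
    · exact fun t _ => ci_meas _ (measurableSet_singleton _)
  refine up.trans ?_
  rw [← vW]
  conv_rhs => rw [← ENNReal.add_halves ε, ← add_assoc]
  gcongr
  refine le_trans (measure_mono (t := {x | x ∈ M ∧ (ci N x, ci N (φ x)) ∈ S} ∪ {x | x ∈ M ∧
    ci (N * p) (φ x) ≠ Equiv.Perm.ofSubtype σ (ci (N * p) x)}) ?_)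
    ((measure_union_le _ _).trans (by gcongr))
  intro x hx
  simp only [mem_iUnion] at hx
  obtain ⟨t, ht, hx⟩ := hx
  have hx' : ci (N * p) x = U t := hx
  have htS := (Finset.mem_filter.1 ht).2
  have e1 : ci N x = t.1 := by
    rw [← ci_div N p hp x, hx']; exact cU t
  have hxM : x ∈ M := (hS _ htS).1 e1
  by_cases hg : ci (N * p) (φ x) = Equiv.Perm.ofSubtype σ (ci (N * p) x)
  · left
    refine ⟨hxM, ?_⟩
    have e2 : ci N (φ x) = t.2.1 := by
      rw [← ci_div N p hp (φ x), hg, hx', Equiv.Perm.ofSubtype_apply_coe]; exact cV t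
    rw [e1, e2]; exact htS
  · right; exact ⟨hxM, hg⟩


lemma weak_conv {Ω : Type*} [TopologicalSpace Ω] [MeasurableSpace Ω] [OpensMeasurableSpace Ω]
    (ρ : Measure Ω) (ρn : ℕ → Measure Ω) (m : ENNReal) (hm0 : m ≠ 0) (hm : m ≠ ⊤)
    (h1 : ρ univ = m) (h2 : ∀ n, ρn n univ = m)
    (h : ∀ G, IsOpen G → ∃ u : ℕ → ENNReal, Tendsto u atTop (𝓝 (ρ G)) ∧ ∀ n, u n ≤ ρn n G)
    (f : BoundedContinuousFunction Ω ℝ) :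
    Tendsto (fun n => ∫ z, f z ∂(ρn n)) atTop (𝓝 (∫ z, f z ∂ρ)) := by
  have hi : m⁻¹ ≠ ⊤ := ENNReal.inv_ne_top.2 hm0
  have p1 : IsProbabilityMeasure (m⁻¹ • ρ) :=
    ⟨by rw [Measure.smul_apply, smul_eq_mul, h1, ENNReal.inv_mul_cancel hm0 hm]⟩
  have p2 : ∀ n, IsProbabilityMeasure (m⁻¹ • ρn n) := fun n =>
    ⟨by rw [Measure.smul_apply, smul_eq_mul, h2, ENNReal.inv_mul_cancel hm0 hm]⟩
  let P : ProbabilityMeasure Ω := ⟨m⁻¹ • ρ, p1⟩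
  let Pn : ℕ → ProbabilityMeasure Ω := fun n => ⟨m⁻¹ • ρn n, p2 n⟩
  have ht : Tendsto Pn atTop (𝓝 P) := by
    apply tendsto_of_forall_isOpen_le_liminf_nat'
    intro G hG
    obtain ⟨u, hu, hle⟩ := h G hG
    have hu' : Tendsto (fun n => m⁻¹ * u n) atTop (𝓝 (m⁻¹ * ρ G)) :=
      ENNReal.Tendsto.const_mul hu (Or.inr hi)
    change m⁻¹ * ρ G ≤ liminf (fun n => m⁻¹ * ρn n G) atTop
    rw [← hu'.liminf_eq]
    refine liminf_le_liminf (Eventually.of_forall fun n => ?_)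
    exact mul_le_mul_right (hle n) _
  have := ProbabilityMeasure.tendsto_iff_forall_integral_tendsto.1 ht f
  have t : Tendsto (fun n => m⁻¹.toReal * ∫ z, f z ∂(ρn n)) atTop
      (𝓝 (m⁻¹.toReal * ∫ z, f z ∂ρ)) := by
    simpa [P, Pn, integral_smul_measure] using this
  have hr : m⁻¹.toReal ≠ 0 := (ENNReal.toReal_pos (ENNReal.inv_ne_zero.2 hm) hi).ne'
  have := t.const_mul (m⁻¹.toReal⁻¹)
  simpa only [inv_mul_cancel_left₀ hr] using this

lemma dist_ci {N : ℕ} (hN : 0 < N) {x y : ℝ × ℝ} (h : ci N x = ci N y) :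
    dist x y < 1 / N := by
  have hN' : (0 : ℝ) < N := by positivity
  simp only [ci, Prod.mk.injEq] at h
  rw [Prod.dist_eq, max_lt_iff, Real.dist_eq, Real.dist_eq, lt_div_iff₀ hN', lt_div_iff₀ hN']
  have a := Int.abs_sub_lt_one_of_floor_eq_floor h.1
  have b := Int.abs_sub_lt_one_of_floor_eq_floor h.2
  rw [← sub_mul, abs_mul, abs_of_pos hN'] at a b
  exact ⟨a, b⟩

lemma ev_cell {G : Set ((ℝ × ℝ) × (ℝ × ℝ))} (hG : IsOpen G) (z : (ℝ × ℝ) × (ℝ × ℝ)) :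
    ∀ᶠ n : ℕ in atTop, (CC (n + 1) (ci (n + 1) z.1) (ci (n + 1) z.2) ⊆ G ↔ z ∈ G) := by
  by_cases hz : z ∈ G
  · obtain ⟨r, hr, hb⟩ := Metric.isOpen_iff.1 hG z hz
    have t := tendsto_one_div_add_atTop_nhds_zero_nat (𝕜 := ℝ)
    filter_upwards [t.eventually (gt_mem_nhds hr)] with n hn
    simp only [hz, iff_true]
    rintro w ⟨h1, h2⟩
    apply hb
    rw [Metric.mem_ball, Prod.dist_eq, max_lt_iff]
    have a := dist_ci n.succ_pos (show ci (n+1) w.1 = _ from h1)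
    have b := dist_ci n.succ_pos (show ci (n+1) w.2 = _ from h2)
    push_cast at a b
    exact ⟨a.trans hn, b.trans hn⟩
  · refine Eventually.of_forall fun n => ?_
    simp only [hz, iff_false]
    intro h
    exact hz (h ⟨rfl, rfl⟩)

theorem final (M : Set (ℝ × ℝ)) (hMopen : IsOpen M) (hMconn : IsConnected M)
    (hMbdd : Bornology.IsBounded M)
    (κ : Kernel (ℝ × ℝ) (ℝ × ℝ)) [IsMarkovKernel κ]
    (hκ : ∀ A : Set (ℝ × ℝ), MeasurableSet A →
      ∫⁻ x, κ x A ∂(volume.restrict M) = volume.restrict M A) :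
    ∃ φ : ℕ → ℝ × ℝ → ℝ × ℝ, (∀ n, IsAD M (φ n)) ∧
      ∀ f : (ℝ × ℝ) × (ℝ × ℝ) → ℝ, ContinuousOn f (closure M ×ˢ closure M) →
        Filter.Tendsto (fun n => ∫ x, f (x, φ n x) ∂(volume.restrict M))
          Filter.atTop
          (nhds (∫ x, (∫ y, f (x, y) ∂(κ x)) ∂(volume.restrict M))) := by
  have hMm := hMopen.measurableSet
  have hfin : volume M ≠ ⊤ := hMbdd.measure_lt_top.ne
  have hpos : volume M ≠ 0 := (hMopen.measure_pos volume hMconn.nonempty).ne'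
  have : IsFiniteMeasure (volume.restrict M) := ⟨by simpa using hfin.lt_top⟩
  set μ : Measure (ℝ × ℝ) := volume.restrict M with hμ
  set ρ := μ ⊗ₘ κ with hρ
  have hle : ∀ A, MeasurableSet A → μ A ≤ volume A := fun A _ => Measure.restrict_apply_le _ _
  have m1 : ∀ A, MeasurableSet A → ρ (A ×ˢ univ) = μ A := by
    intro A hA
    rw [hρ, Measure.compProd_apply_prod hA .univ]
    simp
  have m2 : ∀ A, MeasurableSet A → ρ (univ ×ˢ A) = μ A := by
    intro A hA
    rw [hρ, Measure.compProd_apply_prod .univ hA, setLIntegral_univ, hκ A hA]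
  have aeM : ∀ᵐ x ∂μ, x ∈ M := ae_restrict_mem hMm
  have aeκ : ∀ᵐ x ∂μ, ∀ᵐ y ∂(κ x), y ∈ M := by
    have h0 : ∫⁻ x, κ x Mᶜ ∂μ = 0 := by
      rw [hκ _ hMm.compl, hμ, Measure.restrict_apply hMm.compl]; simp
    rw [lintegral_eq_zero_iff (κ.measurable_coe hMm.compl)] at h0
    filter_upwards [h0] with x hx
    exact hx
  have full : ρ (M ×ˢ M)ᶜ = 0 := by
    have e : (M ×ˢ M)ᶜ ⊆ (Mᶜ ×ˢ univ) ∪ (univ ×ˢ Mᶜ) := by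
      rintro ⟨x, y⟩ h
      simp only [mem_compl_iff, mem_prod, mem_union, mem_univ] at h ⊢
      tauto
    have z : μ Mᶜ = 0 := by
      rw [hμ, Measure.restrict_apply hMm.compl]; simp
    refine measure_mono_null e (measure_union_null ?_ ?_)
    · rw [m1 _ hMm.compl, z]
    · rw [m2 _ hMm.compl, z]
  choose φ hφ hφS using fun n : ℕ => main_approx hMopen hMconn.isPreconnected hMbdd ρ
    (fun A hA => (m1 A hA).trans_le (hle A hA)) (fun A hA => (m2 A hA).trans_le (hle A hA))
    n.succ_pos (((n : ENNReal) + 1)⁻¹) (ENNReal.inv_pos.2 (by finiteness))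
  refine ⟨φ, hφ, fun f hf => ?_⟩
  have φm : ∀ n, Measurable (fun x => (x, φ n x)) := fun n =>
    measurable_id.prodMk (hφ n).2.2.1.measurable
  -- extension
  obtain ⟨g, hg⟩ : ∃ g : BoundedContinuousFunction ((ℝ × ℝ) × (ℝ × ℝ)) ℝ,
      ∀ z ∈ M ×ˢ M, g z = f z := by
    have hcpt : IsCompact (closure M ×ˢ closure M) :=
      hMbdd.isCompact_closure.prod hMbdd.isCompact_closure
    have : CompactSpace (closure M ×ˢ closure M : Set ((ℝ × ℝ) × (ℝ × ℝ))) :=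
      isCompact_iff_compactSpace.1 hcpt
    let f0 : BoundedContinuousFunction (closure M ×ˢ closure M : Set ((ℝ × ℝ) × (ℝ × ℝ))) ℝ :=
      BoundedContinuousFunction.mkOfCompact ⟨_, hf.domRestrict⟩
    obtain ⟨g, -, hg⟩ := f0.exists_extension_norm_eq_of_isClosedEmbedding
      hcpt.isClosed.isClosedEmbedding_subtypeVal
    refine ⟨g, fun z hz => ?_⟩
    exact congrFun hg ⟨z, subset_closure hz.1, subset_closure hz.2⟩
  have e1 : ∀ n, ∫ x, f (x, φ n x) ∂μ = ∫ z, g z ∂(μ.map (fun x => (x, φ n x))) := by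
    intro n
    rw [integral_map (φm n).aemeasurable g.continuous.aestronglyMeasurable]
    refine integral_congr_ae ?_
    filter_upwards [aeM] with x hx
    exact (hg _ ⟨hx, ((hφ n).mem_iff x).2 hx⟩).symm
  have e2 : ∫ x, (∫ y, f (x, y) ∂(κ x)) ∂μ = ∫ z, g z ∂ρ := by
    rw [hρ, Measure.integral_compProd (g.integrable _)]
    refine integral_congr_ae ?_
    filter_upwards [aeM, aeκ] with x hx hx'
    refine integral_congr_ae ?_
    filter_upwards [hx'] with y hy
    exact (hg _ ⟨hx, hy⟩).symm
  simp only [e1, e2]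
  refine weak_conv ρ _ (volume M) hpos hfin ?_ ?_ ?_ g
  · rw [← univ_prod_univ, m1 _ .univ, hμ]; simp
  · intro n
    rw [Measure.map_apply (φm n) .univ, preimage_univ, hμ]; simp
  intro G hG
  let G' := G ∩ M ×ˢ M
  have hG' : IsOpen G' := hG.inter (hMopen.prod hMopen)
  let S : ℕ → Set ((ℤ × ℤ) × (ℤ × ℤ)) := fun n => {q | CC (n + 1) q.1 q.2 ⊆ G'}
  let Gn : ℕ → Set ((ℝ × ℝ) × (ℝ × ℝ)) := fun n =>
    {z | (ci (n + 1) z.1, ci (n + 1) z.2) ∈ S n}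
  have hSn : ∀ n, ∀ q ∈ S n, ci (n + 1) ⁻¹' {q.1} ⊆ M ∧ ci (n + 1) ⁻¹' {q.2} ⊆ M := by
    intro n q hq
    constructor
    · intro x hx
      have := hq (show (x, _) ∈ CC (n + 1) q.1 q.2 from ⟨hx, ci_rep n.succ_pos q.2⟩)
      exact this.2.1
    · intro x hx
      have := hq (show (_, x) ∈ CC (n + 1) q.1 q.2 from ⟨ci_rep n.succ_pos q.1, hx⟩)
      exact this.2.2
  have hGm : ∀ n, MeasurableSet (Gn n) := by
    intro n
    have : Measurable (fun z : (ℝ × ℝ) × (ℝ × ℝ) => (ci (n + 1) z.1, ci (n + 1) z.2)) :=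
      ((ci_meas _).comp measurable_fst).prodMk ((ci_meas _).comp measurable_snd)
    exact this (S n).to_countable.measurableSet
  have tG : Tendsto (fun n => ρ (Gn n)) atTop (𝓝 (ρ G')) :=
    tendsto_measure_of_tendsto_indicator_of_isFiniteMeasure atTop ρ hGm
      (fun z => ev_cell hG' z)
  have eG : ρ G' = ρ G := by
    refine le_antisymm (measure_mono inter_subset_left) ?_
    calc ρ G ≤ ρ (G' ∪ (M ×ˢ M)ᶜ) := measure_mono (fun z hz => by
            by_cases h : z ∈ M ×ˢ M
            · exact Or.inl ⟨hz, h⟩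
            · exact Or.inr h)
      _ ≤ ρ G' + ρ (M ×ˢ M)ᶜ := measure_union_le _ _
      _ = ρ G' := by rw [full, add_zero]
  refine ⟨fun n => ρ (Gn n) - ((n : ENNReal) + 1)⁻¹, ?_, fun n => ?_⟩
  · have t0 : Tendsto (fun n : ℕ => ((n : ENNReal) + 1)⁻¹) atTop (𝓝 0) := by
      have := (tendsto_add_atTop_iff_nat 1).2 ENNReal.tendsto_inv_nat_nhds_zero
      simpa using this
    have := ENNReal.Tendsto.sub tG t0 (Or.inr (by simp))
    rwa [tsub_zero, eG] at this
  · rw [tsub_le_iff_right]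
    refine (hφS n (S n) (hSn n)).trans ?_
    gcongr
    rw [Measure.map_apply (φm n) hG.measurableSet, hμ,
      Measure.restrict_apply (φm n hG.measurableSet)]
    apply measure_mono
    rintro x ⟨hx, hx'⟩
    have := hx' (show (x, φ n x) ∈ CC (n + 1) _ _ from ⟨rfl, rfl⟩)
    exact ⟨this.1, hx⟩



end BA

/-- every bistochastic kernel on `M` is a weak-* limit of
area-preserving smooth diffeomorphisms of `M`. -/
theorem bistochastic_approx_by_diffeos
    (M : Set (ℝ × ℝ)) (hMopen : IsOpen M) (hMconn : IsConnected M)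
    (hMbdd : Bornology.IsBounded M) (hMsm : HasSmoothBoundary M)
    (κ : Kernel (ℝ × ℝ) (ℝ × ℝ)) (hκ : IsBistochastic (volume.restrict M) κ) :
    ∃ φ : ℕ → ℝ × ℝ → ℝ × ℝ, (∀ n, IsSmoothAPDiffeo M (φ n)) ∧
      ∀ f : (ℝ × ℝ) × (ℝ × ℝ) → ℝ, ContinuousOn f (closure M ×ˢ closure M) →
        Filter.Tendsto (fun n => ∫ x, f (x, φ n x) ∂(volume.restrict M))
          Filter.atTop
          (nhds (∫ x, (∫ y, f (x, y) ∂(κ x)) ∂(volume.restrict M))) := by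
  have := hκ.1
  obtain ⟨φ, h1, h2⟩ := BA.final M hMopen hMconn hMbdd κ hκ.2
  exact ⟨φ, fun n => (h1 n).isSmooth hMopen, h2⟩
end

section
/- Let M ⊂ ℝ² be a bounded open connected set with smooth boundary, and let Q₁, Q₂ ⊂ M be two disjoint closed axis-parallel squares of equal side length with centers x₁ and x₂ respectively. Define the swap map p : M → M by p(x) = x − x₁ + x₂ for x ∈ Q₁, p(x) = x − x₂ + x₁ for x ∈ Q₂, and p(x) = x otherwise. Then there exists a sequence (φ_n) of C^∞ diffeomorphisms of M preserving Lebesgue measure such that φ_n → p in L²(M; ℝ²). -/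
open MeasureTheory

structure InG (M : Set (ℝ × ℝ)) (e : (ℝ × ℝ) ≃ (ℝ × ℝ)) : Prop where
  smooth : ContDiff ℝ (⊤ : ℕ∞) e
  smooth_symm : ContDiff ℝ (⊤ : ℕ∞) e.symm
  mp : MeasurePreserving e volume volume
  fix : ∀ x, x ∉ M → e x = x

def InA (M : Set (ℝ × ℝ)) (p : ℝ × ℝ → ℝ × ℝ) : Prop :=
  ∀ ε : ENNReal, 0 < ε → ∃ e, InG M e ∧ volume {x | e x ≠ p x} ≤ ε

lemma InG.comp {M : Set (ℝ × ℝ)} {e f : (ℝ × ℝ) ≃ (ℝ × ℝ)} (he : InG M e) (hf : InG M f) :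
    InG M (f.trans e) where
  smooth := he.smooth.comp hf.smooth
  smooth_symm := hf.smooth_symm.comp he.smooth_symm
  mp := he.mp.comp hf.mp
  fix := fun x hx => by simp [hf.fix x hx, he.fix x hx]

lemma InG.preimage {M : Set (ℝ × ℝ)} {e : (ℝ × ℝ) ≃ (ℝ × ℝ)} (he : InG M e) (s : Set (ℝ × ℝ)) :
    volume (e ⁻¹' s) = volume s := by
  let E : (ℝ × ℝ) ≃ᵐ (ℝ × ℝ) := ⟨e, he.smooth.continuous.measurable, he.smooth_symm.continuous.measurable⟩
  have : MeasurePreserving E volume volume := he.mp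
  exact this.measure_preimage_equiv s

lemma InA.id (M : Set (ℝ × ℝ)) : InA M (fun x => x) := by
  intro ε hε
  refine ⟨Equiv.refl _, ⟨contDiff_id, contDiff_id, MeasurePreserving.id _, fun _ _ => rfl⟩, ?_⟩
  simp

lemma InA.comp {M : Set (ℝ × ℝ)} {p q : ℝ × ℝ → ℝ × ℝ} (hp : InA M p) (hq : InA M q) :
    InA M (fun x => p (q x)) := by
  intro ε hε
  obtain ⟨e, he, hep⟩ := hp (ε / 2) (ENNReal.half_pos hε.ne')
  obtain ⟨f, hf, hfq⟩ := hq (ε / 2) (ENNReal.half_pos hε.ne')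
  refine ⟨f.trans e, he.comp hf, ?_⟩
  have : {x | (f.trans e) x ≠ p (q x)} ⊆ f ⁻¹' {x | e x ≠ p x} ∪ {x | f x ≠ q x} := by
    intro x hx
    by_cases h : f x = q x
    · left
      simp only [Set.mem_ofPred_eq, Equiv.trans_apply, Set.mem_preimage] at hx ⊢
      rw [h] at hx ⊢
      exact hx
    · right; exact h
  calc _ ≤ _ := measure_mono this
    _ ≤ _ := measure_union_le _ _
    _ ≤ ε / 2 + ε / 2 := by
      rw [hf.preimage]; exact add_le_add hep hfq
    _ = ε := ENNReal.add_halves ε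

lemma InA.approx {M : Set (ℝ × ℝ)} {p : ℝ × ℝ → ℝ × ℝ}
    (h : ∀ ε : ENNReal, 0 < ε → ∃ q, InA M q ∧ volume {x | q x ≠ p x} ≤ ε) : InA M p := by
  intro ε hε
  obtain ⟨q, hq, hqp⟩ := h (ε / 2) (ENNReal.half_pos hε.ne')
  obtain ⟨f, hf, hfq⟩ := hq (ε / 2) (ENNReal.half_pos hε.ne')
  refine ⟨f, hf, ?_⟩
  have : {x | f x ≠ p x} ⊆ {x | q x ≠ p x} ∪ {x | f x ≠ q x} := by
    intro x hx
    by_cases h : f x = q x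
    · left
      simp only [Set.mem_ofPred_eq] at hx ⊢
      rwa [h] at hx
    · right; exact h
  calc _ ≤ _ := measure_mono this
    _ ≤ _ := measure_union_le _ _
    _ ≤ ε / 2 + ε / 2 := add_le_add hqp hfq
    _ = ε := ENNReal.add_halves ε

/-- point reflection on the rectangles -/
def opR (c : ℝ × ℝ) (a b : ℝ) : Set (ℝ × ℝ) := {z | |z.1 - c.1| < a ∧ |z.2 - c.2| < b}
def clR (c : ℝ × ℝ) (a b : ℝ) : Set (ℝ × ℝ) := {z | |z.1 - c.1| ≤ a ∧ |z.2 - c.2| ≤ b}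

open Classical in
noncomputable def prefl (K : Set (ℝ × ℝ)) (c : ℝ × ℝ) (z : ℝ × ℝ) : ℝ × ℝ :=
  if z ∈ K then (2 * c.1 - z.1, 2 * c.2 - z.2) else z

open Classical in
noncomputable def sw (x y : ℝ × ℝ) (r : ℝ) (z : ℝ × ℝ) : ℝ × ℝ :=
  if z ∈ clR x r r then z - x + y else if z ∈ clR y r r then z - y + x else z

lemma det_prod (p q r s : ℝ) :
    ((p • ContinuousLinearMap.fst ℝ ℝ ℝ + q • ContinuousLinearMap.snd ℝ ℝ ℝ).prod
      (r • ContinuousLinearMap.fst ℝ ℝ ℝ + s • ContinuousLinearMap.snd ℝ ℝ ℝ)).det = p * s - q * r := by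
  rw [← Matrix.toLin_finTwoProd_toContinuousLinearMap]
  simp only [LinearMap.det_toContinuousLinearMap, LinearMap.det_toLin, Matrix.det_fin_two_of]

noncomputable def hh (x : ℝ) : ℝ := (x * √(1 - x ^ 2) + Real.arcsin x) / 2

lemma hh_pos {x : ℝ} (hx : x ∈ Set.Ioo (-1 : ℝ) 1) : 0 < 1 - x ^ 2 := by
  nlinarith [hx.1, hx.2]

lemma hh_deriv {x : ℝ} (hx : x ∈ Set.Ioo (-1 : ℝ) 1) : HasDerivAt hh (√(1 - x ^ 2)) x := by
  have h0 := hh_pos hx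
  have hs : 0 < √(1 - x ^ 2) := Real.sqrt_pos.2 h0
  have h1 : HasDerivAt (fun x : ℝ => 1 - x ^ 2) (-(2 * x)) x := by
    simpa using (hasDerivAt_pow 2 x).const_sub 1
  have h2 := h1.sqrt h0.ne'
  have h3 := (((hasDerivAt_id x).mul h2).add (Real.hasDerivAt_arcsin hx.1.ne' hx.2.ne)).div_const 2
  refine h3.congr_deriv ?_
  simp only [id]
  have := Real.sq_sqrt h0.le
  field_simp
  nlinarith

lemma hh_cont : Continuous hh := by
  unfold hh
  have := Real.continuous_arcsin
  fun_prop

lemma hh_smooth {x : ℝ} (hx : x ∈ Set.Ioo (-1 : ℝ) 1) : ContDiffAt ℝ (⊤ : ℕ∞) hh x := by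
  have h0 := hh_pos hx
  have h1 : ContDiffAt ℝ (⊤ : ℕ∞) (fun x : ℝ => √(1 - x ^ 2)) x :=
    ContDiffAt.sqrt (by fun_prop) h0.ne'
  exact ((contDiffAt_id.mul h1).add (Real.contDiffAt_arcsin hx.1.ne' hx.2.ne)).div_const 2

lemma hh_mono : StrictMonoOn hh (Set.Icc (-1) 1) := by
  apply strictMonoOn_of_deriv_pos (convex_Icc _ _) hh_cont.continuousOn
  intro x hx
  rw [interior_Icc] at hx
  rw [(hh_deriv hx).deriv]
  exact Real.sqrt_pos.2 (hh_pos hx)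

lemma hh_one : hh 1 = Real.pi / 4 := by simp [hh]; ring
lemma hh_neg (x : ℝ) : hh (-x) = - hh x := by simp [hh]; ring

lemma hh_maps {x : ℝ} (hx : x ∈ Set.Ioo (-1 : ℝ) 1) : |hh x| < Real.pi / 4 := by
  rw [abs_lt]
  constructor
  · rw [← hh_one, ← hh_neg]
    exact hh_mono (by norm_num) ⟨hx.1.le, hx.2.le⟩ hx.1
  · rw [← hh_one]
    exact hh_mono ⟨hx.1.le, hx.2.le⟩ (by norm_num) hx.2

lemma hh_inv : ∃ k : ℝ → ℝ, (∀ y, |y| < Real.pi / 4 → k y ∈ Set.Ioo (-1 : ℝ) 1 ∧ hh (k y) = y) ∧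
    (∀ x ∈ Set.Ioo (-1 : ℝ) 1, k (hh x) = x) ∧
    (∀ y, |y| < Real.pi / 4 → ContDiffAt ℝ (⊤ : ℕ∞) k y) := by
  have : ∀ y : ℝ, ∃ x, |y| < Real.pi / 4 → x ∈ Set.Ioo (-1 : ℝ) 1 ∧ hh x = y := by
    intro y
    by_cases hy : |y| < Real.pi / 4
    · rw [abs_lt] at hy
      have hy' : y ∈ Set.Ioo (hh (-1)) (hh 1) := by rwa [hh_neg, hh_one]
      obtain ⟨x, hx, h⟩ := intermediate_value_Ioo (by norm_num : (-1 : ℝ) ≤ 1) hh_cont.continuousOn hy'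
      exact ⟨x, fun _ => ⟨hx, h⟩⟩
    · exact ⟨0, fun h => absurd h hy⟩
  choose k hk using this
  have hinj : ∀ x ∈ Set.Ioo (-1 : ℝ) 1, k (hh x) = x := by
    intro x hx
    obtain ⟨h1, h2⟩ := hk (hh x) (hh_maps hx)
    exact hh_mono.injOn (Set.Ioo_subset_Icc_self h1) (Set.Ioo_subset_Icc_self hx) h2
  refine ⟨k, hk, hinj, fun y hy => ?_⟩
  obtain ⟨hx, hxy⟩ := hk y hy
  set x := k y with hxdef
  have hs := hh_smooth hx
  have hd := hh_deriv hx
  have hne : √(1 - x ^ 2) ≠ 0 := (Real.sqrt_pos.2 (hh_pos hx)).ne'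
  have hfd : HasFDerivAt hh
    ((ContinuousLinearEquiv.unitsEquivAut ℝ (Units.mk0 _ hne) : ℝ ≃L[ℝ] ℝ) : ℝ →L[ℝ] ℝ) x := by
    have := hd.hasFDerivAt
    refine this.congr_fderiv ?_
    ext; simp
  have hloc := hs.to_localInverse hfd (by simp)
  have hsd : HasStrictFDerivAt hh _ x := hs.hasStrictFDerivAt' hfd (by simp)
  have hr := hsd.eventually_right_inverse
  have hc : ContinuousAt (hsd.localInverse hh _ x) (hh x) := hsd.localInverse_continuousAt
  have hm := hc.eventually_mem (by
    rw [hsd.localInverse_apply_image]; exact isOpen_Ioo.mem_nhds hx)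
  rw [hxy] at hloc hr hm
  refine hloc.congr_of_eventuallyEq ?_
  filter_upwards [hr, hm] with t h1 h2
  have := hinj _ h2
  rw [h1] at this
  exact this

def DD : Set (ℝ × ℝ) := {w | w.1 ^ 2 + w.2 ^ 2 < 1}

lemma DD_fst {w : ℝ × ℝ} (hw : w ∈ DD) : w.1 ∈ Set.Ioo (-1 : ℝ) 1 := by
  have : w.1 ^ 2 + w.2 ^ 2 < 1 := hw
  constructor <;> nlinarith [sq_nonneg w.2]

lemma exists_chart (c : ℝ × ℝ) (a b : ℝ) (ha : 0 < a) (hb : 0 < b) :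
    ∃ (F I : ℝ × ℝ → ℝ × ℝ) (κ : ℝ), κ ≠ 0 ∧
      (∀ w ∈ DD, F w ∈ opR c a b ∧ I (F w) = w) ∧
      (∀ z ∈ opR c a b, I z ∈ DD ∧ F (I z) = z) ∧
      (∀ w ∈ DD, ContDiffAt ℝ (⊤ : ℕ∞) F w) ∧
      (∀ z ∈ opR c a b, ContDiffAt ℝ (⊤ : ℕ∞) I z) ∧
      (∀ w ∈ DD, (fderiv ℝ F w).det = κ) ∧
      (∀ w, F (-w) = (2 * c.1 - (F w).1, 2 * c.2 - (F w).2)) := by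
  obtain ⟨k, hk1, hk2, hk3⟩ := hh_inv
  have hpi := Real.pi_pos
  set α := a / (Real.pi / 4) with hα
  have hα0 : 0 < α := by positivity
  have haα : a = α * (Real.pi / 4) := by rw [hα]; field_simp
  have hkz : ∀ z ∈ opR c a b, |(z.1 - c.1) / α| < Real.pi / 4 := by
    intro z hz
    rw [abs_div, abs_of_pos hα0, div_lt_iff₀ hα0, mul_comm, ← haα]; exact hz.1
  refine ⟨fun w => (c.1 + α * hh w.1, c.2 + b * (w.2 / √(1 - w.1 ^ 2))),
    fun z => (k ((z.1 - c.1) / α), (z.2 - c.2) / b * √(1 - k ((z.1 - c.1) / α) ^ 2)),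
    α * b, by positivity, ?_, ?_, ?_, ?_, ?_, ?_⟩
  · intro w hw
    have hw1 := DD_fst hw
    have hs := Real.sqrt_pos.2 (hh_pos hw1)
    refine ⟨⟨?_, ?_⟩, ?_⟩
    · simp only [add_sub_cancel_left, abs_mul, abs_of_pos hα0]
      rw [haα]
      exact mul_lt_mul_of_pos_left (hh_maps hw1) hα0
    · simp only [add_sub_cancel_left, abs_mul, abs_of_pos hb, abs_div, abs_of_pos hs]
      have : |w.2| < √(1 - w.1 ^ 2) := by
        apply Real.lt_sqrt_of_sq_lt
        rw [sq_abs]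
        have : w.1 ^ 2 + w.2 ^ 2 < 1 := hw
        linarith
      have := (div_lt_one hs).2 this
      nlinarith
    · have : (c.1 + α * hh w.1 - c.1) / α = hh w.1 := by field_simp; ring
      simp only [this, hk2 w.1 hw1]
      ext
      · rfl
      · simp only; field_simp; ring
  · intro z hz
    obtain ⟨h1, h2⟩ := hk1 _ (hkz z hz)
    have hs := Real.sqrt_pos.2 (hh_pos h1)
    constructor
    · simp only [DD, Set.mem_ofPred_eq, mul_pow, Real.sq_sqrt (hh_pos h1).le]
      have h3 : ((z.2 - c.2) / b) ^ 2 < 1 := by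
        rw [sq_lt_one_iff_abs_lt_one, abs_div, abs_of_pos hb, div_lt_one hb]
        exact hz.2
      nlinarith [hh_pos h1]
    · simp only [h2]
      ext
      · simp only; field_simp; ring
      · simp only; field_simp; ring
  · intro w hw
    have hw1 := DD_fst hw
    have hs := Real.sqrt_pos.2 (hh_pos hw1)
    have e1 : ContDiffAt ℝ (⊤ : ℕ∞) (fun w : ℝ × ℝ => hh w.1) w :=
      (hh_smooth hw1).comp w contDiffAt_fst
    have e2 : ContDiffAt ℝ (⊤ : ℕ∞) (fun w : ℝ × ℝ => √(1 - w.1 ^ 2)) w :=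
      ContDiffAt.sqrt (by fun_prop) (hh_pos hw1).ne'
    exact (contDiffAt_const.add (contDiffAt_const.mul e1)).prodMk
      (contDiffAt_const.add (contDiffAt_const.mul (contDiffAt_snd.div e2 hs.ne')))
  · intro z hz
    obtain ⟨h1, h2⟩ := hk1 _ (hkz z hz)
    have hl : ContDiffAt ℝ (⊤ : ℕ∞) (fun z : ℝ × ℝ => (z.1 - c.1) / α) z := by fun_prop
    have e1 : ContDiffAt ℝ (⊤ : ℕ∞) (fun z : ℝ × ℝ => k ((z.1 - c.1) / α)) z :=
      ContDiffAt.comp z (hk3 _ (hkz z hz)) hl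
    have e2 : ContDiffAt ℝ (⊤ : ℕ∞) (fun z : ℝ × ℝ => √(1 - k ((z.1 - c.1) / α) ^ 2)) z :=
      ContDiffAt.sqrt (contDiffAt_const.sub (e1.pow 2)) (hh_pos h1).ne'
    exact e1.prodMk (ContDiffAt.mul (by fun_prop) e2)
  · intro w hw
    have hw1 := DD_fst hw
    have h0 := hh_pos hw1
    have hs := Real.sqrt_pos.2 h0
    have d1 : HasFDerivAt (fun w : ℝ × ℝ => c.1 + α * hh w.1)
        ((α * √(1 - w.1 ^ 2)) • ContinuousLinearMap.fst ℝ ℝ ℝ + (0 : ℝ) • ContinuousLinearMap.snd ℝ ℝ ℝ) w := by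
      have := (((hh_deriv hw1).comp_hasFDerivAt w (hasFDerivAt_fst (𝕜 := ℝ) (p := w))).const_mul α).const_add c.1
      refine this.congr_fderiv ?_
      ext <;> simp
    have h1 : HasDerivAt (fun x : ℝ => 1 - x ^ 2) (-(2 * w.1)) w.1 := by
      simpa using (hasDerivAt_pow 2 w.1).const_sub 1
    have h2 := (h1.sqrt h0.ne').inv hs.ne'
    obtain ⟨q, hq⟩ : ∃ q, HasDerivAt (fun x : ℝ => √(1 - x ^ 2))⁻¹ q w.1 := ⟨_, h2⟩
    have d2 : HasFDerivAt (fun w : ℝ × ℝ => c.2 + b * (w.2 / √(1 - w.1 ^ 2)))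
        ((b * w.2 * q) • ContinuousLinearMap.fst ℝ ℝ ℝ +
          (b * (√(1 - w.1 ^ 2))⁻¹) • ContinuousLinearMap.snd ℝ ℝ ℝ) w := by
      have := (((hasFDerivAt_snd (p := w)).mul (hq.comp_hasFDerivAt w (hasFDerivAt_fst (𝕜 := ℝ) (p := w)))).const_mul b).const_add c.2
      refine this.congr_fderiv ?_
      ext <;> simp <;> ring
    rw [(d1.prodMk d2).fderiv, det_prod]
    field_simp
    ring
  · intro w
    ext
    · simp [hh_neg]; ring
    · simp [neg_div]; ring

noncomputable def TT (g : ℝ → ℝ) (w : ℝ × ℝ) : ℝ × ℝ :=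
  (w.1 * Real.cos (g (w.1 ^ 2 + w.2 ^ 2)) - w.2 * Real.sin (g (w.1 ^ 2 + w.2 ^ 2)),
   w.1 * Real.sin (g (w.1 ^ 2 + w.2 ^ 2)) + w.2 * Real.cos (g (w.1 ^ 2 + w.2 ^ 2)))

lemma TT_norm (g : ℝ → ℝ) (w : ℝ × ℝ) : (TT g w).1 ^ 2 + (TT g w).2 ^ 2 = w.1 ^ 2 + w.2 ^ 2 := by
  simp only [TT]
  have := Real.sin_sq_add_cos_sq (g (w.1 ^ 2 + w.2 ^ 2))
  linear_combination (w.1 ^ 2 + w.2 ^ 2) * this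

lemma TT_inv (g : ℝ → ℝ) (w : ℝ × ℝ) : TT (-g) (TT g w) = w := by
  have h := TT_norm g w
  have := Real.sin_sq_add_cos_sq (g (w.1 ^ 2 + w.2 ^ 2))
  rw [TT, h]
  simp only [TT, Pi.neg_apply, Real.cos_neg, Real.sin_neg]
  ext
  · simp only
    linear_combination w.1 * this
  · simp only
    linear_combination w.2 * this

lemma TT_smooth {g : ℝ → ℝ} (hg : ContDiff ℝ (⊤ : ℕ∞) g) : ContDiff ℝ (⊤ : ℕ∞) (TT g) := by
  unfold TT
  fun_prop

lemma TT_det {g : ℝ → ℝ} (hg : ContDiff ℝ (⊤ : ℕ∞) g) (w : ℝ × ℝ) : (fderiv ℝ (TT g) w).det = 1 := by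
  set s := w.1 ^ 2 + w.2 ^ 2 with hs
  obtain ⟨G, hG⟩ : ∃ G, HasDerivAt g G s := ⟨_, (hg.differentiable (by simp) s).hasDerivAt⟩
  have d0 : HasFDerivAt (fun w : ℝ × ℝ => w.1 ^ 2 + w.2 ^ 2)
      ((2 * w.1) • ContinuousLinearMap.fst ℝ ℝ ℝ + (2 * w.2) • ContinuousLinearMap.snd ℝ ℝ ℝ) w := by
    have := ((hasFDerivAt_fst (𝕜 := ℝ) (p := w)).pow 2).add ((hasFDerivAt_snd (𝕜 := ℝ) (p := w)).pow 2)
    refine this.congr_fderiv ?_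
    ext <;> simp
  have dθ := hG.comp_hasFDerivAt w d0
  have dc := ((Real.hasDerivAt_cos _).comp_hasFDerivAt w dθ)
  have ds := ((Real.hasDerivAt_sin _).comp_hasFDerivAt w dθ)
  have f1 := hasFDerivAt_fst (𝕜 := ℝ) (p := w)
  have f2 := hasFDerivAt_snd (𝕜 := ℝ) (p := w)
  have t1 := (f1.mul dc).sub (f2.mul ds)
  have t2 := (f1.mul ds).add (f2.mul dc)
  set C := Real.cos (g s) with hC
  set S := Real.sin (g s) with hS
  have t := (t1.congr_fderiv (g' := (C - w.1 * S * (2 * w.1 * G) - w.2 * C * (2 * w.1 * G)) • ContinuousLinearMap.fst ℝ ℝ ℝ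
      + (- w.1 * S * (2 * w.2 * G) - S - w.2 * C * (2 * w.2 * G)) • ContinuousLinearMap.snd ℝ ℝ ℝ)
      (by ext <;> simp [← hs, ← hC, ← hS] <;> ring)).prodMk
    (t2.congr_fderiv (g' := (S + w.1 * C * (2 * w.1 * G) - w.2 * S * (2 * w.1 * G)) • ContinuousLinearMap.fst ℝ ℝ ℝ
      + (w.1 * C * (2 * w.2 * G) + C - w.2 * S * (2 * w.2 * G)) • ContinuousLinearMap.snd ℝ ℝ ℝ)
      (by ext <;> simp [← hs, ← hC, ← hS] <;> ring))
  have t' : HasFDerivAt (TT g) _ w := t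
  rw [t'.fderiv, det_prod]
  have := Real.sin_sq_add_cos_sq (g s)
  rw [← hC, ← hS] at this
  linear_combination this

lemma mp_of_det (e : (ℝ × ℝ) ≃ (ℝ × ℝ)) (h1 : ContDiff ℝ (⊤ : ℕ∞) e) 
    (hd : ∀ z, |(fderiv ℝ e z).det| = 1) : MeasurePreserving e volume volume := by
  refine ⟨h1.continuous.measurable, ?_⟩
  ext s hs
  rw [Measure.map_apply h1.continuous.measurable hs]
  have hm := h1.continuous.measurable hs
  have := lintegral_abs_det_fderiv_eq_addHaar_image volume hm
    (f := e) (f' := fderiv ℝ e) (fun x _ => ((h1.differentiable (by simp)) x).hasFDerivAt.hasFDerivWithinAt)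
    e.injective.injOn
  rw [Set.image_preimage_eq _ e.surjective] at this
  rw [← this]
  simp [hd]

section
open Classical
noncomputable def psi (K : Set (ℝ × ℝ)) (F I : ℝ × ℝ → ℝ × ℝ) (g : ℝ → ℝ) (z : ℝ × ℝ) : ℝ × ℝ :=
  if z ∈ K then F (TT g (I z)) else z

lemma TT_DD {g : ℝ → ℝ} {w} (hw : w ∈ DD) : TT g w ∈ DD := by
  simp only [DD, Set.mem_ofPred_eq, TT_norm]; exact hw

lemma psi_inv {K : Set (ℝ × ℝ)} {F I : ℝ × ℝ → ℝ × ℝ} (g : ℝ → ℝ)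
    (h1 : ∀ w ∈ DD, F w ∈ K ∧ I (F w) = w) (h2 : ∀ z ∈ K, I z ∈ DD ∧ F (I z) = z) (z : ℝ × ℝ) :
    psi K F I (-g) (psi K F I g z) = z := by
  by_cases hz : z ∈ K
  · have h3 := h2 z hz
    have h4 := h1 _ (TT_DD (g := g) h3.1)
    rw [psi, psi, if_pos hz, if_pos h4.1, h4.2, TT_inv, h3.2]
  · simp [psi, hz]

lemma psi_local {K : Set (ℝ × ℝ)} {F I : ℝ × ℝ → ℝ × ℝ} {g : ℝ → ℝ} {δ : ℝ} (hδ : 0 < δ)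
    (hgδ : ∀ s, 1 - δ ≤ s → g s = 0)
    (h1 : ∀ w ∈ DD, F w ∈ K ∧ I (F w) = w) (h2 : ∀ z ∈ K, I z ∈ DD ∧ F (I z) = z)
    (h3 : ∀ w ∈ DD, ContDiffAt ℝ (⊤ : ℕ∞) F w) (z : ℝ × ℝ) (hz : z ∉ K) :
    psi K F I g =ᶠ[nhds z] id := by
  set E : Set (ℝ × ℝ) := {w | w.1 ^ 2 + w.2 ^ 2 ≤ 1 - δ} with hE
  have hED : E ⊆ DD := fun w hw => by
    have : w.1 ^ 2 + w.2 ^ 2 ≤ 1 - δ := hw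
    simp only [DD, Set.mem_ofPred_eq]; linarith
  have hEc : IsCompact E := by
    apply Metric.isCompact_of_isClosed_isBounded
    · exact isClosed_le (by fun_prop) (by fun_prop)
    · apply (Metric.isBounded_Icc (-1 : ℝ) 1 |>.prod (Metric.isBounded_Icc (-1 : ℝ) 1)).subset
      intro w hw
      have : w.1 ^ 2 + w.2 ^ 2 < 1 := hED hw
      refine ⟨⟨?_, ?_⟩, ?_, ?_⟩ <;> nlinarith [sq_nonneg w.1, sq_nonneg w.2]
  have hcl : IsClosed (F '' E) := (hEc.image_of_continuousOn
    fun w hw => (h3 w (hED hw)).continuousAt.continuousWithinAt).isClosed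
  have hzn : z ∉ F '' E := by
    rintro ⟨w, hw, rfl⟩; exact hz (h1 w (hED hw)).1
  filter_upwards [hcl.isOpen_compl.mem_nhds hzn] with y hy
  by_cases hyK : y ∈ K
  · have h4 := h2 y hyK
    have : I y ∉ E := fun h => hy ⟨I y, h, h4.2⟩
    have h5 : 1 - δ ≤ (I y).1 ^ 2 + (I y).2 ^ 2 := by
      simp only [hE, Set.mem_ofPred_eq, not_le] at this
      exact this.le
    simp [psi, hyK, TT, hgδ _ h5, h4.2]
  · simp [psi, hyK]

lemma psi_smooth {K : Set (ℝ × ℝ)} (hK : IsOpen K) {F I : ℝ × ℝ → ℝ × ℝ} {g : ℝ → ℝ}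
    (hg : ContDiff ℝ (⊤ : ℕ∞) g) {δ : ℝ} (hδ : 0 < δ)
    (hgδ : ∀ s, 1 - δ ≤ s → g s = 0)
    (h1 : ∀ w ∈ DD, F w ∈ K ∧ I (F w) = w) (h2 : ∀ z ∈ K, I z ∈ DD ∧ F (I z) = z)
    (h3 : ∀ w ∈ DD, ContDiffAt ℝ (⊤ : ℕ∞) F w) (h4 : ∀ z ∈ K, ContDiffAt ℝ (⊤ : ℕ∞) I z) :
    ContDiff ℝ (⊤ : ℕ∞) (psi K F I g) := by
  rw [contDiff_iff_contDiffAt]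
  intro z
  by_cases hz : z ∈ K
  · have e : psi K F I g =ᶠ[nhds z] fun y => F (TT g (I y)) := by
      filter_upwards [hK.mem_nhds hz] with y hy
      simp [psi, hy]
    refine ContDiffAt.congr_of_eventuallyEq ?_ e
    have i1 : ContDiffAt ℝ (⊤ : ℕ∞) (fun y => TT g (I y)) z :=
      (TT_smooth hg).contDiffAt.comp z (h4 z hz)
    exact ContDiffAt.comp z (h3 _ (TT_DD (h2 z hz).1)) i1
  · exact contDiffAt_id.congr_of_eventuallyEq (psi_local hδ hgδ h1 h2 h3 z hz)

lemma psi_det {K : Set (ℝ × ℝ)} (hK : IsOpen K) {F I : ℝ × ℝ → ℝ × ℝ} {g : ℝ → ℝ}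
    (hg : ContDiff ℝ (⊤ : ℕ∞) g) {δ : ℝ} (hδ : 0 < δ)
    (hgδ : ∀ s, 1 - δ ≤ s → g s = 0)
    (h1 : ∀ w ∈ DD, F w ∈ K ∧ I (F w) = w) (h2 : ∀ z ∈ K, I z ∈ DD ∧ F (I z) = z)
    (h3 : ∀ w ∈ DD, ContDiffAt ℝ (⊤ : ℕ∞) F w) (h4 : ∀ z ∈ K, ContDiffAt ℝ (⊤ : ℕ∞) I z)
    {κ : ℝ} (h5 : ∀ w ∈ DD, (fderiv ℝ F w).det = κ) (z : ℝ × ℝ) :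
    (fderiv ℝ (psi K F I g) z).det = 1 := by
  by_cases hz : z ∈ K
  · have e : psi K F I g =ᶠ[nhds z] fun y => F (TT g (I y)) := by
      filter_upwards [hK.mem_nhds hz] with y hy
      simp [psi, hy]
    have dI := ((h4 z hz).differentiableAt (by simp)).hasFDerivAt
    have dT := ((TT_smooth hg).differentiable (by simp) (I z)).hasFDerivAt
    have dF := ((h3 _ (TT_DD (g := g) (h2 z hz).1)).differentiableAt (by simp)).hasFDerivAt
    have dF0 := ((h3 _ (h2 z hz).1).differentiableAt (by simp)).hasFDerivAt
    have dd : HasFDerivAt (fun y => F (TT g (I y))) _ z := dF.comp z (dT.comp z dI)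
    have did : HasFDerivAt (fun y => F (I y)) _ z := dF0.comp z dI
    have did2 : HasFDerivAt (fun y => F (I y)) (ContinuousLinearMap.id ℝ (ℝ × ℝ)) z := by
      refine (hasFDerivAt_id z).congr_of_eventuallyEq ?_
      filter_upwards [hK.mem_nhds hz] with y hy
      exact (h2 y hy).2
    have hu := congrArg ContinuousLinearMap.det (did.unique did2)
    rw [e.fderiv_eq, dd.fderiv]
    simp only [ContinuousLinearMap.det, ContinuousLinearMap.toLinearMap_comp, LinearMap.det_comp,
      ContinuousLinearMap.coe_id, LinearMap.det_id] at hu ⊢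
    have q1 := h5 _ (TT_DD (g := g) (h2 z hz).1)
    have q2 := h5 _ (h2 z hz).1
    have q3 := TT_det hg (I z)
    simp only [ContinuousLinearMap.det] at q1 q2 q3
    rw [q1, q3]; rw [q2] at hu
    linarith
  · rw [(psi_local hδ hgδ h1 h2 h3 z hz).fderiv_eq, fderiv_id]
    simp [ContinuousLinearMap.det]

end

lemma opR_prod (c : ℝ × ℝ) (a b : ℝ) : opR c a b = Metric.ball c.1 a ×ˢ Metric.ball c.2 b := by
  ext z; simp [opR, Real.dist_eq]

theorem refl_open (M : Set (ℝ × ℝ)) (c : ℝ × ℝ) (a b : ℝ) (ha : 0 < a) (hb : 0 < b)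
    (h : opR c a b ⊆ M) : InA M (prefl (opR c a b) c) := by
  obtain ⟨F, I, κ, hκ, h1, h2, h3, h4, h5, h6⟩ := exists_chart c a b ha hb
  set K := opR c a b with hKdef
  have hK : IsOpen K := by
    rw [hKdef, opR_prod]; exact Metric.isOpen_ball.prod Metric.isOpen_ball
  have hKfin : volume K ≠ ⊤ := by
    rw [hKdef, opR_prod]
    exact (Metric.isBounded_ball.prod Metric.isBounded_ball).measure_lt_top.ne
  intro ε hε
  -- exhaustion
  have hIc : ContinuousOn I K := fun z hz => (h4 z hz).continuousAt.continuousWithinAt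
  let B : ℕ → Set (ℝ × ℝ) := fun n => K ∩ I ⁻¹' {w | 1 - 2 * (1 / ((n : ℝ) + 1)) < w.1 ^ 2 + w.2 ^ 2}
  have hB : ∀ n, IsOpen (B n) := fun n =>
    hIc.isOpen_inter_preimage hK (isOpen_lt (by fun_prop) (by fun_prop))
  have hlim := tendsto_measure_iInter_atTop (μ := (volume : Measure (ℝ × ℝ))) (s := B)
    (fun n => (hB n).measurableSet.nullMeasurableSet) ?_
    ⟨0, ne_top_of_le_ne_top hKfin (measure_mono Set.inter_subset_left)⟩
  swap
  · intro m n hmn z hz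
    refine ⟨hz.1, ?_⟩
    have hz2 : 1 - 2 * (1 / ((n : ℝ) + 1)) < (I z).1 ^ 2 + (I z).2 ^ 2 := hz.2
    have : 1 / ((n : ℝ) + 1) ≤ 1 / ((m : ℝ) + 1) := Nat.one_div_le_one_div hmn
    change 1 - 2 * (1 / ((m : ℝ) + 1)) < (I z).1 ^ 2 + (I z).2 ^ 2
    linarith
  have hemp : (⋂ n, B n) = ∅ := by
    rw [Set.eq_empty_iff_forall_notMem]
    intro z hz
    rw [Set.mem_iInter] at hz
    have hD : (I z).1 ^ 2 + (I z).2 ^ 2 < 1 := (h2 z (hz 0).1).1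
    obtain ⟨n, hn⟩ := exists_nat_one_div_lt (show 0 < (1 - ((I z).1 ^ 2 + (I z).2 ^ 2)) / 2 by linarith)
    have hz2 : 1 - 2 * (1 / ((n : ℝ) + 1)) < (I z).1 ^ 2 + (I z).2 ^ 2 := (hz n).2
    linarith
  rw [hemp, measure_empty] at hlim
  obtain ⟨n, hn⟩ := (hlim.eventually (gt_mem_nhds hε)).exists
  set δ : ℝ := 1 / ((n : ℝ) + 1) with hδdef
  have hδ : 0 < δ := by positivity
  let g : ℝ → ℝ := fun s => Real.pi * Real.smoothTransition ((1 - δ - s) / δ)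
  have hg : ContDiff ℝ (⊤ : ℕ∞) g :=
    contDiff_const.mul (Real.smoothTransition.contDiff.comp (by fun_prop))
  have hgδ : ∀ s, 1 - δ ≤ s → g s = 0 := by
    intro s hs
    have : (1 - δ - s) / δ ≤ 0 := div_nonpos_of_nonpos_of_nonneg (by linarith) hδ.le
    simp [g, Real.smoothTransition.zero_of_nonpos this]
  have hgpi : ∀ s, s ≤ 1 - 2 * δ → g s = Real.pi := by
    intro s hs
    have : 1 ≤ (1 - δ - s) / δ := by rw [le_div_iff₀ hδ]; linarith
    simp [g, Real.smoothTransition.one_of_one_le this]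
  have hg' : ContDiff ℝ (⊤ : ℕ∞) (-g) := hg.neg
  have hgδ' : ∀ s, 1 - δ ≤ s → (-g) s = 0 := fun s hs => by simp [hgδ s hs]
  let e : (ℝ × ℝ) ≃ (ℝ × ℝ) := ⟨psi K F I g, psi K F I (-g), psi_inv g h1 h2, fun z => by
    have := psi_inv (-g) h1 h2 z
    rwa [neg_neg] at this⟩
  have he1 : ContDiff ℝ (⊤ : ℕ∞) e := psi_smooth hK hg hδ hgδ h1 h2 h3 h4
  refine ⟨e, ⟨he1, psi_smooth hK hg' hδ hgδ' h1 h2 h3 h4, mp_of_det e he1 fun z => ?_, ?_⟩, ?_⟩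
  · have : (fderiv ℝ e z).det = 1 := psi_det hK hg hδ hgδ h1 h2 h3 h4 h5 z
    rw [this, abs_one]
  · intro x hx
    have : x ∉ K := fun hk => hx (h hk)
    simp [e, psi, this]
  · refine le_trans (measure_mono ?_) hn.le
    intro z hz
    by_contra hc
    apply hz
    by_cases hzK : z ∈ K
    · have h7 : (I z).1 ^ 2 + (I z).2 ^ 2 ≤ 1 - 2 * δ := by
        by_contra hcc
        exact hc ⟨hzK, not_le.1 hcc⟩
      have h8 : TT g (I z) = - I z := by
        ext <;> simp [TT, hgpi _ h7]
      change psi K F I g z = _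
      rw [psi, if_pos hzK, h8, h6, (h2 z hzK).2, prefl, if_pos hzK]
    · simp [e, psi, prefl, hzK]

lemma vol_bdry (c : ℝ × ℝ) (a b : ℝ) : volume (clR c a b \ opR c a b) = 0 := by
  have h1 : clR c a b = Metric.closedBall c.1 a ×ˢ Metric.closedBall c.2 b := by
    ext z; simp [clR, Real.dist_eq]
  have h2 : opR c a b = Metric.ball c.1 a ×ˢ Metric.ball c.2 b := by
    ext z; simp [opR, Real.dist_eq]
  have h3 : opR c a b ⊆ clR c a b := fun z hz => ⟨hz.1.le, hz.2.le⟩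
  rw [measure_sdiff h3]
  · rw [h1, h2, Measure.volume_eq_prod, Measure.prod_prod, Measure.prod_prod]
    simp
  · rw [h2]; exact (Metric.isOpen_ball.prod Metric.isOpen_ball).measurableSet.nullMeasurableSet
  · rw [h2, Measure.volume_eq_prod, Measure.prod_prod]
    simp [ENNReal.mul_eq_top]

theorem refl_between (M : Set (ℝ × ℝ)) (c : ℝ × ℝ) (a b : ℝ) (ha : 0 < a) (hb : 0 < b)
    (K : Set (ℝ × ℝ)) (h3 : opR c a b ⊆ K) (h3' : K ⊆ clR c a b)
    (h : K ⊆ M) : InA M (prefl K c) := by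
  refine InA.approx fun ε hε => ⟨_, refl_open M c a b ha hb (h3.trans h), ?_⟩
  refine le_trans (measure_mono ?_) (le_trans (vol_bdry c a b).le zero_le)
  intro z hz
  simp only [prefl, Set.mem_ofPred_eq] at hz
  by_contra hc
  apply hz
  by_cases h4 : z ∈ opR c a b
  · simp [h4, h3 h4]
  · have : z ∉ K := fun h5 => hc ⟨h3' h5, h4⟩
    simp [h4, this]

lemma opR_sub (c : ℝ × ℝ) (a b : ℝ) : opR c a b ⊆ clR c a b := fun z hz => ⟨hz.1.le, hz.2.le⟩

lemma sw_eq (x y : ℝ × ℝ) (r : ℝ) (B D m)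
    (h1 : ∀ z ∈ clR x r r, z ∉ D ∧ z ∉ clR y r r ∧
      (2 * x.1 - z.1, 2 * x.2 - z.2) ∈ clR x r r)
    (h2 : ∀ z ∈ clR y r r, z ∉ D ∧ 
      (2 * y.1 - z.1, 2 * y.2 - z.2) ∈ clR y r r)
    (h3 : ∀ z ∈ D, (2 * m.1 - z.1, 2 * m.2 - z.2) ∈ D)
    (hm1 : x.1 + y.1 = 2 * m.1) (hm2 : x.2 + y.2 = 2 * m.2)
    (hB : ∀ z, z ∈ B ↔ z ∈ clR x r r ∨ z ∈ clR y r r ∨ z ∈ D) :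
    sw x y r = fun z => prefl B m (prefl (clR x r r) x (prefl (clR y r r) y (prefl D m z))) := by
  funext z
  by_cases z1 : z ∈ clR x r r
  · obtain ⟨a, b, c⟩ := h1 z z1
    have d := (hB _).2 (Or.inl c)
    simp only [sw, prefl, z1, a, b, c, d, if_true, if_false]
    ext <;> simp <;> linarith
  by_cases z2 : z ∈ clR y r r
  · obtain ⟨a, c⟩ := h2 z z2
    have b : (2 * y.1 - z.1, 2 * y.2 - z.2) ∉ clR x r r := fun h => (h1 _ h).2.1 c
    have d := (hB _).2 (Or.inr (Or.inl c))
    simp only [sw, prefl, z1, z2, a, b, c, d, if_true, if_false]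
    ext <;> simp <;> linarith
  by_cases z3 : z ∈ D
  · have c := h3 z z3
    have a : (2 * m.1 - z.1, 2 * m.2 - z.2) ∉ clR x r r := fun h => (h1 _ h).1 c
    have b : (2 * m.1 - z.1, 2 * m.2 - z.2) ∉ clR y r r := fun h => (h2 _ h).1 c
    have d := (hB _).2 (Or.inr (Or.inr c))
    simp only [sw, prefl, z1, z2, z3, a, b, d, if_true, if_false]
    ext <;> simp
  · have d : z ∉ B := by rw [hB]; tauto
    simp only [sw, prefl, z1, z2, z3, d, if_false]

lemma sw_horiz (M : Set (ℝ × ℝ)) (x : ℝ × ℝ) (d r : ℝ) (hr : 0 < r) (hd : 2 * r < d)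
    (h : clR (x.1 + d / 2, x.2) (d / 2 + r) r ⊆ M) : InA M (sw x (x.1 + d, x.2) r) := by
  have h4 : 0 < d / 2 - r := by linarith
  have i1 : ∀ z, z ∈ clR (x.1 + d / 2, x.2) (d / 2 + r) r ↔ z ∈ clR x r r ∨ z ∈ clR (x.1 + d, x.2) r r
      ∨ z ∈ {z : ℝ × ℝ | |z.1 - (x.1 + d / 2)| < d / 2 - r ∧ |z.2 - x.2| ≤ r} := by
    intro z
    simp only [clR, Set.mem_ofPred_eq, abs_le, abs_lt]
    constructor
    · rintro ⟨⟨a, b⟩, c⟩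
      by_cases c2 : z.1 - x.1 ≤ r
      · left; refine ⟨⟨?_, ?_⟩, c⟩ <;> linarith
      by_cases c3 : z.1 - x.1 < d - r
      · right; right; refine ⟨⟨?_, ?_⟩, c⟩ <;> linarith
      · right; left; refine ⟨⟨?_, ?_⟩, c⟩ <;> linarith
    · rintro (⟨⟨a, b⟩, c⟩ | ⟨⟨a, b⟩, c⟩ | ⟨⟨a, b⟩, c⟩) <;>
        refine ⟨⟨?_, ?_⟩, c⟩ <;> linarith
  rw [sw_eq x (x.1 + d, x.2) r _ {z | |z.1 - (x.1 + d / 2)| < d / 2 - r ∧ |z.2 - x.2| ≤ r}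
    (x.1 + d / 2, x.2) ?_ ?_ ?_ (by simp; ring) (by simp; ring) i1]
  · refine InA.comp (refl_between M _ _ _ (by linarith) hr _ (opR_sub _ _ _) subset_rfl h)
      (InA.comp (refl_between M _ _ _ hr hr _ (opR_sub _ _ _) subset_rfl fun z hz => h ((i1 z).2 (.inl hz)))
      (InA.comp (refl_between M _ _ _ hr hr _ (opR_sub _ _ _) subset_rfl fun z hz => h ((i1 z).2 (.inr (.inl hz))))
      (refl_between M _ (d / 2 - r) r h4 hr _ (fun z hz => ⟨hz.1, hz.2.le⟩)
        (fun z hz => ⟨hz.1.le, hz.2⟩) fun z hz => h ((i1 z).2 (.inr (.inr hz))))))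
  all_goals
    intro z hz
    simp only [clR, Set.mem_ofPred_eq, abs_le, abs_lt] at hz ⊢
    obtain ⟨⟨a, b⟩, c, e⟩ := hz
    refine ⟨?_, ?_⟩
  · rintro ⟨⟨_, _⟩, _⟩; linarith
  · refine ⟨?_, ⟨?_, ?_⟩, ?_, ?_⟩
    · rintro ⟨⟨_, _⟩, _⟩; linarith
    all_goals linarith
  · rintro ⟨⟨_, _⟩, _⟩; linarith
  all_goals constructor
  · constructor <;> linarith
  · constructor <;> linarith
  all_goals linarith

lemma sw_vert (M : Set (ℝ × ℝ)) (x : ℝ × ℝ) (d r : ℝ) (hr : 0 < r) (hd : 2 * r < d)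
    (h : clR (x.1, x.2 + d / 2) r (d / 2 + r) ⊆ M) : InA M (sw x (x.1, x.2 + d) r) := by
  have h4 : 0 < d / 2 - r := by linarith
  have i1 : ∀ z, z ∈ clR (x.1, x.2 + d / 2) r (d / 2 + r) ↔ z ∈ clR x r r ∨ z ∈ clR (x.1, x.2 + d) r r
      ∨ z ∈ {z : ℝ × ℝ | |z.1 - x.1| ≤ r ∧ |z.2 - (x.2 + d / 2)| < d / 2 - r} := by
    intro z
    simp only [clR, Set.mem_ofPred_eq, abs_le, abs_lt]
    constructor
    · rintro ⟨c, ⟨a, b⟩⟩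
      by_cases c2 : z.2 - x.2 ≤ r
      · left; refine ⟨c, ⟨?_, ?_⟩⟩ <;> linarith
      by_cases c3 : z.2 - x.2 < d - r
      · right; right; refine ⟨c, ⟨?_, ?_⟩⟩ <;> linarith
      · right; left; refine ⟨c, ⟨?_, ?_⟩⟩ <;> linarith
    · rintro (⟨c, ⟨a, b⟩⟩ | ⟨c, ⟨a, b⟩⟩ | ⟨c, ⟨a, b⟩⟩) <;>
        refine ⟨c, ⟨?_, ?_⟩⟩ <;> linarith
  rw [sw_eq x (x.1, x.2 + d) r _ {z | |z.1 - x.1| ≤ r ∧ |z.2 - (x.2 + d / 2)| < d / 2 - r}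
    (x.1, x.2 + d / 2) ?_ ?_ ?_ (by simp; ring) (by simp; ring) i1]
  · refine InA.comp (refl_between M _ _ _ hr (by linarith) _ (opR_sub _ _ _) subset_rfl h)
      (InA.comp (refl_between M _ _ _ hr hr _ (opR_sub _ _ _) subset_rfl fun z hz => h ((i1 z).2 (.inl hz)))
      (InA.comp (refl_between M _ _ _ hr hr _ (opR_sub _ _ _) subset_rfl fun z hz => h ((i1 z).2 (.inr (.inl hz))))
      (refl_between M _ r (d / 2 - r) hr h4 _ (fun z hz => ⟨hz.1.le, hz.2⟩)
        (fun z hz => ⟨hz.1, hz.2.le⟩) fun z hz => h ((i1 z).2 (.inr (.inr hz))))))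
  all_goals
    intro z hz
    simp only [clR, Set.mem_ofPred_eq, abs_le, abs_lt] at hz ⊢
    obtain ⟨⟨a, b⟩, c, e⟩ := hz
    refine ⟨?_, ?_⟩
  · rintro ⟨_, _, _⟩; linarith
  · refine ⟨?_, ⟨?_, ?_⟩, ?_, ?_⟩
    · rintro ⟨_, _, _⟩; linarith
    all_goals linarith
  · rintro ⟨_, _, _⟩; linarith
  all_goals constructor
  · constructor <;> linarith
  · constructor <;> linarith
  all_goals linarith

/-- relation: small squares at x, y can be swapped -/
def SwR (M : Set (ℝ × ℝ)) (x y : ℝ × ℝ) : Prop :=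
  ∃ r₀ : ℝ, 0 < r₀ ∧ ∀ r, 0 < r → r < r₀ → InA M (sw x y r)

lemma clR_eq (x : ℝ × ℝ) (r : ℝ) : clR x r r = Metric.closedBall x r := by
  rw [← closedBall_prod_same]
  ext z; simp [clR, Real.dist_eq]

lemma disj {x y : ℝ × ℝ} {r : ℝ} (h : 2 * r < dist x y) : ∀ z, z ∈ clR x r r → z ∉ clR y r r := by
  intro z hx hy
  rw [clR_eq, Metric.mem_closedBall] at hx hy
  linarith [dist_triangle_left x y z]

lemma sw_self (x : ℝ × ℝ) (r : ℝ) : sw x x r = fun z => z := by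
  funext z; simp [sw]

lemma SwR.refl (M : Set (ℝ × ℝ)) (x : ℝ × ℝ) : SwR M x x :=
  ⟨1, one_pos, fun r _ _ => by rw [sw_self]; exact InA.id M⟩

lemma SwR.symm {M : Set (ℝ × ℝ)} {x y : ℝ × ℝ} (h : SwR M x y) : SwR M y x := by
  by_cases hxy : x = y
  · subst hxy; exact h
  obtain ⟨r0, hr0, h⟩ := h
  have := dist_pos.2 hxy
  refine ⟨min r0 (dist x y / 2), by positivity, fun r hr hr' => ?_⟩
  rw [lt_min_iff] at hr'
  convert h r hr hr'.1 using 1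
  funext z
  have := disj (x := x) (y := y) (r := r) (by linarith) z
  simp only [sw]
  split_ifs with h1 h2 <;> first | rfl | exact absurd h1 (this h2)

lemma sw_mem (x y z : ℝ × ℝ) (r : ℝ) (h : z ∈ clR x r r) : z - x + y ∈ clR y r r := by
  simpa [clR] using h

lemma SwR.trans {M : Set (ℝ × ℝ)} {x y z : ℝ × ℝ} (h : SwR M x y) (h' : SwR M y z) : SwR M x z := by
  by_cases hxy : x = y
  · subst hxy; exact h'
  by_cases hyz : y = z
  · subst hyz; exact h
  by_cases hxz : x = z
  · subst hxz; exact SwR.refl M x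
  obtain ⟨r0, hr0, h⟩ := h
  obtain ⟨r1, hr1, h'⟩ := h'
  have d1 := dist_pos.2 hxy
  have d2 := dist_pos.2 hyz
  have d3 := dist_pos.2 hxz
  refine ⟨min (min r0 r1) (min (dist x y / 2) (min (dist y z / 2) (dist x z / 2))), by positivity,
    fun r hr hr' => ?_⟩
  simp only [lt_min_iff] at hr'
  convert (h r hr hr'.1.1).comp ((h' r hr hr'.1.2).comp (h r hr hr'.1.1)) using 1
  funext u
  have e1 := disj (x := x) (y := y) (r := r) (by linarith)
  have e2 := disj (x := y) (y := z) (r := r) (by linarith)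
  have e3 := disj (x := x) (y := z) (r := r) (by linarith)
  have e1' : ∀ u, u ∈ clR y r r → u ∉ clR x r r := fun u h h' => e1 u h' h
  have e2' : ∀ u, u ∈ clR z r r → u ∉ clR y r r := fun u h h' => e2 u h' h
  have e3' : ∀ u, u ∈ clR z r r → u ∉ clR x r r := fun u h h' => e3 u h' h
  by_cases u1 : u ∈ clR x r r
  · have k1 := sw_mem x y u r u1
    have k2 := sw_mem y z _ r k1
    have k3 := e3' _ k2
    have k4 := e2' _ k2
    simp only [sw, u1, k1, k3, k4, if_true, if_false]
    abel
  by_cases u2 : u ∈ clR y r r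
  · have k1 := sw_mem y x u r u2
    have k2 := e1 _ k1
    have k3 := e3 _ k1
    have k4 := e2 _ u2
    simp only [sw, u1, u2, k1, k2, k3, k4, if_true, if_false]
    abel
  by_cases u3 : u ∈ clR z r r
  · have k1 := sw_mem z y u r u3
    have k2 := e1' _ k1
    simp only [sw, u1, u2, u3, k1, k2, if_true, if_false]
    abel
  · simp only [sw, u1, u2, u3, if_false]

lemma SwR.horiz_pos {M : Set (ℝ × ℝ)} {c : ℝ × ℝ} {ρ : ℝ} (hM : Metric.ball c ρ ⊆ M) (s t u : ℝ)
    (hst : s < t) (h1 : (s, u) ∈ Metric.ball c ρ) (h2 : (t, u) ∈ Metric.ball c ρ) : SwR M (s, u) (t, u) := by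
  rw [← ball_prod_same] at *
  simp only [Set.mem_prod, Metric.mem_ball, Real.dist_eq, abs_lt] at h1 h2
  obtain ⟨⟨a1, a2⟩, a3, a4⟩ := h1
  obtain ⟨⟨b1, b2⟩, b3, b4⟩ := h2
  refine ⟨min ((t - s) / 2) (min (min (ρ + (s - c.1)) (ρ - (t - c.1))) (min (ρ + (u - c.2)) (ρ - (u - c.2)))), ?_, ?_⟩
  · simp only [lt_min_iff]; refine ⟨?_, ⟨?_, ?_⟩, ?_, ?_⟩ <;> linarith
  intro r hr hr'
  simp only [lt_min_iff] at hr'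
  obtain ⟨q1, ⟨q2, q3⟩, q4, q5⟩ := hr'
  have := sw_horiz M (s, u) (t - s) r hr (by linarith) ?_
  · simpa using this
  refine subset_trans ?_ hM
  intro z hz
  simp only [clR, Set.mem_ofPred_eq, abs_le] at hz
  simp only [Set.mem_prod, Metric.mem_ball, Real.dist_eq, abs_lt]
  obtain ⟨⟨a, b⟩, e, f⟩ := hz
  refine ⟨⟨?_, ?_⟩, ?_, ?_⟩ <;> linarith

lemma SwR.vert_pos {M : Set (ℝ × ℝ)} {c : ℝ × ℝ} {ρ : ℝ} (hM : Metric.ball c ρ ⊆ M) (s t u : ℝ)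
    (hst : s < t) (h1 : (u, s) ∈ Metric.ball c ρ) (h2 : (u, t) ∈ Metric.ball c ρ) : SwR M (u, s) (u, t) := by
  rw [← ball_prod_same] at *
  simp only [Set.mem_prod, Metric.mem_ball, Real.dist_eq, abs_lt] at h1 h2
  obtain ⟨⟨a3, a4⟩, a1, a2⟩ := h1
  obtain ⟨⟨b3, b4⟩, b1, b2⟩ := h2
  refine ⟨min ((t - s) / 2) (min (min (ρ + (s - c.2)) (ρ - (t - c.2))) (min (ρ + (u - c.1)) (ρ - (u - c.1)))), ?_, ?_⟩
  · simp only [lt_min_iff]; refine ⟨?_, ⟨?_, ?_⟩, ?_, ?_⟩ <;> linarith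
  intro r hr hr'
  simp only [lt_min_iff] at hr'
  obtain ⟨q1, ⟨q2, q3⟩, q4, q5⟩ := hr'
  have := sw_vert M (u, s) (t - s) r hr (by linarith) ?_
  · simpa using this
  refine subset_trans ?_ hM
  intro z hz
  simp only [clR, Set.mem_ofPred_eq, abs_le] at hz
  simp only [Set.mem_prod, Metric.mem_ball, Real.dist_eq, abs_lt]
  obtain ⟨⟨a, b⟩, e, f⟩ := hz
  refine ⟨⟨?_, ?_⟩, ?_, ?_⟩ <;> linarith

lemma SwR.ball {M : Set (ℝ × ℝ)} {c : ℝ × ℝ} {ρ : ℝ} (hM : Metric.ball c ρ ⊆ M) (y)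
    (hc : c ∈ Metric.ball c ρ) (hy : y ∈ Metric.ball c ρ) : SwR M c y := by
  have hmid : (y.1, c.2) ∈ Metric.ball c ρ := by
    rw [← ball_prod_same] at *
    exact ⟨hy.1, hc.2⟩
  have k1 : SwR M c (y.1, c.2) := by
    rcases lt_trichotomy c.1 y.1 with h | h | h
    · exact SwR.horiz_pos hM _ _ _ h hc hmid
    · rw [← h]; exact SwR.refl M c
    · exact (SwR.horiz_pos hM _ _ _ h hmid hc).symm
  have k2 : SwR M (y.1, c.2) y := by
    rcases lt_trichotomy c.2 y.2 with h | h | h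
    · exact SwR.vert_pos hM _ _ _ h hmid hy
    · rw [h]; exact SwR.refl M y
    · exact (SwR.vert_pos hM _ _ _ h hy hmid).symm
  exact k1.trans k2

lemma SwR.all {M : Set (ℝ × ℝ)} (ho : IsOpen M) (hc : IsConnected M) {x y} (hx : x ∈ M) (hy : y ∈ M) :
    SwR M x y := by
  refine hc.isPreconnected.induction₂ (SwR M) ?_ (fun x y z _ _ _ => SwR.trans)
    (fun x y _ _ => SwR.symm) hx hy
  intro x hx
  obtain ⟨ρ, hρ, hb⟩ := Metric.isOpen_iff.1 ho x hx
  apply mem_nhdsWithin_of_mem_nhds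
  filter_upwards [Metric.ball_mem_nhds x hρ] with y hy
  exact SwR.ball hb y (Metric.mem_ball_self hρ) hy

open Classical in
noncomputable def famF (τ : ℝ × ℝ) (r : ℝ × ℝ → ℝ) (t : Finset (ℝ × ℝ)) (z : ℝ × ℝ) : ℝ × ℝ :=
  if ∃ x ∈ t, z ∈ clR x (r x) (r x) then z + τ
  else if ∃ x ∈ t, z - τ ∈ clR x (r x) (r x) then z - τ else z

lemma mem_shift (a τ z : ℝ × ℝ) (r : ℝ) : z ∈ clR (a + τ) r r ↔ z - τ ∈ clR a r r := by
  simp [clR, sub_sub, add_comm]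

lemma famF_mem (M : Set (ℝ × ℝ)) (τ : ℝ × ℝ) (r : ℝ × ℝ → ℝ) (Q : Set (ℝ × ℝ))
    (hQ : ∀ z ∈ Q, z + τ ∉ Q) (t : Finset (ℝ × ℝ))
    (hsub : ∀ x ∈ t, clR x (r x) (r x) ⊆ Q)
    (hd : ∀ x ∈ t, ∀ y ∈ t, x ≠ y → ∀ z, z ∈ clR x (r x) (r x) → z ∉ clR y (r y) (r y))
    (hA : ∀ x ∈ t, InA M (sw x (x + τ) (r x))) : InA M (famF τ r t) := by
  classical
  induction t using Finset.induction_on with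
  | empty =>
    convert InA.id M using 1
    funext z; simp [famF]
  | insert a t ha ih =>
    have ih' := ih (fun x hx => hsub x (Finset.mem_insert_of_mem hx))
      (fun x hx y hy => hd x (Finset.mem_insert_of_mem hx) y (Finset.mem_insert_of_mem hy))
      (fun x hx => hA x (Finset.mem_insert_of_mem hx))
    convert (hA a (Finset.mem_insert_self a t)).comp ih' using 1
    funext z
    have hsa := hsub a (Finset.mem_insert_self a t)
    have hQ' : ∀ z ∈ Q, z - τ ∉ Q := fun z hz h => hQ _ h (by simpa using hz)
    by_cases h1 : ∃ x ∈ t, z ∈ clR x (r x) (r x)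
    · obtain ⟨x, hx, hz⟩ := h1
      have hzQ := hsub x (Finset.mem_insert_of_mem hx) hz
      have e1 : ∃ x ∈ insert a t, z ∈ clR x (r x) (r x) := ⟨x, Finset.mem_insert_of_mem hx, hz⟩
      have e2 : ∃ x ∈ t, z ∈ clR x (r x) (r x) := ⟨x, hx, hz⟩
      have e3 : z + τ ∉ clR a (r a) (r a) := fun h => hQ _ hzQ (hsa h)
      have e4 : z ∉ clR a (r a) (r a) :=
        hd x (Finset.mem_insert_of_mem hx) a (Finset.mem_insert_self a t)
          (fun h => ha (h ▸ hx)) z hz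
      simp only [famF, sw, e1, e2, e3, mem_shift, add_sub_cancel_right, e4, if_true, if_false]
    by_cases h2 : ∃ x ∈ t, z - τ ∈ clR x (r x) (r x)
    · obtain ⟨x, hx, hz⟩ := h2
      have hzQ := hsub x (Finset.mem_insert_of_mem hx) hz
      have hzn : z ∉ Q := fun h => hQ' _ h hzQ
      have e1 : ¬ ∃ x ∈ insert a t, z ∈ clR x (r x) (r x) := by
        rintro ⟨y, hy, hzy⟩
        exact hzn (hsub y hy hzy)
      have e2 : ∃ x ∈ insert a t, z - τ ∈ clR x (r x) (r x) := ⟨x, Finset.mem_insert_of_mem hx, hz⟩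
      have e2' : ∃ x ∈ t, z - τ ∈ clR x (r x) (r x) := ⟨x, hx, hz⟩
      have e3 : z - τ - τ ∉ clR a (r a) (r a) := fun h => hQ' _ hzQ (hsa h)
      have e4 : z - τ ∉ clR a (r a) (r a) :=
        hd x (Finset.mem_insert_of_mem hx) a (Finset.mem_insert_self a t)
          (fun h => ha (h ▸ hx)) _ hz
      simp only [famF, sw, e1, e2, e2', h1, e3, mem_shift, e4, if_true, if_false]
    · have e1 : (∃ x ∈ insert a t, z ∈ clR x (r x) (r x)) ↔ z ∈ clR a (r a) (r a) := by
        constructor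
        · rintro ⟨y, hy, hzy⟩
          rcases Finset.mem_insert.1 hy with rfl | hy
          · exact hzy
          · exact absurd ⟨y, hy, hzy⟩ h1
        · exact fun h => ⟨a, Finset.mem_insert_self a t, h⟩
      have e2 : (∃ x ∈ insert a t, z - τ ∈ clR x (r x) (r x)) ↔ z - τ ∈ clR a (r a) (r a) := by
        constructor
        · rintro ⟨y, hy, hzy⟩
          rcases Finset.mem_insert.1 hy with rfl | hy
          · exact hzy
          · exact absurd ⟨y, hy, hzy⟩ h2
        · exact fun h => ⟨a, Finset.mem_insert_self a t, h⟩
      have e5 : z - a + (a + τ) = z + τ := by abel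
      have e6 : z - (a + τ) + a = z - τ := by abel
      simp only [famF, sw, h1, h2, mem_shift, if_false, e1, e2, e5, e6]

lemma cover_fin (U : Set (ℝ × ℝ)) (hU : MeasurableSet U) (hfin : volume U ≠ ⊤) (R : ℝ × ℝ → ℝ)
    (hR : ∀ x ∈ U, 0 < R x) (ε : ENNReal) (hε : 0 < ε) :
    ∃ (t : Finset (ℝ × ℝ)) (r : ℝ × ℝ → ℝ), (↑t ⊆ U) ∧ (∀ x ∈ t, 0 < r x ∧ r x < R x) ∧
      (∀ x ∈ t, ∀ y ∈ t, x ≠ y → ∀ z, z ∈ clR x (r x) (r x) → z ∉ clR y (r y) (r y)) ∧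
      volume (U \ ⋃ x ∈ t, clR x (r x) (r x)) ≤ ε := by
  obtain ⟨t, r, htc, htU, hr, hcov, hdis⟩ := Besicovitch.exists_disjoint_closedBall_covering_ae
    (volume : Measure (ℝ × ℝ)) (fun _ => Set.univ) U
    (fun x _ δ hδ => ⟨δ / 2, trivial, by constructor <;> linarith⟩) R hR
  obtain ⟨s, hs⟩ : ∃ s : Finset (ℝ × ℝ), (↑s ⊆ t) ∧
      volume (U \ ⋃ x ∈ s, Metric.closedBall x (r x)) ≤ ε := by
    rcases t.eq_empty_or_nonempty with rfl | hne
    · refine ⟨∅, by simp, ?_⟩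
      simp at hcov ⊢
      rw [hcov]; exact zero_le
    obtain ⟨f, rfl⟩ := htc.exists_eq_range hne
    classical
    have hlim := tendsto_measure_iInter_atTop (μ := (volume : Measure (ℝ × ℝ)))
      (s := fun n : ℕ => U \ ⋃ x ∈ (Finset.range n).image f, Metric.closedBall x (r x))
      (fun n => (hU.diff (Finset.measurableSet_biUnion _
        fun _ _ => Metric.isClosed_closedBall.measurableSet)).nullMeasurableSet) ?_
      ⟨0, ne_top_of_le_ne_top hfin (measure_mono Set.sdiff_subset)⟩
    · have hz : volume (⋂ n : ℕ, U \ ⋃ x ∈ (Finset.range n).image f, Metric.closedBall x (r x)) = 0 := by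
        refine measure_mono_null ?_ hcov
        intro z hz
        simp only [Set.mem_iInter] at hz
        refine ⟨(hz 0).1, ?_⟩
        intro hc
        simp only [Set.mem_iUnion, Set.mem_range] at hc
        obtain ⟨x, ⟨n, rfl⟩, hx⟩ := hc
        apply (hz (n + 1)).2
        simp only [Set.mem_iUnion]
        exact ⟨f n, Finset.mem_image_of_mem f (by simp), hx⟩
      rw [hz] at hlim
      obtain ⟨n, hn⟩ := (hlim.eventually (gt_mem_nhds hε)).exists
      refine ⟨(Finset.range n).image f, ?_, hn.le⟩
      intro x hx
      simp at hx
      obtain ⟨m, _, rfl⟩ := hx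
      exact ⟨m, rfl⟩
    · intro m n hmn
      apply Set.sdiff_subset_sdiff_right
      apply Set.biUnion_subset_biUnion_left
      intro x hx
      exact Finset.image_subset_image (Finset.range_mono hmn) hx
  refine ⟨s, r, hs.1.trans htU, fun x hx => (hr x (hs.1 hx)).2, ?_, by simpa only [clR_eq] using hs.2⟩
  intro x hx y hy hxy z hzx hzy
  rw [clR_eq] at hzx hzy
  exact Set.disjoint_left.1 (hdis (hs.1 hx) (hs.1 hy) hxy) hzx hzy

theorem main_InA
    (M : Set (ℝ × ℝ)) (hMopen : IsOpen M) (hMconn : IsConnected M)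
    (c₁ c₂ : ℝ × ℝ) (l : ℝ)
    (Q₁ Q₂ : Set (ℝ × ℝ))
    (hQ₁ : Q₁ = clR c₁ l l)
    (hQ₂ : Q₂ = clR c₂ l l)
    (hQ₁M : Q₁ ⊆ M) (hQ₂M : Q₂ ⊆ M) (hdisj : Disjoint Q₁ Q₂)
    (p : ℝ × ℝ → ℝ × ℝ)
    (hp₁ : ∀ x ∈ Q₁, p x = x - c₁ + c₂)
    (hp₂ : ∀ x ∈ Q₂, p x = x - c₂ + c₁)
    (hp₃ : ∀ x, x ∉ Q₁ ∪ Q₂ → p x = x) : InA M p := by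
  apply InA.approx
  intro ε hε
  set τ := c₂ - c₁ with hτ
  have hc2 : c₂ = c₁ + τ := by rw [hτ]; abel
  set U := opR c₁ l l with hUdef
  have hUQ : U ⊆ Q₁ := by rw [hQ₁]; exact opR_sub _ _ _
  have hUb : U = Metric.ball c₁ l := by
    rw [← ball_prod_same]
    ext z; simp [hUdef, opR, Real.dist_eq]
  have hQ2 : ∀ z, z ∈ Q₂ ↔ z - τ ∈ Q₁ := by
    intro z; rw [hQ₂, hQ₁, hc2]; exact mem_shift _ _ _ _
  have hrel : ∀ x, ∃ r0 : ℝ, x ∈ U → 0 < r0 ∧ ∀ r, 0 < r → r < r0 → InA M (sw x (x + τ) r) := by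
    intro x
    by_cases hx : x ∈ U
    · obtain ⟨r0, h0, h⟩ := SwR.all hMopen hMconn (hQ₁M (hUQ hx))
        (hQ₂M ((hQ2 (x + τ)).2 (by simpa using hUQ hx)))
      exact ⟨r0, fun _ => ⟨h0, h⟩⟩
    · exact ⟨0, fun h => absurd h hx⟩
  choose r0 hr0 using hrel
  obtain ⟨t, r, htU, hr, hd, hvol⟩ := cover_fin U (hUb ▸ Metric.isOpen_ball.measurableSet)
    (hUb ▸ Metric.isBounded_ball.measure_lt_top.ne) (fun x => min (r0 x) (l - dist x c₁))
    (fun x hx => lt_min (hr0 x hx).1 (by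
      rw [hUb, Metric.mem_ball] at hx; linarith)) (ε / 2) (ENNReal.half_pos hε.ne')
  have hsub : ∀ x ∈ t, clR x (r x) (r x) ⊆ Q₁ := by
    intro x hx
    rw [hQ₁, clR_eq, clR_eq]
    apply Metric.closedBall_subset_closedBall'
    linarith [(lt_min_iff.1 (hr x hx).2).2]
  have hdj : ∀ z ∈ Q₁, z + τ ∉ Q₁ := fun z hz h =>
    Set.disjoint_left.1 hdisj h ((hQ2 _).2 (by simpa using hz))
  refine ⟨famF τ r t, famF_mem M τ r Q₁ hdj t hsub hd
    (fun x hx => (hr0 x (htU hx)).2 _ (hr x hx).1 (lt_min_iff.1 (hr x hx).2).1), ?_⟩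
  set N := Q₁ \ ⋃ x ∈ t, clR x (r x) (r x) with hN
  have hNv : volume N ≤ ε / 2 := by
    have : N ⊆ (U \ ⋃ x ∈ t, clR x (r x) (r x)) ∪ (clR c₁ l l \ opR c₁ l l) := by
      rintro z ⟨h1, h2⟩
      by_cases hz : z ∈ U
      · exact Or.inl ⟨hz, h2⟩
      · exact Or.inr ⟨hQ₁ ▸ h1, hz⟩
    refine (measure_mono this).trans ((measure_union_le _ _).trans ?_)
    rw [vol_bdry, add_zero]; exact hvol
  have hsubset : {x | famF τ r t x ≠ p x} ⊆ N ∪ (fun z => z + (-τ)) ⁻¹' N := by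
    intro z hz
    by_contra hc
    apply hz
    simp only [Set.mem_union, not_or, Set.mem_preimage, ← sub_eq_add_neg] at hc
    obtain ⟨n1, n2⟩ := hc
    by_cases z1 : z ∈ Q₁
    · have : ∃ x ∈ t, z ∈ clR x (r x) (r x) := by
        by_contra hcc
        exact n1 ⟨z1, by simpa using hcc⟩
      rw [hp₁ z z1, famF, if_pos this, hτ]; abel
    have k1 : ¬ ∃ x ∈ t, z ∈ clR x (r x) (r x) := by
      rintro ⟨x, hx, h⟩; exact z1 (hsub x hx h)
    by_cases z2 : z ∈ Q₂
    · have : ∃ x ∈ t, z - τ ∈ clR x (r x) (r x) := by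
        by_contra hcc
        exact n2 ⟨(hQ2 z).1 z2, by simpa using hcc⟩
      rw [hp₂ z z2, famF, if_neg k1, if_pos this, hτ]; abel
    have k2 : ¬ ∃ x ∈ t, z - τ ∈ clR x (r x) (r x) := by
      rintro ⟨x, hx, h⟩; exact z2 ((hQ2 z).2 (hsub x hx h))
    rw [hp₃ z (by simp [z1, z2]), famF, if_neg k1, if_neg k2]
  refine (measure_mono hsubset).trans ((measure_union_le _ _).trans ?_)
  rw [measure_preimage_add_right]
  calc _ ≤ ε / 2 + ε / 2 := add_le_add hNv hNv
    _ = ε := ENNReal.add_halves ε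

lemma InG.diffeo {M : Set (ℝ × ℝ)} {e : (ℝ × ℝ) ≃ (ℝ × ℝ)} (he : InG M e) (hM : MeasurableSet M) :
    IsSmoothAPDiffeo M e := by
  have hmem : ∀ x, e x ∈ M ↔ x ∈ M := by
    intro x
    constructor
    · intro h
      by_contra hx
      rw [he.fix x hx] at h; exact hx h
    · intro h
      by_contra hx
      have := e.injective (he.fix _ hx)
      rw [this] at hx; exact hx h
  refine ⟨⟨fun x hx => (hmem x).2 hx, e.injective.injOn, fun y hy => ⟨e.symm y, ?_, by simp⟩⟩,
    he.smooth.contDiffOn, ⟨e.symm, he.smooth_symm.contDiffOn, by simp, by simp⟩, ?_⟩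
  · rw [← hmem]; simpa using hy
  · have := he.mp.restrict_preimage hM
    have h2 : e ⁻¹' M = M := by ext x; exact hmem x
    rwa [h2] at this

/-- the map exchanging two disjoint closed axis-parallel squares of
equal side length contained in `M` is an `L²` limit of measure-preserving smooth
diffeomorphisms of `M`. -/
theorem square_swap_approx
    (M : Set (ℝ × ℝ)) (hMopen : IsOpen M) (hMconn : IsConnected M)
    (hMbdd : Bornology.IsBounded M) (hMsm : HasSmoothBoundary M)
    (c₁ c₂ : ℝ × ℝ) (ℓ : ℝ) (hℓ : 0 < ℓ)
    (Q₁ Q₂ : Set (ℝ × ℝ))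
    (hQ₁ : Q₁ = Set.Icc (c₁ - (ℓ / 2, ℓ / 2)) (c₁ + (ℓ / 2, ℓ / 2)))
    (hQ₂ : Q₂ = Set.Icc (c₂ - (ℓ / 2, ℓ / 2)) (c₂ + (ℓ / 2, ℓ / 2)))
    (hQ₁M : Q₁ ⊆ M) (hQ₂M : Q₂ ⊆ M) (hdisj : Disjoint Q₁ Q₂)
    (p : ℝ × ℝ → ℝ × ℝ)
    (hp₁ : ∀ x ∈ Q₁, p x = x - c₁ + c₂)
    (hp₂ : ∀ x ∈ Q₂, p x = x - c₂ + c₁)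
    (hp₃ : ∀ x, x ∉ Q₁ ∪ Q₂ → p x = x) :
    ∃ φ : ℕ → ℝ × ℝ → ℝ × ℝ, (∀ n, IsSmoothAPDiffeo M (φ n)) ∧
      Filter.Tendsto
        (fun n => ∫ x, (((φ n x).1 - (p x).1) ^ 2 + ((φ n x).2 - (p x).2) ^ 2)
          ∂(volume.restrict M))
        Filter.atTop (nhds 0) := by
  have hIcc : ∀ c : ℝ × ℝ, Set.Icc (c - (ℓ / 2, ℓ / 2)) (c + (ℓ / 2, ℓ / 2)) = clR c (ℓ / 2) (ℓ / 2) := by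
    intro c
    ext z
    simp only [Set.mem_Icc, clR, Set.mem_ofPred_eq, abs_le, Prod.le_def, Prod.fst_sub, Prod.snd_sub,
      Prod.fst_add, Prod.snd_add]
    constructor
    · rintro ⟨⟨_, _⟩, _, _⟩; refine ⟨⟨?_, ?_⟩, ?_, ?_⟩ <;> linarith
    · rintro ⟨⟨_, _⟩, _, _⟩; refine ⟨⟨?_, ?_⟩, ?_, ?_⟩ <;> linarith
  have hA := main_InA M hMopen hMconn c₁ c₂ (ℓ / 2) Q₁ Q₂ (hQ₁.trans (hIcc _)) (hQ₂.trans (hIcc _))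
    hQ₁M hQ₂M hdisj p hp₁ hp₂ hp₃
  have hA' : ∀ n : ℕ, ∃ e, InG M e ∧ volume {x | e x ≠ p x} ≤ ENNReal.ofReal (1 / ((n : ℝ) + 1)) :=
    fun n => hA _ (ENNReal.ofReal_pos.2 (by positivity))
  choose e he hev using hA'
  refine ⟨fun n => e n, fun n => (he n).diffeo hMopen.measurableSet, ?_⟩
  have hpM : ∀ x ∈ M, p x ∈ M := by
    intro x hx
    by_cases x1 : x ∈ Q₁
    · rw [hp₁ x x1]
      apply hQ₂M
      rw [hQ₂, hIcc]; rw [hQ₁, hIcc] at x1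
      exact sw_mem _ _ _ _ x1
    by_cases x2 : x ∈ Q₂
    · rw [hp₂ x x2]
      apply hQ₁M
      rw [hQ₁, hIcc]; rw [hQ₂, hIcc] at x2
      exact sw_mem _ _ _ _ x2
    · rw [hp₃ x (by simp [x1, x2])]; exact hx
  obtain ⟨C, hC⟩ := Metric.isBounded_iff.1 hMbdd
  have hC0 : 0 ≤ C := by
    obtain ⟨x, hx⟩ := hMconn.nonempty
    simpa using hC hx hx
  have key : ∀ x ∈ M, ∀ y ∈ M, (x.1 - y.1) ^ 2 + (x.2 - y.2) ^ 2 ≤ 2 * C ^ 2 := by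
    intro x hx y hy
    have := hC hx hy
    rw [Prod.dist_eq, max_le_iff, Real.dist_eq, Real.dist_eq] at this
    have h1 := sq_le_sq' (by linarith [abs_le.1 this.1]) (abs_le.1 this.1).2
    have h2 := sq_le_sq' (by linarith [abs_le.1 this.2]) (abs_le.1 this.2).2
    linarith
  have hlim : Filter.Tendsto (fun n : ℕ => 2 * C ^ 2 * (1 / ((n : ℝ) + 1))) Filter.atTop (nhds 0) := by
    simpa using (tendsto_one_div_add_atTop_nhds_zero_nat (𝕜 := ℝ)).const_mul (2 * C ^ 2)
  refine squeeze_zero (fun n => integral_nonneg fun x => by positivity) (fun n => ?_) hlim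
  set S := toMeasurable volume {x | e n x ≠ p x} with hS
  have hSm : MeasurableSet S := measurableSet_toMeasurable _ _
  have hSv : volume S ≤ ENNReal.ofReal (1 / ((n : ℝ) + 1)) := by
    rw [hS, measure_toMeasurable]; exact hev n
  have hSM : volume.restrict M S ≤ ENNReal.ofReal (1 / ((n : ℝ) + 1)) :=
    (Measure.restrict_apply_le _ _).trans hSv
  have hint : Integrable (S.indicator (fun _ => 2 * C ^ 2)) (volume.restrict M) := by
    rw [integrable_indicator_iff hSm]
    exact integrableOn_const (hs := ne_top_of_le_ne_top ENNReal.ofReal_ne_top hSM)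
  calc _ ≤ ∫ x, S.indicator (fun _ => 2 * C ^ 2) x ∂(volume.restrict M) := by
        refine integral_mono_of_nonneg (Filter.Eventually.of_forall fun x => by
          simp only [Pi.zero_apply]; positivity) hint ?_
        filter_upwards [ae_restrict_mem hMopen.measurableSet] with x hx
        by_cases h : e n x = p x
        · simp only [h, sub_self]
          simp only [ne_eq, OfNat.ofNat_ne_zero, not_false_eq_true, zero_pow, add_zero]
          exact Set.indicator_nonneg (fun _ _ => by positivity) x
        · rw [Set.indicator_of_mem (subset_toMeasurable _ _ h)]
          exact key _ (((he n).diffeo hMopen.measurableSet).1.mapsTo hx) _ (hpM x hx)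
    _ = 2 * C ^ 2 * (volume.restrict M).real S := by
        rw [integral_indicator_const _ hSm, smul_eq_mul, mul_comm]
    _ ≤ _ := by
        apply mul_le_mul_of_nonneg_left _ (by positivity)
        exact ENNReal.toReal_le_of_le_ofReal (by positivity) hSM
end

section
/- Let X and Y be real normed vector spaces, let Y* denote the topological dual of Y, and let C ⊆ Y be a convex cone (closed under addition and under multiplication by nonnegative scalars) with nonempty interior. Let J : X → ℝ and S : X → Y, and let g₀ ∈ X satisfy S g₀ ∈ −C and J(g₀) = inf{ J(g) : g ∈ X, S g ∈ −C }. Assume: (H1) for every h ∈ X the one-sided limits J'(g₀;h) := lim_{ε→0⁺} (J(g₀+εh) − J(g₀))/ε exists in ℝ and S'(g₀;h) := lim_{ε→0⁺} (S(g₀+εh) − S(g₀))/ε exists in Y; (H2) the map h ↦ J'(g₀;h) is convex, and for all λ ∈ [0,1] and h₁, h₂ ∈ X one has S'(g₀; λh₁+(1−λ)h₂) − λ S'(g₀;h₁) − (1−λ) S'(g₀;h₂) ∈ −C. Then there exist c₀ ≥ 0 and λ* ∈ Y* with ⟨λ*, f⟩ ≥ 0 for all f ∈ C, such that (c₀, λ*)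 ≠ (0, 0), c₀ J'(g₀;h) + ⟨λ*, S'(g₀;h)⟩ ≥ 0 for every h ∈ X, and ⟨λ*, S g₀⟩ = 0. -/
open Filter

/-- abstract Karush-Kuhn-Tucker / Rakotoson-Serre optimality theorem
with a convex cone of constraints having nonempty interior. -/
theorem abstract_KKT
    {X Y : Type*} [NormedAddCommGroup X] [NormedSpace ℝ X]
    [NormedAddCommGroup Y] [NormedSpace ℝ Y]
    (C : Set Y)
    (hCsmul : ∀ k ∈ C, ∀ α : ℝ, 0 ≤ α → α • k ∈ C)
    (hCadd : ∀ a ∈ C, ∀ b ∈ C, a + b ∈ C)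
    (hCint : (interior C).Nonempty)
    (J : X → ℝ) (S : X → Y) (g₀ : X)
    (hfeas : S g₀ ∈ -C)
    (hopt : ∀ g : X, S g ∈ -C → J g₀ ≤ J g)
    -- (H1): the one-sided directional derivatives of `J` and `S` at `g₀` exist
    (J' : X → ℝ) (S' : X → Y)
    (hJ' : ∀ h : X, Tendsto (fun ε : ℝ => (J (g₀ + ε • h) - J g₀) / ε)
      (nhdsWithin 0 (Set.Ioi 0)) (nhds (J' h)))
    (hS' : ∀ h : X, Tendsto (fun ε : ℝ => ε⁻¹ • (S (g₀ + ε • h) - S g₀))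
      (nhdsWithin 0 (Set.Ioi 0)) (nhds (S' h)))
    -- (H2): convexity of the directional derivatives
    (hJ'conv : ConvexOn ℝ Set.univ J')
    (hS'conv : ∀ lam : ℝ, lam ∈ Set.Icc (0:ℝ) 1 → ∀ h₁ h₂ : X,
      S' (lam • h₁ + (1 - lam) • h₂) - lam • S' h₁ - (1 - lam) • S' h₂ ∈ -C) :
    ∃ (c₀ : ℝ) (lamStar : Y →L[ℝ] ℝ), 0 ≤ c₀ ∧
      (∀ f ∈ C, 0 ≤ lamStar f) ∧
      ¬(c₀ = 0 ∧ lamStar = 0) ∧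
      (∀ h : X, 0 ≤ c₀ * J' h + lamStar (S' h)) ∧
      lamStar (S g₀) = 0 := by
  have hCi_add : ∀ k ∈ C, ∀ y ∈ interior C, k + y ∈ interior C := by
    intro k hk y hy
    have ho : IsOpen ((fun z => k + z) '' interior C) :=
      (Homeomorph.addLeft k).isOpenMap _ isOpen_interior
    refine interior_maximal ?_ ho ⟨y, hy, rfl⟩
    rintro _ ⟨z, hz, rfl⟩
    exact hCadd k hk z (interior_subset hz)
  have hCi_smul : ∀ y ∈ interior C, ∀ α : ℝ, 0 < α → α • y ∈ interior C := by
    intro y hy α hα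
    have ho : IsOpen ((fun z => α • z) '' interior C) :=
      (Homeomorph.smulOfNeZero α hα.ne').isOpenMap _ isOpen_interior
    refine interior_maximal ?_ ho ⟨y, hy, rfl⟩
    rintro _ ⟨z, hz, rfl⟩
    exact hCsmul z (interior_subset hz) α hα.le
  have hCconv : Convex ℝ C := by
    intro x hx y hy a b ha hb _
    exact hCadd _ (hCsmul x hx a ha) _ (hCsmul y hy b hb)
  obtain ⟨e, he⟩ := hCint
  have hg : -S g₀ ∈ C := hfeas
  have h0C : (0 : Y) ∈ C := by simpa using hCsmul e (interior_subset he) 0 le_rfl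
  let s : Set (ℝ × Y) := Set.Iio 0 ×ˢ (-interior C)
  let t : Set (ℝ × Y) := {p | ∃ h, J' h ≤ p.1 ∧ p.2 - S g₀ - S' h ∈ C}
  have hs1 : Convex ℝ s := (convex_Iio 0).prod hCconv.interior.neg
  have hs2 : IsOpen s := isOpen_Iio.prod isOpen_interior.neg
  have ht : Convex ℝ t := by
    rintro ⟨r, y⟩ ⟨h1, hr, hy⟩ ⟨r', y'⟩ ⟨h2, hr', hy'⟩ a b ha hb hab
    refine ⟨a • h1 + b • h2, ?_, ?_⟩
    · refine (hJ'conv.2 trivial trivial ha hb hab).trans ?_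
      simp only [smul_eq_mul, Prod.smul_mk, Prod.mk_add_mk]
      dsimp only at hr hr'
      gcongr
    · have h3 := hS'conv a ⟨ha, by linarith⟩ h1 h2
      obtain rfl : b = 1 - a := by linarith
      have h4 := hCadd _ (hCadd _ (hCsmul _ hy a ha) _ (hCsmul _ hy' _ hb)) _ h3
      convert h4 using 1
      simp only [Prod.smul_mk, Prod.mk_add_mk]
      module
  have hdisj : Disjoint s t := by
    rw [Set.disjoint_left]
    rintro ⟨r, y⟩ ⟨hr, hy⟩ ⟨h, hJh, hSh⟩
    simp only [Set.mem_Iio, Set.mem_neg] at hr hy hJh hSh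
    have hq : -(S g₀ + S' h) ∈ interior C := by
      convert hCi_add _ hSh _ hy using 1
      abel
    have e1 : ∀ᶠ ε : ℝ in nhdsWithin 0 (Set.Ioi 0),
        -(S g₀ + ε⁻¹ • (S (g₀ + ε • h) - S g₀)) ∈ interior C :=
      ((hS' h).const_add (S g₀)).neg.eventually_mem (isOpen_interior.mem_nhds hq)
    have e2 := (hJ' h).eventually_lt_const (lt_of_le_of_lt hJh hr)
    have e3 : ∀ᶠ ε : ℝ in nhdsWithin 0 (Set.Ioi 0), ε ∈ Set.Ioo (0:ℝ) 1 :=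
      Ioo_mem_nhdsGT one_pos
    obtain ⟨ε, h1, h2, h3, h4⟩ := (e1.and (e2.and e3)).exists
    have h5 : S (g₀ + ε • h) ∈ -C := by
      have h6 := hCadd _ (hCsmul _ hg (1 - ε) (by linarith)) _
        (hCsmul _ (interior_subset h1) ε h3.le)
      rw [Set.mem_neg]
      convert h6 using 1
      rw [smul_neg ε, smul_add ε, smul_smul, mul_inv_cancel₀ h3.ne']
      module
    have h7 := hopt _ h5
    have := div_nonneg (sub_nonneg.2 h7) h3.le
    linarith
  obtain ⟨f, u, hfs, hft⟩ := geometric_hahn_banach_open hs1 hs2 ht hdisj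
  have hcone : ∀ r : ℝ, r < 0 → ∀ y ∈ interior C, ∀ α : ℝ, 0 < α →
      α * f (r, -y) < u := by
    intro r hr y hy α hα
    have := hfs (α • (r, -y)) ⟨by simpa using mul_neg_of_pos_of_neg hα hr, by
      simpa using hCi_smul y hy α hα⟩
    rwa [map_smul, smul_eq_mul] at this
  have hnp : ∀ r : ℝ, r < 0 → ∀ y ∈ interior C, f (r, -y) ≤ 0 := by
    intro r hr y hy
    by_contra! hc
    have h1 := hcone r hr y hy 1 one_pos
    have h2 := hcone r hr y hy (u / f (r, -y)) (div_pos (by linarith) hc)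
    rw [div_mul_cancel₀ _ hc.ne'] at h2
    exact lt_irrefl _ h2
  have hu : 0 ≤ u := by
    by_contra! hc
    have h1 := hcone (-1) (by norm_num) e he 1 one_pos
    have h3 : f (-1, -e) < 0 := by linarith
    have h2 := hcone (-1) (by norm_num) e he _ (div_pos_of_neg_of_neg hc h3)
    rw [div_mul_cancel₀ _ h3.ne] at h2
    exact lt_irrefl _ h2
  let c : ℝ := f (1, 0)
  let l : Y →L[ℝ] ℝ := f.comp (ContinuousLinearMap.inr ℝ ℝ Y)
  have hf : ∀ r y, f (r, y) = c * r + l y := by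
    intro r y
    have : ((r, y) : ℝ × Y) = r • ((1 : ℝ), (0 : Y)) + (0, y) := by simp
    rw [this, map_add, map_smul, smul_eq_mul, mul_comm]
    rfl
  simp only [hf, map_neg] at hnp
  have hc : 0 ≤ c := by
    by_contra! hc
    have h1 := hnp (-((|l e| + 1) / (-c))) (by
      have : 0 < (|l e| + 1) / (-c) := div_pos (by positivity) (by linarith)
      linarith) e he
    have h2 : c * (-((|l e| + 1) / (-c))) = |l e| + 1 := by
      field_simp [hc.ne]
    rw [h2] at h1
    linarith [le_abs_self (l e)]
  have hl : ∀ y ∈ interior C, 0 ≤ l y := by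
    intro y hy
    by_contra! h
    have hp : 0 < -l y / (2 * (c + 1)) := div_pos (by linarith) (by linarith)
    have h1 := hnp (-(-l y / (2 * (c + 1)))) (by linarith) y hy
    have h2 : 2 * (c + 1) * (-l y / (2 * (c + 1))) = -l y := by
      field_simp
    nlinarith
  have hlC : ∀ y ∈ C, 0 ≤ l y := by
    intro y hy
    by_contra! h
    have h1 := hl e he
    have hα : 0 < -l y / (2 * (l e + 1)) := div_pos (by linarith) (by linarith)
    have h2 := hl _ (hCi_add y hy _ (hCi_smul e he _ hα))
    rw [map_add, map_smul, smul_eq_mul] at h2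
    have h3 : 2 * (l e + 1) * (-l y / (2 * (l e + 1))) = -l y := by
      field_simp
    nlinarith
  have hmain : ∀ h, u ≤ c * J' h + l (S g₀ + S' h) := by
    intro h
    rw [← hf]
    exact hft _ ⟨h, le_rfl, by simpa using h0C⟩
  have hJ0 : J' 0 = 0 := by
    refine tendsto_nhds_unique (hJ' 0) ?_
    simp
  have hS0 : S' 0 = 0 := by
    refine tendsto_nhds_unique (hS' 0) ?_
    simp
  have hlg : l (S g₀) = 0 := by
    have h1 := hmain 0
    have h2 := hlC _ hg
    simp only [hJ0, hS0, add_zero, mul_zero, zero_add] at h1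
    rw [map_neg] at h2
    linarith
  refine ⟨c, l, hc, hlC, ?_, ?_, hlg⟩
  · rintro ⟨h1, h2⟩
    have h3 := hmain 0
    have h4 := hcone (-1) (by norm_num) e he 1 one_pos
    rw [hf, h1, h2] at h4
    rw [h1, h2] at h3
    simp at h3 h4
    linarith
  · intro h
    have := hmain h
    rw [map_add, hlg] at this
    linarith
end

section
/- Let M be a bounded open subset of ℝ² with finite Lebesgue measure λ, and let f, g : M → [0, ∞) be bounded measurable functions. Then ∫_M f(x) g(x) dλ(x) ≤ ∫₀^{λ(M)} f*(s) g*(s) ds, where f* and g* are the decreasing rearrangements of f and g. -/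
open MeasureTheory

noncomputable section

/-- The distribution function `d_h(t) = λ({x ∈ M : h(x) > t})` (as a real number). -/
def distFun (μ : Measure (ℝ × ℝ)) (h : ℝ × ℝ → ℝ) (t : ℝ) : ℝ :=
  (μ {x | t < h x}).toReal

/-- The decreasing rearrangement `h*(s) = sup {τ ≥ 0 : d_h(τ) > s}`
(with `sup ∅ = 0`). -/
def decRearrangement (μ : Measure (ℝ × ℝ)) (h : ℝ × ℝ → ℝ) (s : ℝ) : ℝ :=
  sSup {τ : ℝ | 0 ≤ τ ∧ s < distFun μ h τ}

lemma distFun_antitone (μ : Measure (ℝ × ℝ)) [IsFiniteMeasure μ] (h : ℝ × ℝ → ℝ) :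
    Antitone (distFun μ h) := by
  intro a b hab
  unfold distFun
  apply ENNReal.toReal_mono (measure_ne_top _ _)
  apply measure_mono
  intro x hx
  exact lt_of_le_of_lt hab hx

lemma set_bound (μ : Measure (ℝ × ℝ)) (h : ℝ × ℝ → ℝ) (C : ℝ)
    (hC : ∀ᵐ x ∂μ, h x ≤ C) (u : ℝ) (hu : 0 ≤ u) (τ : ℝ) (hτ : u < distFun μ h τ) :
    τ ≤ C := by
  by_contra hc
  push Not at hc
  have : μ {x | τ < h x} = 0 := by
    rw [measure_eq_zero_iff_ae_notMem]
    filter_upwards [hC] with x hx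
    simp only [not_lt]
    linarith
  unfold distFun at hτ
  rw [this] at hτ
  simp at hτ
  linarith

lemma rearr_nonneg (μ : Measure (ℝ × ℝ)) (h : ℝ × ℝ → ℝ) (u : ℝ) :
    0 ≤ decRearrangement μ h u := Real.sSup_nonneg (fun _ hx => hx.1)

lemma rearr_le (μ : Measure (ℝ × ℝ)) (h : ℝ × ℝ → ℝ) (C : ℝ)
    (hC : ∀ᵐ x ∂μ, h x ≤ C) (u : ℝ) (hu : 0 ≤ u) :
    decRearrangement μ h u ≤ max C 0 :=
  Real.sSup_le (fun τ hτ => le_max_of_le_left (set_bound μ h C hC u hu τ hτ.2))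
    (le_max_right _ _)

lemma le_rearr (μ : Measure (ℝ × ℝ)) (h : ℝ × ℝ → ℝ) (C : ℝ)
    (hC : ∀ᵐ x ∂μ, h x ≤ C) (u : ℝ) (hu : 0 ≤ u) (s : ℝ) (hs : 0 ≤ s)
    (hus : u < distFun μ h s) :
    s ≤ decRearrangement μ h u :=
  le_csSup ⟨C, fun τ hτ => set_bound μ h C hC u hu τ hτ.2⟩ ⟨hs, hus⟩

lemma rearr_meas (μ : Measure (ℝ × ℝ)) (h : ℝ × ℝ → ℝ) (C : ℝ)
    (hC : ∀ᵐ x ∂μ, h x ≤ C) :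
    Measurable (fun u => decRearrangement μ h (max u 0)) := by
  apply Antitone.measurable
  intro a b hab
  have hab' : max a 0 ≤ max b 0 := max_le_max_right 0 hab
  refine Real.sSup_le (fun τ hτ => ?_) (rearr_nonneg _ _ _)
  exact le_rearr μ h C hC _ (le_max_right _ _) τ hτ.1 (hab'.trans_lt hτ.2)

lemma hl_lintegral (μ : Measure (ℝ × ℝ)) [IsFiniteMeasure μ] (f g : ℝ × ℝ → ℝ)
    (hfm : Measurable f) (hgm : Measurable g) (Cf Cg : ℝ)
    (hf : ∀ᵐ x ∂μ, f x ≤ Cf) (hg : ∀ᵐ x ∂μ, g x ≤ Cg) :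
    ∫⁻ x, ENNReal.ofReal (f x) * ENNReal.ofReal (g x) ∂μ ≤
    ∫⁻ u in Set.Ioc 0 (μ Set.univ).toReal,
      ENNReal.ofReal (decRearrangement μ f (max u 0))
        * ENNReal.ofReal (decRearrangement μ g (max u 0)) := by
  set φ := fun u => decRearrangement μ f (max u 0) with hφ
  set ψ := fun u => decRearrangement μ g (max u 0) with hψ
  have hφm : Measurable φ := rearr_meas μ f Cf hf
  have hψm : Measurable ψ := rearr_meas μ g Cg hg
  set ν := (volume : Measure ℝ).restrict (Set.Ioc 0 (μ Set.univ).toReal) with hν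
  let A : Set ((ℝ × ℝ) × (ℝ × ℝ)) :=
    {p | (0 ≤ p.2.1 ∧ p.2.1 < f p.1) ∧ (0 ≤ p.2.2 ∧ p.2.2 < g p.1)}
  let B : Set (ℝ × (ℝ × ℝ)) :=
    {p | (0 ≤ p.2.1 ∧ p.2.1 ≤ φ p.1) ∧ (0 ≤ p.2.2 ∧ p.2.2 ≤ ψ p.1)}
  have hA : MeasurableSet A := by
    have a1 : MeasurableSet {p : (ℝ × ℝ) × (ℝ × ℝ) | 0 ≤ p.2.1} :=
      measurableSet_le (by fun_prop) (by fun_prop)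
    have a2 : MeasurableSet {p : (ℝ × ℝ) × (ℝ × ℝ) | p.2.1 < f p.1} :=
      measurableSet_lt (by fun_prop) (by fun_prop)
    have a3 : MeasurableSet {p : (ℝ × ℝ) × (ℝ × ℝ) | 0 ≤ p.2.2} :=
      measurableSet_le (by fun_prop) (by fun_prop)
    have a4 : MeasurableSet {p : (ℝ × ℝ) × (ℝ × ℝ) | p.2.2 < g p.1} :=
      measurableSet_lt (by fun_prop) (by fun_prop)
    exact (a1.inter a2).inter (a3.inter a4)
  have hB : MeasurableSet B := by
    have a1 : MeasurableSet {p : ℝ × (ℝ × ℝ) | 0 ≤ p.2.1} :=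
      measurableSet_le (by fun_prop) (by fun_prop)
    have a2 : MeasurableSet {p : ℝ × (ℝ × ℝ) | p.2.1 ≤ φ p.1} :=
      measurableSet_le (by fun_prop) (by fun_prop)
    have a3 : MeasurableSet {p : ℝ × (ℝ × ℝ) | 0 ≤ p.2.2} :=
      measurableSet_le (by fun_prop) (by fun_prop)
    have a4 : MeasurableSet {p : ℝ × (ℝ × ℝ) | p.2.2 ≤ ψ p.1} :=
      measurableSet_le (by fun_prop) (by fun_prop)
    exact (a1.inter a2).inter (a3.inter a4)
  have h1 : ∫⁻ x, ENNReal.ofReal (f x) * ENNReal.ofReal (g x) ∂μ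
      = (μ.prod (volume : Measure (ℝ × ℝ))) A := by
    rw [Measure.prod_apply hA]
    congr 1
    ext x
    have : Prod.mk x ⁻¹' A = Set.Ico 0 (f x) ×ˢ Set.Ico 0 (g x) := by
      ext p; simp [A]
    rw [this, Measure.volume_eq_prod, Measure.prod_prod]
    simp
  have h2 : ∫⁻ u, ENNReal.ofReal (φ u) * ENNReal.ofReal (ψ u) ∂ν
      = (ν.prod (volume : Measure (ℝ × ℝ))) B := by
    rw [Measure.prod_apply hB]
    congr 1
    ext x
    have : Prod.mk x ⁻¹' B = Set.Icc 0 (φ x) ×ˢ Set.Icc 0 (ψ x) := by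
      ext p; simp only [Set.mem_prod, Set.mem_Icc]; rfl
    rw [this, Measure.volume_eq_prod, Measure.prod_prod]
    simp
  rw [h1]
  refine le_of_le_of_eq ?_ h2.symm
  rw [Measure.prod_apply_symm hA, Measure.prod_apply_symm hB]
  apply lintegral_mono
  rintro ⟨s, t⟩
  by_cases hst : 0 ≤ s ∧ 0 ≤ t
  swap
  · have : (fun x => (x, (s, t))) ⁻¹' A = ∅ := by
      ext x
      simp only [A, Set.mem_preimage, Set.mem_ofPred_eq, Set.mem_empty_iff_false, iff_false]
      tauto
    simp only [this, measure_empty, zero_le]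
  obtain ⟨hs, ht⟩ := hst
  have hle : ∀ (h : ℝ × ℝ → ℝ) (r : ℝ), distFun μ h r ≤ (μ Set.univ).toReal := fun h r =>
    ENNReal.toReal_mono (measure_ne_top _ _) (measure_mono (Set.subset_univ _))
  calc μ ((fun x => (x, (s, t))) ⁻¹' A)
      ≤ min (μ {x | s < f x}) (μ {x | t < g x}) := by
        apply le_min <;> apply measure_mono <;> intro x hx
        · exact hx.1.2
        · exact hx.2.2
    _ = ENNReal.ofReal (min (distFun μ f s) (distFun μ g t)) := by
        rw [ENNReal.ofReal_min]
        unfold distFun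
        rw [ENNReal.ofReal_toReal (measure_ne_top _ _), ENNReal.ofReal_toReal (measure_ne_top _ _)]
    _ = volume (Set.Ioo 0 (min (distFun μ f s) (distFun μ g t))) := by simp
    _ = ν (Set.Ioo 0 (min (distFun μ f s) (distFun μ g t))) := by
        rw [hν, Measure.restrict_eq_self]
        intro u hu
        exact ⟨hu.1, (hu.2.le.trans (min_le_left _ _)).trans (hle f s)⟩
    _ ≤ ν ((fun x => (x, (s, t))) ⁻¹' B) := by
        apply measure_mono
        intro u hu
        have hu2 := lt_min_iff.1 hu.2
        have e : max u 0 = u := max_eq_left hu.1.le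
        refine ⟨⟨hs, ?_⟩, ⟨ht, ?_⟩⟩
        · simp only [hφ, e]
          exact le_rearr μ f Cf hf u hu.1.le s hs hu2.1
        · simp only [hψ, e]
          exact le_rearr μ g Cg hg u hu.1.le t ht hu2.2

/-- the Hardy-Littlewood inequality
`∫_M f g dλ ≤ ∫₀^{λ(M)} f* g* ds`. -/
theorem hardy_littlewood
    (M : Set (ℝ × ℝ)) (hMopen : IsOpen M) (hMbdd : Bornology.IsBounded M)
    (f g : ℝ × ℝ → ℝ) (hfm : Measurable f) (hgm : Measurable g)
    (hf0 : ∀ x ∈ M, 0 ≤ f x) (hg0 : ∀ x ∈ M, 0 ≤ g x)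
    (Cf Cg : ℝ) (hfb : ∀ x ∈ M, f x ≤ Cf) (hgb : ∀ x ∈ M, g x ≤ Cg) :
    ∫ x, f x * g x ∂(volume.restrict M)
      ≤ ∫ s in (0:ℝ)..((volume M).toReal),
          decRearrangement (volume.restrict M) f s
            * decRearrangement (volume.restrict M) g s := by
  have hMm := hMopen.measurableSet
  have hMfin : volume M < ⊤ := hMbdd.measure_lt_top
  have : IsFiniteMeasure (volume.restrict M) := ⟨by simpa using hMfin⟩
  have hf : ∀ᵐ x ∂(volume.restrict M), f x ≤ Cf :=
    (ae_restrict_iff' hMm).2 (Filter.Eventually.of_forall hfb)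
  have hg : ∀ᵐ x ∂(volume.restrict M), g x ≤ Cg :=
    (ae_restrict_iff' hMm).2 (Filter.Eventually.of_forall hgb)
  have hf0' : ∀ᵐ x ∂(volume.restrict M), 0 ≤ f x :=
    (ae_restrict_iff' hMm).2 (Filter.Eventually.of_forall hf0)
  have hg0' : ∀ᵐ x ∂(volume.restrict M), 0 ≤ g x :=
    (ae_restrict_iff' hMm).2 (Filter.Eventually.of_forall hg0)
  have key := hl_lintegral (volume.restrict M) f g hfm hgm Cf Cg hf hg
  rw [Measure.restrict_apply_univ] at key
  set μ := (volume : Measure (ℝ × ℝ)).restrict M with hμ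
  rw [intervalIntegral.integral_of_le ENNReal.toReal_nonneg]
  have hR : ∫ s in Set.Ioc 0 (volume M).toReal, decRearrangement μ f s * decRearrangement μ g s
      = ∫ s in Set.Ioc 0 (volume M).toReal,
        decRearrangement μ f (max s 0) * decRearrangement μ g (max s 0) := by
    apply setIntegral_congr_fun measurableSet_Ioc
    intro u hu
    have e : max u 0 = u := max_eq_left hu.1.le
    simp only [e]
  have hm : Measurable (fun s => decRearrangement μ f (max s 0) * decRearrangement μ g (max s 0)) :=
    (rearr_meas μ f Cf hf).mul (rearr_meas μ g Cg hg)
  have hfg : Measurable (fun x => f x * g x) := hfm.mul hgm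
  rw [hR, integral_eq_lintegral_of_nonneg_ae
      (by filter_upwards [hf0', hg0'] with x h1 h2 using mul_nonneg h1 h2)
      hfg.aestronglyMeasurable,
    integral_eq_lintegral_of_nonneg_ae
      (Filter.Eventually.of_forall fun u => mul_nonneg (rearr_nonneg _ _ _) (rearr_nonneg _ _ _))
      hm.aestronglyMeasurable]
  have e1 : ∫⁻ x, ENNReal.ofReal (f x * g x) ∂μ
      = ∫⁻ x, ENNReal.ofReal (f x) * ENNReal.ofReal (g x) ∂μ := by
    apply lintegral_congr_ae
    filter_upwards [hf0'] with x h1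
    exact ENNReal.ofReal_mul h1
  have e2 : ∀ u, ENNReal.ofReal (decRearrangement μ f (max u 0) * decRearrangement μ g (max u 0))
      = ENNReal.ofReal (decRearrangement μ f (max u 0))
        * ENNReal.ofReal (decRearrangement μ g (max u 0)) := fun u =>
    ENNReal.ofReal_mul (rearr_nonneg _ _ _)
  apply ENNReal.toReal_mono
  · refine ne_of_lt (lt_of_le_of_lt (lintegral_mono (g := fun _ =>
      ENNReal.ofReal (max Cf 0 * max Cg 0)) fun u => ?_) ?_)
    · apply ENNReal.ofReal_le_ofReal
      exact mul_le_mul (rearr_le μ f Cf hf _ (le_max_right _ _))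
        (rearr_le μ g Cg hg _ (le_max_right _ _)) (rearr_nonneg _ _ _) (le_max_right _ _)
    · rw [lintegral_const]
      apply ENNReal.mul_lt_top ENNReal.ofReal_lt_top
      simp
  · rw [e1]
    simp only [e2]
    exact key

end
end
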